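/- arXiv:0809.4966 — 2 statements merged into one kernel-verified Lean document; each statement's English description precedes it below -/
import Mathlib

section
/- Fix integers n ≥ 2 and 1 ≤ k ≤ n−1. In R = ℤ[τ_1,…,τ_{n+k}], with the conventions τ_0 = 1, τ_p = 0 for p < 0 or p > n+k, and δ_p = 1 for p ≤ k, δ_p = 2 for p > k, let I ⊆ R be the ideal generated by: det(δ_{1+j−i} τ_{1+j−i})_{1≤i,j≤r} for n−k+1 ≤ r ≤ n; ∑_{p=k+1}^{r} (−1)^p τ_p · det(δ_{1+j−i} τ_{1+j−i})_{1≤i,j≤r−p} for n+1 ≤ r ≤ n+k; and τ_r² + ∑_{i=1}^{r} (−1)^i δ_{r−i} τ_{r+i} τ_{r−i} for k+1 ≤ r ≤ n. Then R/I is a free ℤ-module of rank 2^{n−k} · binom(n, k). -/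
open MvPolynomial

/-- The element `τ_p` of `R = ℤ[τ_1,…,τ_{n+k}]`, with the conventions `τ_0 = 1`
and `τ_p = 0` for `p < 0` or `p > n+k`. -/
noncomputable def tGen (n k : ℕ) (p : ℤ) : MvPolynomial (Fin (n + k)) ℤ :=
  if h : 1 ≤ p ∧ p ≤ n + k then X ⟨p.toNat - 1, by omega⟩
  else if p = 0 then 1 else 0

/-- `δ_p = 1` for `p ≤ k` and `δ_p = 2` for `p > k`, as a constant of the ring. -/
noncomputable def dlt (n k : ℕ) (p : ℤ) : MvPolynomial (Fin (n + k)) ℤ :=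
  if p ≤ k then 1 else 2

/-- The `r × r` determinant `det(δ_{1+j-i} τ_{1+j-i})_{1 ≤ i,j ≤ r}`. -/
noncomputable def tDet (n k : ℕ) (r : ℕ) : MvPolynomial (Fin (n + k)) ℤ :=
  (Matrix.of fun i j : Fin r =>
    dlt n k (1 + (j : ℤ) - (i : ℤ)) * tGen n k (1 + (j : ℤ) - (i : ℤ))).det

/-- The relation `∑_{p=k+1}^{r} (−1)^p τ_p · det(δ_{1+j-i} τ_{1+j-i})_{1≤i,j≤r−p}`. -/
noncomputable def tSumRel (n k : ℕ) (r : ℕ) : MvPolynomial (Fin (n + k)) ℤ :=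
  ∑ p ∈ Finset.Icc (k + 1) r,
    (-1 : MvPolynomial (Fin (n + k)) ℤ) ^ p * tGen n k p * tDet n k (r - p)

/-- The quadratic relation `τ_r² + ∑_{i=1}^{r} (−1)^i δ_{r−i} τ_{r+i} τ_{r−i}`. -/
noncomputable def tQuadRel (n k : ℕ) (r : ℕ) : MvPolynomial (Fin (n + k)) ℤ :=
  tGen n k r ^ 2 +
    ∑ i ∈ Finset.Icc 1 r,
      (-1 : MvPolynomial (Fin (n + k)) ℤ) ^ i * dlt n k ((r : ℤ) - i) *
        tGen n k (r + i) * tGen n k ((r : ℤ) - i)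

namespace OGp

section Groebner
variable {A : Type} [CommRing A] {m : ℕ}

/-- polynomials all of whose monomials have weight `< d`. -/
noncomputable def FF (A : Type) [CommRing A] {m : ℕ} (w : Fin m → ℕ) (d : ℕ) : Submodule A (MvPolynomial (Fin m) A) :=
  restrictSupport A {β | Finsupp.weight w β < d}

lemma mem_FF {w : Fin m → ℕ} {d : ℕ} {p : MvPolynomial (Fin m) A} :
    p ∈ FF A w d ↔ ∀ β, coeff β p ≠ 0 → Finsupp.weight w β < d := by
  rw [FF, mem_restrictSupport_iff]
  constructor
  · intro h β hβ
    exact h (by simpa using hβ)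
  · intro h β hβ
    exact h β (by simpa using hβ)

lemma FF_mono {w : Fin m → ℕ} {d e : ℕ} (h : d ≤ e) {p : MvPolynomial (Fin m) A}
    (hp : p ∈ FF A w d) : p ∈ FF A w e := by
  rw [mem_FF] at *
  intro β hβ
  exact lt_of_lt_of_le (hp β hβ) h

lemma monomial_mem_FF {w : Fin m → ℕ} {d : ℕ} {β : Fin m →₀ ℕ} (h : Finsupp.weight w β < d) (a : A) :
    monomial β a ∈ FF A w d := by
  classical
  rw [mem_FF]
  intro γ hγ
  rw [coeff_monomial] at hγ
  split_ifs at hγ with h1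
  · rwa [← h1]
  · exact absurd rfl hγ

lemma mul_mem_FF {w : Fin m → ℕ} {d e : ℕ} {p q : MvPolynomial (Fin m) A}
    (hp : p ∈ FF A w d) (hq : q ∈ FF A w (e + 1)) : p * q ∈ FF A w (d + e) := by
  classical
  rw [mem_FF] at *
  intro β hβ
  rw [coeff_mul] at hβ
  obtain ⟨x, hx, hx2⟩ := Finset.exists_ne_zero_of_sum_ne_zero hβ
  have h1 := hp x.1 (left_ne_zero_of_mul hx2)
  have h2 := hq x.2 (right_ne_zero_of_mul hx2)
  have hx := Finset.HasAntidiagonal.mem_antidiagonal.1 hx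
  rw [← hx, map_add]
  omega

/-- `p = y^β + lower weight`. -/
def Lead (w : Fin m → ℕ) (β : Fin m →₀ ℕ) (p : MvPolynomial (Fin m) A) : Prop :=
  p - monomial β 1 ∈ FF A w (Finsupp.weight w β)

lemma Lead.mem {w : Fin m → ℕ} {β : Fin m →₀ ℕ} {p : MvPolynomial (Fin m) A} (h : Lead w β p) :
    p ∈ FF A w (Finsupp.weight w β + 1) := by
  have := (FF A w (Finsupp.weight w β + 1)).add_mem (FF_mono (Nat.le_succ _) h)
    (monomial_mem_FF (Nat.lt_succ_self _) 1)
  simpa using this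

lemma Lead.mul {w : Fin m → ℕ} {β γ : Fin m →₀ ℕ} {p q : MvPolynomial (Fin m) A}
    (hp : Lead w β p) (hq : Lead w γ q) : Lead w (β + γ) (p * q) := by
  have h1 : p * q - monomial (β + γ) 1
      = (p - monomial β 1) * q + (q - monomial γ 1) * monomial β 1 := by
    have : (monomial (β + γ) 1 : MvPolynomial (Fin m) A) = monomial β 1 * monomial γ 1 := by
      rw [monomial_mul, one_mul]
    rw [this]; ring
  rw [Lead, h1, map_add]
  apply Submodule.add_mem
  · exact mul_mem_FF hp hq.mem
  · rw [add_comm]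
    exact mul_mem_FF hq (monomial_mem_FF (Nat.lt_succ_self _) 1)

lemma Lead.one {w : Fin m → ℕ} : Lead w 0 (1 : MvPolynomial (Fin m) A) := by
  simp [Lead]

lemma Lead.pow {w : Fin m → ℕ} {β : Fin m →₀ ℕ} {p : MvPolynomial (Fin m) A}
    (hp : Lead w β p) (j : ℕ) : Lead w (j • β) (p ^ j) := by
  induction j with
  | zero => simpa using Lead.one
  | succ j ih => rw [succ_nsmul, pow_succ]; exact ih.mul hp

lemma Lead.prod {w : Fin m → ℕ} {ι : Type} (s : Finset ι) (β : ι → Fin m →₀ ℕ)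
    (p : ι → MvPolynomial (Fin m) A) (h : ∀ i ∈ s, Lead w (β i) (p i)) :
    Lead w (∑ i ∈ s, β i) (∏ i ∈ s, p i) := by
  classical
  induction s using Finset.induction_on with
  | empty => simpa using Lead.one
  | insert a s ha ih =>
    rw [Finset.sum_insert ha, Finset.prod_insert ha]
    exact (h a (by simp)).mul (ih fun i hi => h i (by simp [hi]))

noncomputable def ee (z : Fin m → MvPolynomial (Fin m) A) (β : Fin m →₀ ℕ) : MvPolynomial (Fin m) A :=
  ∏ i, (z i ^ (β i / 2) * X i ^ (β i % 2))

lemma ee_lead {w : Fin m → ℕ} {z : Fin m → MvPolynomial (Fin m) A}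
    (hz : ∀ i, Lead w (Finsupp.single i 2) (z i)) (β : Fin m →₀ ℕ) : Lead w β (ee z β) := by
  classical
  have hX : ∀ i : Fin m, Lead w (Finsupp.single i 1) (X i : MvPolynomial (Fin m) A) := by
    intro i; simp [Lead, X]
  have := Lead.prod (w := w) Finset.univ
    (fun i => (β i / 2) • Finsupp.single i 2 + (β i % 2) • Finsupp.single i 1)
    (fun i => z i ^ (β i / 2) * X i ^ (β i % 2))
    (fun i _ => ((hz i).pow _).mul ((hX i).pow _))
  convert this using 1
  ext j
  rw [Finsupp.finsetSum_apply, Finset.sum_eq_single j]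
  · simp
    omega
  · intro i _ hij
    simp [hij]
  · simp
  rfl

noncomputable def phi (z : Fin m → MvPolynomial (Fin m) A) :
    MvPolynomial (Fin m) A →ₗ[A] MvPolynomial (Fin m) A :=
  (basisMonomials (Fin m) A).constr A (ee z)

lemma phi_monomial (z : Fin m → MvPolynomial (Fin m) A) (β) : phi z (monomial β 1) = ee z β := by
  have := (basisMonomials (Fin m) A).constr_basis A (ee z) β
  simpa [phi] using this

lemma phi_eq_sum (z : Fin m → MvPolynomial (Fin m) A) (p) :
    phi z p = ∑ β ∈ p.support, coeff β p • ee z β := by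
  conv_lhs => rw [p.as_sum]
  rw [map_sum]
  refine Finset.sum_congr rfl fun β _ => ?_
  rw [← phi_monomial, ← map_smul, smul_monomial, smul_eq_mul, mul_one]

lemma phi_inj {w : Fin m → ℕ} {z : Fin m → MvPolynomial (Fin m) A}
    (hz : ∀ i, Lead w (Finsupp.single i 2) (z i)) : Function.Injective (phi z) := by
  classical
  rw [injective_iff_map_eq_zero]
  intro p hp
  by_contra hne
  have hs : p.support.Nonempty := by
    rwa [Finset.nonempty_iff_ne_empty, Ne, support_eq_empty]
  obtain ⟨γ, hγ, hmax⟩ := p.support.exists_max_image (Finsupp.weight w) hs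
  have h1 : p - phi z p ∈ FF A w (Finsupp.weight w γ) := by
    rw [phi_eq_sum]
    conv in (p - _) => lhs; rw [p.as_sum]
    rw [← Finset.sum_sub_distrib]
    refine Submodule.sum_mem _ fun β hβ => ?_
    have := ee_lead hz β
    have h2 := FF_mono (hmax β hβ) ((FF A w _).smul_mem (-(coeff β p)) this)
    convert h2 using 1
    rw [smul_sub, smul_monomial]
    simp
    ring
  rw [hp, sub_zero, mem_FF] at h1
  exact lt_irrefl _ (h1 γ (by simpa using hγ))

lemma phi_surj {w : Fin m → ℕ} {z : Fin m → MvPolynomial (Fin m) A}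
    (hz : ∀ i, Lead w (Finsupp.single i 2) (z i)) : Function.Surjective (phi z) := by
  have key : ∀ d, ∀ p ∈ FF A w d, p ∈ LinearMap.range (phi z) := by
    intro d
    induction d with
    | zero =>
      intro p hp
      rw [mem_FF] at hp
      have : p = 0 := by
        ext β
        by_contra h
        exact absurd (hp β (by simpa using h)) (by omega)
      rw [this]; exact Submodule.zero_mem _
    | succ d ih =>
      intro p hp
      rw [p.as_sum]
      refine Submodule.sum_mem _ fun β hβ => ?_
      have hw := mem_FF.1 hp β (by simpa using hβ)
      have h1 : (monomial β 1 : MvPolynomial (Fin m) A) ∈ LinearMap.range (phi z) := by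
        have h2 := ih _ (FF_mono (Nat.lt_succ_iff.1 hw) (ee_lead hz β))
        have h3 : ee z β ∈ LinearMap.range (phi z) := ⟨_, phi_monomial z β⟩
        have := Submodule.sub_mem _ h3 h2
        simpa using this
      have := (LinearMap.range (phi z)).smul_mem (coeff β p) h1
      simpa [smul_monomial] using this
  intro p
  have : p ∈ FF A w (p.support.sup (Finsupp.weight w) + 1) := by
    rw [mem_FF]
    intro β hβ
    exact Nat.lt_succ_iff.2 (Finset.le_sup (f := Finsupp.weight w) (by simpa using hβ))
  exact key _ p this

lemma ee_mul (z : Fin m → MvPolynomial (Fin m) A) (r : Fin m) (β) :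
    z r * ee z β = ee z (β + Finsupp.single r 2) := by
  classical
  have h : z r = ∏ i, if i = r then z r else 1 := by simp
  simp only [ee]
  rw [h, ← Finset.prod_mul_distrib]
  refine Finset.prod_congr rfl fun i _ => ?_
  by_cases hi : i = r
  · subst hi
    have h1 : (β i + 2) / 2 = β i / 2 + 1 := by omega
    have h2 : (β i + 2) % 2 = β i % 2 := by omega
    simp [h1, h2]
    ring
  · simp [hi, Finsupp.single_apply, Ne.symm hi]

theorem quad_free (w : Fin m → ℕ) (z : Fin m → MvPolynomial (Fin m) A)
    (hz : ∀ i, Lead w (Finsupp.single i 2) (z i)) :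
    Nonempty (Module.Basis (Fin (2 ^ m)) A (MvPolynomial (Fin m) A ⧸ Ideal.span (Set.range z))) := by
  classical
  let I := Ideal.span (Set.range z)
  let Φ : MvPolynomial (Fin m) A ≃ₗ[A] MvPolynomial (Fin m) A :=
    LinearEquiv.ofBijective (phi z) ⟨phi_inj hz, phi_surj hz⟩
  have hΦ : ∀ β, Φ (monomial β 1) = ee z β := fun β => phi_monomial z β
  let π0 : MvPolynomial (Fin m) A →ₗ[A] ((Fin m → Fin 2) →₀ A) :=
    (basisMonomials (Fin m) A).constr A
      (fun β => if ∀ i, β i < 2 then Finsupp.single (fun i => ⟨β i % 2, Nat.mod_lt _ (by norm_num)⟩) 1 else 0)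
  let π := π0 ∘ₗ Φ.symm.toLinearMap
  have hπ : ∀ β, π (ee z β) = if ∀ i, β i < 2 then Finsupp.single (fun i => ⟨β i % 2, Nat.mod_lt _ (by norm_num)⟩) 1 else 0 := by
    intro β
    have : Φ.symm (ee z β) = basisMonomials (Fin m) A β := by
      rw [← hΦ, LinearEquiv.symm_apply_apply, coe_basisMonomials]
    simp only [π, LinearMap.comp_apply, LinearEquiv.coe_coe, this]
    exact (basisMonomials (Fin m) A).constr_basis A _ β
  have hext : ∀ (N : Type) [AddCommGroup N] [Module A N] (f g : MvPolynomial (Fin m) A →ₗ[A] N),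
      (∀ β, f (ee z β) = g (ee z β)) → f = g := by
    intro N _ _ f g h
    have : f ∘ₗ Φ.toLinearMap = g ∘ₗ Φ.toLinearMap := by
      refine (basisMonomials (Fin m) A).ext fun β => ?_
      simp only [LinearMap.comp_apply, LinearEquiv.coe_coe, coe_basisMonomials, hΦ, h]
    refine LinearMap.ext fun p => ?_
    have h3 := LinearMap.congr_fun this (Φ.symm p)
    simpa using h3
  have hker : I.restrictScalars A ≤ LinearMap.ker π := by
    intro p hp
    rw [LinearMap.mem_ker]
    have hp' : p ∈ I := hp
    obtain ⟨c, hc⟩ := (Ideal.mem_span_range_iff_exists_fun).1 hp'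
    rw [← hc, map_sum]
    refine Finset.sum_eq_zero fun r _ => ?_
    have h0 : π ∘ₗ LinearMap.mulLeft A (z r) = 0 := by
      refine hext _ _ _ fun β => ?_
      rw [LinearMap.comp_apply, LinearMap.mulLeft_apply, ee_mul, hπ, if_neg]
      · rfl
      · intro h
        have := h r
        simp at this
    have := LinearMap.congr_fun h0 (c r)
    simpa [mul_comm] using this
  let πb : (MvPolynomial (Fin m) A ⧸ I) →ₗ[A] ((Fin m → Fin 2) →₀ A) :=
    (Submodule.liftQ (I.restrictScalars A) π hker)
  let em : (Fin m → Fin 2) → (Fin m →₀ ℕ) := fun s => Finsupp.equivFunOnFinite.symm (fun i => (s i : ℕ))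
  let inv : ((Fin m → Fin 2) →₀ A) →ₗ[A] (MvPolynomial (Fin m) A ⧸ I) :=
    Finsupp.linearCombination A (fun s => Ideal.Quotient.mk I (ee z (em s)))
  have hπb : ∀ p, πb (Ideal.Quotient.mk I p) = π p := fun p => rfl
  have h1 : πb ∘ₗ inv = LinearMap.id := by
    refine Finsupp.lhom_ext' fun s => LinearMap.ext_ring ?_
    simp only [LinearMap.comp_apply, Finsupp.lsingle_apply, inv, Finsupp.linearCombination_single,
      one_smul, hπb, hπ, LinearMap.id_apply]
    rw [if_pos]
    · congr 1
      ext i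
      simp [em]
      omega
    · intro i
      simp [em]
      omega
  have h2' : (inv ∘ₗ πb) ∘ₗ (Ideal.Quotient.mkₐ A I).toLinearMap = (Ideal.Quotient.mkₐ A I).toLinearMap := by
    refine hext _ _ _ fun β => ?_
    simp only [LinearMap.comp_apply, AlgHom.toLinearMap_apply, Ideal.Quotient.mkₐ_eq_mk, hπb, hπ]
    split_ifs with h
    · simp only [inv, Finsupp.linearCombination_single, one_smul]
      congr 2
      ext i
      have := h i
      simp [em]
      omega
    · rw [map_zero]
      push Not at h
      obtain ⟨r, hr⟩ := h
      symm
      rw [Ideal.Quotient.eq_zero_iff_mem]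
      have : β = (β - Finsupp.single r 2) + Finsupp.single r 2 := by
        ext i
        by_cases hi : i = r
        · subst hi; simp; omega
        · simp [Finsupp.single_apply, Ne.symm hi]
      rw [this, ← ee_mul]
      exact Ideal.mul_mem_right _ _ (Ideal.subset_span ⟨r, rfl⟩)
  have h2 : inv ∘ₗ πb = LinearMap.id := by
    refine LinearMap.ext fun q => ?_
    obtain ⟨p, rfl⟩ := Ideal.Quotient.mk_surjective q
    exact LinearMap.congr_fun h2' p
  let E : (MvPolynomial (Fin m) A ⧸ I) ≃ₗ[A] ((Fin m → Fin 2) →₀ A) := LinearEquiv.ofLinearMap πb inv h1 h2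
  have B := Module.Basis.ofRepr E
  exact ⟨B.reindex (Fintype.equivFinOfCardEq (by simp))⟩

end Groebner


section Quad
open PowerSeries

/-- `f(-t)`. -/
noncomputable abbrev ng {T : Type} [CommRing T] : PowerSeries T →+* PowerSeries T := PowerSeries.evalNegHom

lemma coeff_ng {T : Type} [CommRing T] (p : PowerSeries T) (i : ℕ) :
    PowerSeries.coeff i (ng p) = (-1) ^ i * PowerSeries.coeff i p := by
  simp [ng, PowerSeries.evalNegHom, PowerSeries.coeff_rescale]

lemma map_ng {T S : Type} [CommRing T] [CommRing S] (f : T →+* S) (p : PowerSeries T) :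
    PowerSeries.map f (ng p) = ng (PowerSeries.map f p) := by
  ext i
  simp only [PowerSeries.coeff_map, coeff_ng]
  simp

lemma map_map_ps {T S U : Type} [CommRing T] [CommRing S] [CommRing U] (f : T →+* S) (f' : S →+* U)
    (p : PowerSeries T) : PowerSeries.map f' (PowerSeries.map f p) = PowerSeries.map (f'.comp f) p := by
  ext i
  simp

/-- The power series `∑ y_i t^i`, `1 ≤ i ≤ m`. -/
noncomputable def YS {T : Type} [CommRing T] (m : ℕ) (y : Fin m → T) : PowerSeries T :=
  PowerSeries.mk fun i => if h : 1 ≤ i ∧ i ≤ m then y ⟨i - 1, by omega⟩ else 0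

lemma coeff_YS {T : Type} [CommRing T] {m : ℕ} (y : Fin m → T) (i : ℕ) :
    PowerSeries.coeff i (YS m y) = if h : 1 ≤ i ∧ i ≤ m then y ⟨i - 1, by omega⟩ else 0 := by
  simp [YS]

lemma map_YS {T S : Type} [CommRing T] [CommRing S] (f : T →+* S) {m : ℕ} (y : Fin m → T) :
    PowerSeries.map f (YS m y) = YS m (fun i => f (y i)) := by
  ext i
  simp only [PowerSeries.coeff_map, coeff_YS]
  split_ifs <;> simp

/-- The quadratic form relation. -/
noncomputable def QR {T : Type} [CommRing T] (g y : PowerSeries T) (r : ℕ) : T :=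
  PowerSeries.coeff (2 * r) (ng y * (y + g))

lemma map_QR {T S : Type} [CommRing T] [CommRing S] (f : T →+* S) (g y : PowerSeries T) (r : ℕ) :
    f (QR g y r) = QR (PowerSeries.map f g) (PowerSeries.map f y) r := by
  rw [QR, QR, ← PowerSeries.coeff_map, map_mul, map_ng, map_add]

lemma QR_eq_sum {T : Type} [CommRing T] (g y : PowerSeries T) (r : ℕ) :
    QR g y r = ∑ x ∈ Finset.HasAntidiagonal.antidiagonal (2 * r), (-1) ^ x.1 *
      (PowerSeries.coeff x.1 y * PowerSeries.coeff x.2 y + PowerSeries.coeff x.1 y * PowerSeries.coeff x.2 g) := by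
  rw [QR, PowerSeries.coeff_mul]
  refine Finset.sum_congr rfl fun x _ => ?_
  rw [coeff_ng, map_add]
  ring

lemma sq_aux {i j l : ℕ} (h : j + l = 2 * i) (hne : j ≠ l) : 2 * i ^ 2 < j ^ 2 + l ^ 2 := by
  zify at *
  have h2 : (0 : ℤ) < ((j : ℤ) - l) ^ 2 := by
    have : (j : ℤ) - l ≠ 0 := sub_ne_zero.2 hne
    positivity
  nlinarith

theorem Q_exists (A : Type) [CommRing A] (m : ℕ) (g : PowerSeries A) (s : ℕ → A) :
    ∃ (B : Type) (_ : CommRing B) (_ : Algebra A B) (y : Fin m → B),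
      (∀ r, 1 ≤ r → r ≤ m → QR (PowerSeries.map (algebraMap A B) g) (YS m y) r = algebraMap A B (s r)) ∧
      Nonempty (Module.Basis (Fin (2 ^ m)) A B) ∧
      (∀ (T : Type) [CommRing T] (φ : A →+* T) (y' : Fin m → T),
        (∀ r, 1 ≤ r → r ≤ m → QR (PowerSeries.map φ g) (YS m y') r = φ (s r)) →
        ∃ ψ : B →+* T, ψ.comp (algebraMap A B) = φ ∧ ∀ i, ψ (y i) = y' i) ∧
      (∀ (T : Type) [CommRing T] (ψ₁ ψ₂ : B →+* T),
        ψ₁.comp (algebraMap A B) = ψ₂.comp (algebraMap A B) → (∀ i, ψ₁ (y i) = ψ₂ (y i)) → ψ₁ = ψ₂) := by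
  classical
  let z0 : ℕ → MvPolynomial (Fin m) A := fun r => QR (PowerSeries.map MvPolynomial.C g)
    (YS m (fun i => (MvPolynomial.X i : MvPolynomial (Fin m) A))) r - MvPolynomial.C (s r)
  let z : Fin m → MvPolynomial (Fin m) A := fun i => (-1) ^ (i.1 + 1) * z0 (i.1 + 1)
  let w : Fin m → ℕ := fun i => 2 * (m + 1) ^ 2 + 1 - (i.1 + 1) ^ 2
  have hw : ∀ i : Fin m, w i + (i.1 + 1) ^ 2 = 2 * (m + 1) ^ 2 + 1 := by
    intro i
    have : (i.1 + 1) ^ 2 ≤ (m + 1) ^ 2 := Nat.pow_le_pow_left (by omega) 2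
    simp only [w]; omega
  have hz : ∀ i, Lead w (Finsupp.single i 2) (z i) := by
    intro i
    have hi2 : (i.1 + 1) ^ 2 ≤ (m + 1) ^ 2 := Nat.pow_le_pow_left (by omega) 2
    have hwi := hw i
    have hwt : Finsupp.weight w (Finsupp.single i 2) = 2 * w i := by
      simp [Finsupp.weight_single]
    rw [Lead, hwt]
    have hmem : ∀ j : ℕ, ∀ q : MvPolynomial (Fin m) A, q ∈ FF A w (2 * w i) → (-1) ^ j * q ∈ FF A w (2 * w i) := by
      intro j q hq
      rcases neg_one_pow_eq_or (MvPolynomial (Fin m) A) j with h | h <;> rw [h]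
      · simpa using hq
      · simpa using hq
    have hC : ∀ a : A, (MvPolynomial.C a : MvPolynomial (Fin m) A) ∈ FF A w (2 * w i) := by
      intro a
      refine monomial_mem_FF ?_ a
      simp
      omega
    have hlin : ∀ (j : ℕ) (a : A), PowerSeries.coeff j (YS m (fun i => (MvPolynomial.X i : MvPolynomial (Fin m) A))) * MvPolynomial.C a
        ∈ FF A w (2 * w i) := by
      intro j a
      rw [coeff_YS]
      split_ifs with hj
      · rw [mul_comm (MvPolynomial.X _), MvPolynomial.C_mul_X_eq_monomial]
        refine monomial_mem_FF ?_ a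
        have := hw ⟨j - 1, by omega⟩
        rw [Finsupp.weight_single]
        simp
        omega
      · simp
    have hquad : ∀ j l : ℕ, j + l = 2 * (i.1 + 1) → j ≠ l →
        PowerSeries.coeff j (YS m (fun i => (MvPolynomial.X i : MvPolynomial (Fin m) A))) *
        PowerSeries.coeff l (YS m (fun i => (MvPolynomial.X i : MvPolynomial (Fin m) A))) ∈ FF A w (2 * w i) := by
      intro j l hjl hne
      rw [coeff_YS, coeff_YS]
      split_ifs with hj hl
      · rw [MvPolynomial.X, MvPolynomial.X, MvPolynomial.monomial_mul]
        refine monomial_mem_FF ?_ _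
        have h1 := hw ⟨j - 1, by omega⟩
        have h2 := hw ⟨l - 1, by omega⟩
        simp only [Nat.sub_add_cancel hj.1, Nat.sub_add_cancel hl.1] at h1 h2
        rw [map_add, Finsupp.weight_single, Finsupp.weight_single]
        simp only [one_smul]
        have : 2 * (i.1 + 1) ^ 2 < j ^ 2 + l ^ 2 := by
          exact sq_aux hjl hne
        omega
      all_goals simp
    have hdiag : PowerSeries.coeff (i.1 + 1) (YS m (fun i => (MvPolynomial.X i : MvPolynomial (Fin m) A))) = MvPolynomial.X i := by
      rw [coeff_YS, dif_pos ⟨by omega, by omega⟩]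
      rfl
    have hsq : (-1 : MvPolynomial (Fin m) A) ^ (i.1 + 1) * (-1) ^ (i.1 + 1) = 1 := by
      rw [← mul_pow]; simp
    have hmain : z i - MvPolynomial.monomial (Finsupp.single i 2) 1 =
        (-1) ^ (i.1 + 1) * ((∑ x ∈ (Finset.HasAntidiagonal.antidiagonal (2 * (i.1 + 1))).erase (i.1 + 1, i.1 + 1), (-1) ^ x.1 *
          (PowerSeries.coeff x.1 (YS m (fun i => (MvPolynomial.X i : MvPolynomial (Fin m) A))) *
           PowerSeries.coeff x.2 (YS m (fun i => (MvPolynomial.X i : MvPolynomial (Fin m) A))) +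
           PowerSeries.coeff x.1 (YS m (fun i => (MvPolynomial.X i : MvPolynomial (Fin m) A))) * MvPolynomial.C (PowerSeries.coeff x.2 g)))
          + (-1) ^ (i.1 + 1) * (PowerSeries.coeff (i.1 + 1) (YS m (fun i => (MvPolynomial.X i : MvPolynomial (Fin m) A))) * MvPolynomial.C (PowerSeries.coeff (i.1 + 1) g))
          - MvPolynomial.C (s (i.1 + 1))) := by
      have hm : ((i.1 + 1, i.1 + 1) : ℕ × ℕ) ∈ Finset.HasAntidiagonal.antidiagonal (2 * (i.1 + 1)) := by
        rw [Finset.HasAntidiagonal.mem_antidiagonal]; ring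
      simp only [z, z0]
      rw [QR_eq_sum, ← Finset.add_sum_erase _ _ hm]
      simp only [hdiag, PowerSeries.coeff_map]
      have : (MvPolynomial.monomial (Finsupp.single i 2) 1 : MvPolynomial (Fin m) A) = MvPolynomial.X i * MvPolynomial.X i := by
        rw [MvPolynomial.X, MvPolynomial.monomial_mul, ← Finsupp.single_add, mul_one]
      rw [this]
      linear_combination (MvPolynomial.X i * MvPolynomial.X i) * hsq
    rw [hmain]
    refine hmem _ _ (Submodule.sub_mem _ (Submodule.add_mem _ (Submodule.sum_mem _ ?_) (hmem _ _ (hlin _ _))) (hC _))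
    intro x hx
    rw [Finset.mem_erase, Finset.HasAntidiagonal.mem_antidiagonal] at hx
    refine hmem _ _ (Submodule.add_mem _ (hquad _ _ hx.2 ?_) (hlin _ _))
    intro h
    exact hx.1 (Prod.ext (by simp; omega) (by simp; omega))
  let I := Ideal.span (Set.range z)
  refine ⟨(MvPolynomial (Fin m) A) ⧸ I, inferInstance, inferInstance, fun i => Ideal.Quotient.mk I (MvPolynomial.X i), ?_, quad_free w z hz, ?_, ?_⟩
  · intro r hr1 hr2
    have h1 : z ⟨r - 1, by omega⟩ ∈ I := Ideal.subset_span ⟨_, rfl⟩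
    have h2 : z0 r ∈ I := by
      have := I.mul_mem_left ((-1) ^ r) h1
      simp only [z, Nat.sub_add_cancel hr1] at this
      rwa [← mul_assoc, ← mul_pow, neg_one_mul, neg_neg, one_pow, one_mul] at this
    have h3 := Ideal.Quotient.eq_zero_iff_mem.2 h2
    simp only [z0] at h3
    rw [map_sub, sub_eq_zero, map_QR, map_YS] at h3
    rw [map_map_ps] at h3
    exact h3
  · intro T _ φ y' h
    have hI : ∀ a ∈ I, MvPolynomial.eval₂Hom φ y' a = 0 := by
      intro a ha
      have : I ≤ RingHom.ker (MvPolynomial.eval₂Hom φ y') := by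
        refine Ideal.span_le.2 ?_
        rintro _ ⟨i, rfl⟩
        simp only [SetLike.mem_coe, RingHom.mem_ker, z, z0]
        rw [map_mul, map_sub, map_QR, map_YS, map_map_ps]
        simp only [MvPolynomial.eval₂Hom_X', MvPolynomial.eval₂Hom_C, MvPolynomial.eval₂Hom_comp_C]
        rw [h _ (by omega) (by omega)]
        simp
      exact this ha
    refine ⟨Ideal.Quotient.lift I (MvPolynomial.eval₂Hom φ y') hI, ?_, ?_⟩
    · ext a
      exact MvPolynomial.eval₂Hom_C φ y' a
    · intro i
      exact MvPolynomial.eval₂Hom_X' φ y' i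
  · intro T _ ψ₁ ψ₂ h1 h2
    refine Ideal.Quotient.ringHom_ext ?_
    refine MvPolynomial.ringHom_ext ?_ ?_
    · intro a
      exact RingHom.congr_fun h1 a
    · intro i
      exact h2 i

end Quad


section Split
open Polynomial

lemma cancel_aux {T : Type} [CommRing T] {f a b : T[X]} (hf : f.coeff 0 = 1) (h : a * f = b * f) : a = b := by
  have hu : IsUnit (f : PowerSeries T) := by
    rw [PowerSeries.isUnit_iff_constantCoeff]
    simp [hf]
  apply Polynomial.coe_injective
  have h2 : (a : PowerSeries T) * f = b * f := by
    rw [← Polynomial.coe_mul, h, Polynomial.coe_mul]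
  exact hu.mul_right_cancel h2

lemma reflect_lin {T : Type} [CommRing T] (x : T) : reflect 1 (1 + Polynomial.C x * Polynomial.X) = Polynomial.X + Polynomial.C x := by
  ext i
  rw [coeff_reflect]
  rcases i with _ | _ | i
  · simp [revAt_le, Polynomial.coeff_one]
  · simp [revAt_le, Polynomial.coeff_one, Polynomial.coeff_C]
  · rw [revAt_eq_self_of_lt (by omega)]
    simp [Polynomial.coeff_one, Polynomial.coeff_C, Polynomial.coeff_X]

lemma lin_deg {T : Type} [CommRing T] (x : T) : (1 + Polynomial.C x * Polynomial.X : T[X]).natDegree ≤ 1 := by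
  have := natDegree_linear_le (a := x) (b := 1)
  rwa [add_comm, Polynomial.C_1] at this

lemma reflect_reflect {T : Type} [CommRing T] (n : ℕ) (p : T[X]) : reflect n (reflect n p) = p := by
  ext i
  simp [coeff_reflect]

lemma reflect_deg {T : Type} [CommRing T] (n : ℕ) (p : T[X]) (hp : p.natDegree ≤ n) :
    (reflect n p).natDegree ≤ n := by
  rw [natDegree_le_iff_coeff_eq_zero]
  intro i hi
  rw [coeff_reflect, revAt_eq_self_of_lt hi]
  exact coeff_eq_zero_of_natDegree_lt (by omega)

lemma reflect_map {T S : Type} [CommRing T] [CommRing S] (f : T →+* S) (n : ℕ) (p : T[X]) :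
    (reflect n p).map f = reflect n (p.map f) := by
  ext i
  simp [coeff_reflect]

theorem one_step (A : Type) [CommRing A] (n : ℕ) (p : A[X]) (hp : p.natDegree ≤ n + 1) (hp0 : p.coeff 0 = 1) :
    ∃ (B : Type) (_ : CommRing B) (_ : Algebra A B) (x : B) (a : B[X]),
      a.natDegree ≤ n ∧ a.coeff 0 = 1 ∧ a * (1 + Polynomial.C x * Polynomial.X) = p.map (algebraMap A B) ∧
      Nonempty (Module.Basis (Fin (n + 1)) A B) ∧
      (∀ (T : Type) [CommRing T] (φ : A →+* T) (x' : T) (a' : T[X]), a'.natDegree ≤ n →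
        a' * (1 + Polynomial.C x' * Polynomial.X) = p.map φ →
        ∃ ψ : B →+* T, ψ.comp (algebraMap A B) = φ ∧ ψ x = x') ∧
      (∀ (T : Type) [CommRing T] (ψ₁ ψ₂ : B →+* T),
        ψ₁.comp (algebraMap A B) = ψ₂.comp (algebraMap A B) → ψ₁ x = ψ₂ x → ψ₁ = ψ₂) := by
  rcases subsingleton_or_nontrivial A with hA | hA
  · -- trivial ring
    refine ⟨A, inferInstance, inferInstance, 0, 0, by simp, Subsingleton.elim _ _, Subsingleton.elim _ _, ?_, ?_, ?_⟩
    · have : Unique (Fin (n+1) →₀ A) := ⟨⟨0⟩, fun f => by ext; exact Subsingleton.elim _ _⟩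
      exact ⟨Module.Basis.ofRepr
        { toFun := fun _ => 0, invFun := fun _ => 0, left_inv := fun _ => Subsingleton.elim _ _,
          right_inv := fun _ => Subsingleton.elim _ _, map_add' := fun _ _ => Subsingleton.elim _ _,
          map_smul' := fun _ _ => Subsingleton.elim _ _ }⟩
    · intro T _ φ x' a' _ _
      have : Subsingleton T := by
        rw [← not_nontrivial_iff_subsingleton]
        intro h
        exact not_subsingleton_iff_nontrivial.2 φ.domain_nontrivial hA
      exact ⟨φ, by ext; rfl, Subsingleton.elim _ _⟩
    · intro T _ ψ₁ ψ₂ h _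
      exact h
  let q := reflect (n + 1) p
  have hq1 : q.coeff (n + 1) = 1 := by simp [q, coeff_reflect, hp0]
  have hqd : q.natDegree ≤ n + 1 := reflect_deg _ _ hp
  have hq : q.Monic := monic_of_natDegree_le_of_coeff_eq_one _ hqd hq1
  have hqd' : q.natDegree = n + 1 := natDegree_eq_of_le_of_coeff_ne_zero hqd (by rw [hq1]; exact one_ne_zero)
  let B := AdjoinRoot q
  let ρ : B := AdjoinRoot.root q
  let b : B[X] := (q.map (algebraMap A B)) /ₘ (Polynomial.X - Polynomial.C ρ)
  have hb : (Polynomial.X - Polynomial.C ρ) * b = q.map (algebraMap A B) := by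
    rw [mul_divByMonic_eq_iff_isRoot, IsRoot, Polynomial.eval_map]
    exact AdjoinRoot.eval₂_root q
  have hbd : b.natDegree ≤ n := by
    have h1 : (q.map (algebraMap A B)).natDegree ≤ n + 1 := natDegree_map_le.trans hqd
    rcases subsingleton_or_nontrivial B with hB | hB
    · rw [natDegree_of_subsingleton]; omega
    simp only [b]
    rw [natDegree_divByMonic _ (monic_X_sub_C ρ), natDegree_X_sub_C]
    omega
  have hfac : reflect n b * (1 + Polynomial.C (-ρ) * Polynomial.X) = p.map (algebraMap A B) := by
    have h1 : reflect (n + 1) (b * (Polynomial.X + Polynomial.C (-ρ))) = p.map (algebraMap A B) := by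
      rw [Polynomial.C_neg, ← sub_eq_add_neg, mul_comm, hb, ← reflect_map, reflect_reflect]
    have hl : (Polynomial.X + Polynomial.C (-ρ) : B[X]).natDegree ≤ 1 := by
      have := natDegree_linear_le (a := (1 : B)) (b := -ρ)
      rwa [Polynomial.C_1, one_mul] at this
    rw [reflect_mul _ _ hbd hl] at h1
    rw [← h1, ← reflect_lin, reflect_reflect]
  refine ⟨B, inferInstance, inferInstance, -ρ, reflect n b, reflect_deg _ _ hbd, ?_, hfac, ?_, ?_, ?_⟩
  · have := congrArg (fun f => Polynomial.coeff f 0) hfac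
    simpa [mul_coeff_zero, hp0] using this
  · have := (AdjoinRoot.powerBasis' hq).basis
    rw [AdjoinRoot.powerBasis'_dim, hqd'] at this
    exact ⟨this⟩
  · intro T _ φ x' a' ha' h
    have hev : eval₂ φ (-x') q = 0 := by
      have h2 : q.map φ = reflect n a' * (Polynomial.X + Polynomial.C x') := by
        simp only [q]
        rw [reflect_map, ← h, reflect_mul _ _ ha' (lin_deg x'), reflect_lin]
      rw [← Polynomial.eval_map, h2]
      simp
    refine ⟨AdjoinRoot.lift φ (-x') hev, ?_, ?_⟩
    · ext a
      exact AdjoinRoot.lift_of hev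
    · rw [map_neg]
      simp only [ρ]
      rw [AdjoinRoot.lift_root, neg_neg]
  · intro T _ ψ₁ ψ₂ h1 h2
    refine AdjoinRoot.ringHom_ext h1 ?_
    simpa using h2

theorem PS_exists (A : Type) [CommRing A] (n : ℕ) (p : A[X]) (hp : p.natDegree ≤ n) (hp0 : p.coeff 0 = 1)
    (k : ℕ) (hk : k ≤ n) :
    ∃ (B : Type) (_ : CommRing B) (_ : Algebra A B) (x : Fin k → B) (a : B[X]),
      a.natDegree ≤ n - k ∧ a.coeff 0 = 1 ∧ a * ∏ i, (1 + Polynomial.C (x i) * Polynomial.X) = p.map (algebraMap A B) ∧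
      Nonempty (Module.Basis (Fin (n.descFactorial k)) A B) ∧
      (∀ (T : Type) [CommRing T] (φ : A →+* T) (x' : Fin k → T) (a' : T[X]), a'.natDegree ≤ n - k →
        a' * ∏ i, (1 + Polynomial.C (x' i) * Polynomial.X) = p.map φ →
        ∃ ψ : B →+* T, ψ.comp (algebraMap A B) = φ ∧ ∀ i, ψ (x i) = x' i) ∧
      (∀ (T : Type) [CommRing T] (ψ₁ ψ₂ : B →+* T),
        ψ₁.comp (algebraMap A B) = ψ₂.comp (algebraMap A B) → (∀ i, ψ₁ (x i) = ψ₂ (x i)) → ψ₁ = ψ₂) := by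
  induction k with
  | zero =>
    refine ⟨A, inferInstance, inferInstance, Fin.elim0, p, hp, hp0, by simp, ?_, ?_, ?_⟩
    · simp only [Nat.descFactorial_zero]
      exact ⟨Module.Basis.singleton (Fin 1) A⟩
    · intro T _ φ x' a' _ _
      exact ⟨φ, by ext; rfl, fun i => i.elim0⟩
    · intro T _ ψ₁ ψ₂ h _
      exact h
  | succ k ih =>
    obtain ⟨B, _, _, x, a, had, ha0, hfac, ⟨bas⟩, hlift, huniq⟩ := ih (by omega)
    obtain ⟨B', _, _, x1, a1, had1, ha01, hfac1, ⟨bas1⟩, hlift1, huniq1⟩ :=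
      one_step B (n - (k + 1)) a (by omega) ha0
    letI : Algebra A B' := ((algebraMap B B').comp (algebraMap A B)).toAlgebra
    haveI : IsScalarTower A B B' := IsScalarTower.of_algebraMap_eq (fun _ => rfl)
    have hmap : ∀ {S U : Type} [CommRing S] [CommRing U] (f : S →+* U) (x : Fin k → S),
        (∏ i, (1 + Polynomial.C (x i) * Polynomial.X : S[X])).map f = ∏ i, (1 + Polynomial.C (f (x i)) * Polynomial.X) := by
      intro S U _ _ f x
      rw [Polynomial.map_prod]
      simp
    refine ⟨B', inferInstance, inferInstance, Fin.snoc (fun i => algebraMap B B' (x i)) x1, a1, had1, ha01, ?_, ?_, ?_, ?_⟩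
    · rw [Fin.prod_univ_castSucc]
      simp only [Fin.snoc_castSucc, Fin.snoc_last]
      rw [mul_comm (∏ i, _), ← mul_assoc, hfac1, ← hmap, ← Polynomial.map_mul, hfac, Polynomial.map_map]
      rfl
    · refine ⟨(bas.smulTower bas1).reindex (Fintype.equivFinOfCardEq ?_)⟩
      simp [Nat.descFactorial_succ]
      have : n - k = n - (k + 1) + 1 := by omega
      rw [this]; ring
    · intro T _ φ x' a' ha' h
      have hd : (a' * (1 + Polynomial.C (x' (Fin.last k)) * Polynomial.X)).natDegree ≤ n - k := by
        refine natDegree_mul_le.trans ?_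
        have := lin_deg (x' (Fin.last k))
        omega
      have h' : a' * (1 + Polynomial.C (x' (Fin.last k)) * Polynomial.X) * ∏ i : Fin k, (1 + Polynomial.C (x' i.castSucc) * Polynomial.X) = p.map φ := by
        rw [← h, Fin.prod_univ_castSucc]; ring
      obtain ⟨ψ, hψ1, hψ2⟩ := hlift T φ (fun i => x' i.castSucc) _ hd h'
      have hψa : a' * (1 + Polynomial.C (x' (Fin.last k)) * Polynomial.X) = a.map ψ := by
        refine cancel_aux (f := ∏ i : Fin k, (1 + Polynomial.C (x' i.castSucc) * Polynomial.X)) ?_ ?_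
        · simp [coeff_zero_prod]
        · rw [h', ← hψ1, ← Polynomial.map_map, ← hfac, Polynomial.map_mul, hmap]
          simp only [hψ2]
      obtain ⟨ψ', h1, h2⟩ := hlift1 T ψ _ a' ha' hψa
      refine ⟨ψ', ?_, ?_⟩
      · rw [← hψ1, ← h1]; rfl
      · intro i
        refine Fin.lastCases ?_ (fun i => ?_) i
        · simpa using h2
        · simp only [Fin.snoc_castSucc]
          rw [← hψ2, ← h1]; rfl
    · intro T _ ψ₁ ψ₂ h1 h2
      refine huniq1 T ψ₁ ψ₂ ?_ ?_
      · refine huniq T _ _ ?_ ?_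
        · exact h1
        · intro i
          have := h2 i.castSucc
          simpa using this
      · simpa using h2 (Fin.last k)

end Split


section Rel
open PowerSeries

theorem det_eq {T : Type} [CommRing T] (c d : PowerSeries T) (hc : PowerSeries.coeff 0 c = 1)
    (h : d * ng c = 1) (r : ℕ) :
    (Matrix.of fun i j : Fin r => if (i : ℕ) ≤ j + 1 then PowerSeries.coeff (1 + (j : ℕ) - i) c else 0).det =
      PowerSeries.coeff r d := by
  let e := ng d
  have he : c * e = 1 := by
    have h1 : ng (d * ng c) = 1 := by rw [h, map_one]
    have h2 : ng (ng c) = c := by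
      ext i
      rw [coeff_ng, coeff_ng, ← mul_assoc, ← mul_pow]; simp
    rw [map_mul, h2, mul_comm] at h1
    exact h1
  let L : Matrix (Fin (r + 1)) (Fin (r + 1)) T :=
    Matrix.of fun i j => if (i : ℕ) ≤ j then PowerSeries.coeff ((j : ℕ) - i) c else 0
  have hdet : L.det = 1 := by
    rw [Matrix.det_of_upperTriangular]
    · simp [L, hc]
    · intro i j hij
      simp only [L, Matrix.of_apply]
      rw [if_neg]
      simpa using hij
  let v : Fin (r + 1) → T := fun j => PowerSeries.coeff (r - j) e
  have hv : L.mulVec v = Pi.single (Fin.last r) 1 := by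
    ext i
    obtain ⟨m, hm⟩ : ∃ m, r = i + m := ⟨r - i, by omega⟩
    have h1 : L.mulVec v i = PowerSeries.coeff m (c * e) := by
      simp only [Matrix.mulVec, dotProduct, L, v, Matrix.of_apply]
      rw [Fin.sum_univ_eq_sum_range (fun j => (if (i : ℕ) ≤ j then PowerSeries.coeff (j - i) c else 0) * PowerSeries.coeff (r - j) e) (r + 1)]
      have hr : Finset.range (r + 1) = Finset.range (i + (m + 1)) := by congr 1; omega
      rw [hr, Finset.sum_range_add, PowerSeries.coeff_mul,
        Finset.Nat.sum_antidiagonal_eq_sum_range_succ (fun a b => PowerSeries.coeff a c * PowerSeries.coeff b e)]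
      rw [Finset.sum_eq_zero, zero_add]
      · refine Finset.sum_congr rfl fun x _ => ?_
        rw [if_pos (by omega)]
        congr 3 <;> omega
      · intro x hx
        rw [if_neg (by simpa using hx), zero_mul]
    rw [h1, he, PowerSeries.coeff_one]
    by_cases h0 : m = 0
    · have : i = Fin.last r := by ext; simp; omega
      rw [if_pos h0, this, Pi.single_eq_same]
    · have : i ≠ Fin.last r := by intro hh; rw [hh] at hm; simp at hm; omega
      rw [if_neg h0, Pi.single_eq_of_ne this]
  have hv2 : v 0 = L.adjugate 0 (Fin.last r) := by
    have : L.adjugate.mulVec (L.mulVec v) = v := by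
      rw [Matrix.mulVec_mulVec, Matrix.adjugate_mul, hdet, one_smul, Matrix.one_mulVec]
    rw [← this, hv]
    simp
  rw [Matrix.adjugate_fin_succ_eq_det_submatrix] at hv2
  have hv3 : v 0 = (-1) ^ r * PowerSeries.coeff r d := by
    simp [v, e, coeff_ng]
  rw [hv3] at hv2
  have hs : L.submatrix (Fin.last r).succAbove (Fin.succAbove 0) =
      (Matrix.of fun i j : Fin r => if (i : ℕ) ≤ j + 1 then PowerSeries.coeff (1 + (j : ℕ) - i) c else 0) := by
    ext i j
    simp only [L, Matrix.submatrix_apply, Matrix.of_apply, Fin.succAbove_last, Fin.succAbove_zero, Fin.val_castSucc, Fin.val_succ]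
    rw [add_comm 1 (j : ℕ)]
  rw [hs] at hv2
  have h3 := congrArg (fun x => (-1) ^ r * x) hv2
  simp only [← mul_assoc, Fin.val_last, Fin.val_zero, add_zero, zero_add] at h3
  rw [← mul_pow] at h3
  simpa using h3.symm

/-- extended generator sequence -/
def tt {T : Type} [CommRing T] {N : ℕ} (t : Fin N → T) (i : ℕ) : T :=
  if h : 1 ≤ i ∧ i ≤ N then t ⟨i - 1, by omega⟩ else if i = 0 then 1 else 0

noncomputable def lo {T : Type} [CommRing T] (k : ℕ) (t : ℕ → T) : PowerSeries T :=
  PowerSeries.mk fun i => if i ≤ k then t i else 0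

noncomputable def hi {T : Type} [CommRing T] (k : ℕ) (t : ℕ → T) : PowerSeries T :=
  PowerSeries.mk fun i => if k < i then t i else 0

lemma coeff_lo {T : Type} [CommRing T] (k : ℕ) (t : ℕ → T) (i : ℕ) :
    PowerSeries.coeff i (lo k t) = if i ≤ k then t i else 0 := by simp [lo]

lemma coeff_hi {T : Type} [CommRing T] (k : ℕ) (t : ℕ → T) (i : ℕ) :
    PowerSeries.coeff i (hi k t) = if k < i then t i else 0 := by simp [hi]

lemma tGen_nat (n k : ℕ) (p : ℕ) : tGen n k p = tt (fun i => MvPolynomial.X i) p := by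
  simp only [tGen, tt]
  by_cases h : 1 ≤ p ∧ p ≤ n + k
  · rw [dif_pos h, dif_pos (by exact_mod_cast h)]
    simp
  · rw [dif_neg h, dif_neg (by exact_mod_cast h)]
    simp

lemma tGen_neg (n k : ℕ) (p : ℤ) (hp : p < 0) : tGen n k p = 0 := by
  rw [tGen, dif_neg (by omega), if_neg (by omega)]

lemma map_tt {T S : Type} [CommRing T] [CommRing S] (f : T →+* S) {N : ℕ} (t : Fin N → T) (i : ℕ) :
    f (tt t i) = tt (fun j => f (t j)) i := by
  simp only [tt]
  split_ifs <;> simp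

lemma map_lo {T S : Type} [CommRing T] [CommRing S] (f : T →+* S) (k : ℕ) (t : ℕ → T) :
    PowerSeries.map f (lo k t) = lo k (fun i => f (t i)) := by
  ext i
  simp only [PowerSeries.coeff_map, coeff_lo]
  split_ifs <;> simp

lemma map_hi {T S : Type} [CommRing T] [CommRing S] (f : T →+* S) (k : ℕ) (t : ℕ → T) :
    PowerSeries.map f (hi k t) = hi k (fun i => f (t i)) := by
  ext i
  simp only [PowerSeries.coeff_map, coeff_hi]
  split_ifs <;> simp

variable {T : Type} [CommRing T] (n k : ℕ) (ev : MvPolynomial (Fin (n + k)) ℤ →+* T)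

lemma ev_tGen (p : ℕ) : ev (tGen n k p) = tt (fun i => ev (MvPolynomial.X i)) p := by
  rw [tGen_nat, map_tt]

lemma ev_dt (p : ℕ) : ev (dlt n k p * tGen n k p) =
    PowerSeries.coeff p (lo k (tt (fun i => ev (MvPolynomial.X i))) + 2 * hi k (tt (fun i => ev (MvPolynomial.X i)))) := by
  have h2 : (2 : PowerSeries T) = PowerSeries.C 2 := (map_ofNat PowerSeries.C 2).symm
  rw [map_mul, ev_tGen, map_add, h2, PowerSeries.coeff_C_mul, coeff_lo, coeff_hi, dlt]
  by_cases h : p ≤ k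
  · rw [if_pos h, if_pos (by exact_mod_cast h), if_neg (by omega)]; simp
  · rw [if_neg h, if_neg (by exact_mod_cast h), if_pos (by omega)]; simp [map_ofNat]

lemma ev_tDet (d : PowerSeries T)
    (hd : d * ng (lo k (tt (fun i => ev (MvPolynomial.X i))) + 2 * hi k (tt (fun i => ev (MvPolynomial.X i)))) = 1) (r : ℕ) :
    ev (tDet n k r) = PowerSeries.coeff r d := by
  rw [← det_eq _ d _ hd, tDet, RingHom.map_det]
  · congr 1
    ext i j
    simp only [RingHom.mapMatrix_apply, Matrix.map_apply, Matrix.of_apply]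
    by_cases h : (i : ℕ) ≤ j + 1
    · rw [if_pos h, ← ev_dt]
      rw [Nat.cast_sub (by omega)]
      push_cast; rfl
    · rw [if_neg h, tGen_neg _ _ _ (by omega)]; simp
  · rw [← ev_dt]
    simp [dlt, tGen]

lemma ev_tSumRel (d : PowerSeries T)
    (hd : d * ng (lo k (tt (fun i => ev (MvPolynomial.X i))) + 2 * hi k (tt (fun i => ev (MvPolynomial.X i)))) = 1) (r : ℕ) :
    ev (tSumRel n k r) = PowerSeries.coeff r (ng (hi k (tt (fun i => ev (MvPolynomial.X i)))) * d) := by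
  rw [tSumRel, map_sum, PowerSeries.coeff_mul,
    Finset.Nat.sum_antidiagonal_eq_sum_range_succ (fun a b => PowerSeries.coeff a (ng (hi k (tt (fun i => ev (MvPolynomial.X i))))) * PowerSeries.coeff b d)]
  rw [← Finset.sum_subset (s₁ := Finset.Icc (k + 1) r) (s₂ := Finset.range r.succ)]
  · refine Finset.sum_congr rfl fun p hp => ?_
    rw [Finset.mem_Icc] at hp
    rw [map_mul, map_mul, ev_tGen, ev_tDet _ _ _ d hd, coeff_ng, coeff_hi, if_pos (by omega)]
    simp
  · intro p; simp only [Finset.mem_Icc, Finset.mem_range]; omega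
  · intro p h1 h2
    simp at h1 h2
    rw [coeff_ng, coeff_hi, if_neg (by omega)]
    simp

lemma sum_mid (F : ℕ → T) (r : ℕ) : ∑ a ∈ Finset.range (2 * r + 1), F a =
    F r + ∑ i ∈ Finset.Icc 1 r, (F (r - i) + F (r + i)) := by
  rw [show 2 * r + 1 = r + (r + 1) by omega, Finset.sum_range_add, Finset.sum_range_succ',
    ← Finset.sum_range_reflect, show Finset.Icc 1 r = Finset.Ico 1 (r + 1) by ext; simp only [Finset.mem_Icc, Finset.mem_Ico]; omega,
    Finset.sum_Ico_eq_sum_range, Finset.sum_add_distrib, add_tsub_cancel_right]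
  have h1 : ∑ j ∈ Finset.range r, F (r - 1 - j) = ∑ j ∈ Finset.range r, F (r - (1 + j)) :=
    Finset.sum_congr rfl fun j _ => by congr 1; omega
  have h2 : ∑ j ∈ Finset.range r, F (r + (j + 1)) = ∑ j ∈ Finset.range r, F (r + (1 + j)) :=
    Finset.sum_congr rfl fun j _ => by congr 1; omega
  rw [h1, h2]
  simp only [add_zero]
  ring

lemma ev_tQuadRel (r : ℕ) (hr : k + 1 ≤ r) :
    (-1) ^ r * ev (tQuadRel n k r) = QR (lo k (tt (fun i => ev (MvPolynomial.X i)))) (hi k (tt (fun i => ev (MvPolynomial.X i)))) r := by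
  set t := tt (fun i => ev (MvPolynomial.X i)) with ht
  have h2 : (2 : PowerSeries T) = PowerSeries.C 2 := (map_ofNat PowerSeries.C 2).symm
  rw [QR_eq_sum,
    Finset.Nat.sum_antidiagonal_eq_sum_range_succ (fun a b => (-1) ^ a *
      (PowerSeries.coeff a (hi k t) * PowerSeries.coeff b (hi k t) + PowerSeries.coeff a (hi k t) * PowerSeries.coeff b (lo k t)))]
  rw [Nat.succ_eq_add_one, sum_mid, tQuadRel, map_add, mul_add, map_sum, Finset.mul_sum]
  congr 1
  · rw [map_pow, ev_tGen, ← ht, coeff_hi, if_pos (by omega), coeff_hi, if_pos (by omega), coeff_lo, if_neg (by omega),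
      show 2 * r - r = r by omega]
    ring
  · refine Finset.sum_congr rfl fun i hi' => ?_
    rw [Finset.mem_Icc] at hi'
    have e1 : ((r : ℤ) - i) = ((r - i : ℕ) : ℤ) := by omega
    have e2 : ((r : ℤ) + i) = ((r + i : ℕ) : ℤ) := by omega
    have e3 : 2 * r - (r - i) = r + i := by omega
    have e4 : 2 * r - (r + i) = r - i := by omega
    have e5 : (-1 : T) ^ (r - i) = (-1) ^ (r + i) := by
      rw [show r + i = (r - i) + 2 * i by omega, pow_add, pow_mul]; simp
    have := ev_dt n k ev (r - i)
    rw [map_mul, ← ht, map_add, h2, PowerSeries.coeff_C_mul] at this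
    have hg : t (r - i) = PowerSeries.coeff (r - i) (hi k t) + PowerSeries.coeff (r - i) (lo k t) := by
      rw [coeff_hi, coeff_lo]
      by_cases h : k < r - i
      · rw [if_pos h, if_neg (by omega), add_zero]
      · rw [if_neg h, if_pos (by omega), zero_add]
    have hp : PowerSeries.coeff (r + i) (hi k t) = t (r + i) := by rw [coeff_hi, if_pos (by omega)]
    have hq : PowerSeries.coeff (r + i) (lo k t) = 0 := by rw [coeff_lo, if_neg (by omega)]
    have hm : ev ((-1) ^ i) = (-1) ^ i := by simp
    rw [e1, e2, map_mul, map_mul, map_mul, ev_tGen n k ev (r + i), ← ht, e3, e4, e5, hp, hq, hm]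
    linear_combination ((-1) ^ r * (-1) ^ i * t (r + i)) * this

end Rel

section Master
open PowerSeries

variable {T : Type} [CommRing T]

lemma cz (f f' : PowerSeries T) : PowerSeries.coeff 0 (f * f') = PowerSeries.coeff 0 f * PowerSeries.coeff 0 f' := by
  simp

lemma even_id (g h y : PowerSeries T) (r : ℕ) :
    PowerSeries.coeff (2 * r) (ng (h - y) * ((h - y) + (g + 2 * y))) = QR g h r - QR g y r := by
  have h2 : ng (ng y) = y := by
    ext i
    rw [coeff_ng, coeff_ng, ← mul_assoc, ← mul_pow]; simp
  have h1 : ng (h - y) * ((h - y) + (g + 2 * y)) =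
      ng h * (h + g) - ng y * (y + g) + (ng (ng y * h) * 1 - ng y * h) := by
    rw [map_sub, map_mul, h2]; ring
  rw [h1, map_add, map_sub, QR, QR, mul_one, map_sub, coeff_ng]
  simp

lemma odd_zero (b : PowerSeries T) (i : ℕ) (hi : ¬ Even i) : PowerSeries.coeff i (b * ng b) = 0 := by
  rw [PowerSeries.coeff_mul]
  refine Finset.sum_involution (fun x _ => (x.2, x.1)) ?_ ?_ ?_ ?_
  · rintro ⟨x, y⟩ hx
    simp only [Finset.HasAntidiagonal.mem_antidiagonal] at hx
    simp only [coeff_ng]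
    rcases Nat.even_or_odd x with h | h
    · have h' : Odd y := by
        by_contra h''
        rw [Nat.not_odd_iff_even] at h''
        exact hi (hx ▸ h.add h'')
      rw [h.neg_one_pow, h'.neg_one_pow]; ring
    · have h' : Even y := by
        by_contra h''
        rw [Nat.not_even_iff_odd] at h''
        exact hi (hx ▸ h.add_odd h'')
      rw [h.neg_one_pow, h'.neg_one_pow]; ring
  · rintro ⟨x, y⟩ hx _ h
    simp only [Finset.HasAntidiagonal.mem_antidiagonal, Prod.mk.injEq] at hx h
    apply hi
    rw [← hx, h.1]
    exact ⟨_, rfl⟩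
  · rintro ⟨x, y⟩ hx
    simp only [Finset.HasAntidiagonal.mem_antidiagonal] at hx ⊢
    omega
  · rintro ⟨x, y⟩ hx; rfl

lemma even_fwd (E F : PowerSeries T) (hE : ∀ i, ¬ Even i → PowerSeries.coeff i E = 0) (n : ℕ)
    (hF : ∀ r, r ≤ n → PowerSeries.coeff (2 * r) F = 0) (r : ℕ) (hr : r ≤ n) :
    PowerSeries.coeff (2 * r) (E * F) = 0 := by
  rw [PowerSeries.coeff_mul]
  refine Finset.sum_eq_zero ?_
  rintro ⟨x, y⟩ hx
  simp only [Finset.HasAntidiagonal.mem_antidiagonal] at hx ⊢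
  by_cases h : Even x
  · obtain ⟨s, hs⟩ := h
    have : y = 2 * (r - s) := by omega
    rw [this, hF _ (by omega), mul_zero]
  · rw [hE _ h, zero_mul]

lemma even_bwd (E F : PowerSeries T) (hE : ∀ i, ¬ Even i → PowerSeries.coeff i E = 0)
    (hE0 : PowerSeries.coeff 0 E = 1) (n : ℕ)
    (hF : ∀ r, r ≤ n → PowerSeries.coeff (2 * r) (E * F) = 0) (r : ℕ) (hr : r ≤ n) :
    PowerSeries.coeff (2 * r) F = 0 := by
  induction r using Nat.strong_induction_on with
  | _ r ih =>
  have h := hF r hr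
  rw [PowerSeries.coeff_mul, Finset.sum_eq_single (0, 2 * r)] at h
  · simpa [hE0] using h
  · rintro ⟨x, y⟩ hx hne
    simp only [Finset.HasAntidiagonal.mem_antidiagonal, ne_eq, Prod.mk.injEq] at hx hne ⊢
    by_cases h : Even x
    · obtain ⟨s, hs⟩ := h
      have : y = 2 * (r - s) := by omega
      rw [this, ih _ (by omega) (by omega), mul_zero]
    · rw [hE _ h, zero_mul]
  · intro hx; simp at hx

/-- supported in degrees at most `m` -/
def Sp (f : PowerSeries T) (m : ℕ) : Prop := ∀ i, m < i → PowerSeries.coeff i f = 0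

lemma Sp.mul {f f' : PowerSeries T} {m m' : ℕ} (h : Sp f m) (h' : Sp f' m') : Sp (f * f') (m + m') := by
  intro i hi
  rw [PowerSeries.coeff_mul]
  refine Finset.sum_eq_zero ?_
  rintro ⟨x, y⟩ hx
  simp only [Finset.HasAntidiagonal.mem_antidiagonal] at hx ⊢
  by_cases hxm : m < x
  · rw [h _ hxm, zero_mul]
  · rw [h' _ (by omega), mul_zero]

lemma Sp.ng {f : PowerSeries T} {m : ℕ} (h : Sp f m) : Sp (ng f) m := by
  intro i hi
  rw [coeff_ng, h i hi, mul_zero]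

lemma Sp.mono {f : PowerSeries T} {m m' : ℕ} (h : Sp f m) (hm : m ≤ m') : Sp f m' :=
  fun i hi => h i (by omega)

lemma Sp.add {f f' : PowerSeries T} {m : ℕ} (h : Sp f m) (h' : Sp f' m) : Sp (f + f') m := by
  intro i hi
  rw [map_add, h i hi, h' i hi, add_zero]

lemma coeff_two_mul (f : PowerSeries T) (i : ℕ) : PowerSeries.coeff i (2 * f) = 2 * PowerSeries.coeff i f := by
  rw [two_mul, two_mul, map_add]

lemma Sp.two_mul {f : PowerSeries T} {m : ℕ} (h : Sp f m) : Sp (2 * f) m := by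
  intro i hi
  rw [coeff_two_mul, h i hi, mul_zero]

lemma Sp.one (m : ℕ) : Sp (1 : PowerSeries T) m := by
  intro i hi
  rw [PowerSeries.coeff_one, if_neg (by omega)]

lemma QR_Sp {g y : PowerSeries T} {k : ℕ} (hg : Sp g k) (hy : Sp y k) (r : ℕ) (hr : k < r) : QR g y r = 0 :=
  (hy.ng.mul (hy.add hg)) _ (by omega)

/-- recursion lemma -/
lemma rec_zero {f q : PowerSeries T} {k N M : ℕ} (hf0 : PowerSeries.coeff 0 f = 1) (hf : Sp f k)
    (h : ∀ r, N < r → r ≤ M → PowerSeries.coeff r (f * q) = 0)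
    (hq : ∀ r, N < r + k → r ≤ N → PowerSeries.coeff r q = 0) (r : ℕ) (h1 : N < r + k) (h2 : r ≤ M) :
    PowerSeries.coeff r q = 0 := by
  induction r using Nat.strong_induction_on with
  | _ r ih =>
  by_cases hr : r ≤ N
  · exact hq r h1 hr
  have h' := h r (by omega) h2
  rw [PowerSeries.coeff_mul, Finset.sum_eq_single (0, r)] at h'
  · simpa [hf0] using h'
  · rintro ⟨x, y⟩ hx hne
    simp only [Finset.HasAntidiagonal.mem_antidiagonal, ne_eq, Prod.mk.injEq] at hx hne ⊢
    by_cases hxk : k < x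
    · rw [hf _ hxk, zero_mul]
    · rw [ih y (by omega) (by omega) (by omega), mul_zero]
  · intro hx; simp at hx

/-- product vanishing -/
lemma prod_zero {f q : PowerSeries T} {k r : ℕ} (hf0 : PowerSeries.coeff 0 f = 0) (hf : Sp f k)
    (hq : ∀ s, r ≤ s + k → s < r → PowerSeries.coeff s q = 0) :
    PowerSeries.coeff r (f * q) = 0 := by
  rw [PowerSeries.coeff_mul]
  refine Finset.sum_eq_zero ?_
  rintro ⟨x, y⟩ hx
  simp only [Finset.HasAntidiagonal.mem_antidiagonal] at hx ⊢
  by_cases hx0 : x = 0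
  · rw [hx0, hf0, zero_mul]
  by_cases hxk : k < x
  · rw [hf _ hxk, zero_mul]
  · rw [hq y (by omega) (by omega), mul_zero]

lemma unit_of {f : PowerSeries T} (hf0 : PowerSeries.coeff 0 f = 1) : IsUnit f := by
  rw [PowerSeries.isUnit_iff_constantCoeff, ← PowerSeries.coeff_zero_eq_constantCoeff_apply, hf0]
  exact isUnit_one

lemma core_P (P : PowerSeries T) (n : ℕ) (hF : ∀ r, r ≤ n → PowerSeries.coeff (2 * r) (ng P * (1 + P)) = 0) :
    (PowerSeries.X : PowerSeries T) ^ (2 * n + 2) ∣ P + ng P + 2 * P * ng P := by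
  have h2 : ng (ng P) = P := by
    ext i
    rw [coeff_ng, coeff_ng, ← mul_assoc, ← mul_pow]; simp
  have h : P + ng P + 2 * P * ng P = ng P * (1 + P) + ng (ng P * (1 + P)) := by
    rw [map_mul, map_add, h2, map_one]; ring
  rw [h, PowerSeries.X_pow_dvd_iff]
  intro m hm
  rw [map_add, coeff_ng]
  rcases Nat.even_or_odd m with he | ho
  · obtain ⟨s, hs⟩ := he
    rw [show m = 2 * s by omega, hF s (by omega)]; simp
  · rw [ho.neg_one_pow]; ring

/-- From the quadratic relation on `P`: consequences for `d`. -/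
lemma core_d (n : ℕ) {g h y P d : PowerSeries T} (hP : (g + 2 * y) * P = h - y)
    (hd : d * ng (g + 2 * h) = 1)
    (hF : (PowerSeries.X : PowerSeries T) ^ (2 * n + 2) ∣ P + ng P + 2 * P * ng P) :
    (PowerSeries.X : PowerSeries T) ^ (2 * n + 2) ∣ d * ng (g + 2 * y) - (1 + 2 * P) ∧
    (PowerSeries.X : PowerSeries T) ^ (2 * n + 2) ∣ ng h * d - (ng y * d - P) := by
  have hc : g + 2 * h = (g + 2 * y) * (1 + 2 * P) := by linear_combination (-2) * hP
  have hh : ng h = ng y + ng (g + 2 * y) * ng P := by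
    rw [← map_mul, hP, map_sub]; ring
  rw [hc, map_mul, map_add ng 1, map_one, map_mul ng 2, map_ofNat] at hd
  set β := ng (g + 2 * y)
  have e1 : d * β - (1 + 2 * P) = (P + ng P + 2 * P * ng P) * (-2 * (d * β)) := by
    linear_combination (1 + 2 * P) * hd
  have d1 : (PowerSeries.X : PowerSeries T) ^ (2 * n + 2) ∣ d * β - (1 + 2 * P) := by
    rw [e1]; exact hF.mul_right _
  refine ⟨d1, ?_⟩
  have e2 : ng h * d - (ng y * d - P) = (d * β - (1 + 2 * P)) * ng P + (P + ng P + 2 * P * ng P) := by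
    rw [hh]; ring
  rw [e2]
  exact dvd_add (d1.mul_right _) hF

theorem dir1 {n k : ℕ} (hkn : k ≤ n) {g h y P d : PowerSeries T}
    (hg0 : PowerSeries.coeff 0 g = 1) (hg : Sp g k) (hh0 : ∀ i, i ≤ k → PowerSeries.coeff i h = 0)
    (hh : Sp h (n + k)) (hy0 : PowerSeries.coeff 0 y = 0) (hy : Sp y k)
    (hP : (g + 2 * y) * P = h - y) (hd : d * ng (g + 2 * h) = 1)
    (hq1 : ∀ r, 1 ≤ r → r ≤ k → QR g y r = QR g h r) (hq2 : ∀ r, k < r → r ≤ n → QR g h r = 0)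
    (hd1 : ∀ r, n < r + k → r ≤ n → PowerSeries.coeff r d = 0)
    (hd2 : ∀ r, n < r → r ≤ n + k → PowerSeries.coeff r (ng h * d) = 0) :
    (∀ r, 1 ≤ r → r ≤ n → QR 1 P r = 0) ∧ PowerSeries.coeff 0 P = 0 ∧ Sp P n ∧
    ∃ a : PowerSeries T, Sp a (n - k) ∧ a * ng (g + 2 * y) = 1 + 2 * P := by
  have hb0 : PowerSeries.coeff 0 (g + 2 * y) = 1 := by rw [map_add, coeff_two_mul, hg0, hy0]; simp
  have hb : Sp (g + 2 * y) k := hg.add hy.two_mul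
  have hP0 : PowerSeries.coeff 0 P = 0 := by
    have := congrArg (PowerSeries.coeff 0) hP
    rw [cz, hb0, map_sub, hh0 0 (by omega), hy0] at this
    simpa using this
  have hE0 : PowerSeries.coeff 0 ((g + 2 * y) * ng (g + 2 * y)) = 1 := by
    rw [cz, coeff_ng, hb0]; simp
  have hEF : (g + 2 * y) * ng (g + 2 * y) * (ng P * (1 + P)) = ng (h - y) * ((h - y) + (g + 2 * y)) := by
    rw [← hP, map_mul]; ring
  have hF : ∀ r, r ≤ n → PowerSeries.coeff (2 * r) (ng P * (1 + P)) = 0 := by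
    refine even_bwd _ _ (odd_zero _) hE0 n ?_
    intro r hr
    rw [hEF, even_id]
    rcases Nat.eq_zero_or_pos r with rfl | hr0
    · rw [QR, QR, mul_zero, cz, cz, coeff_ng, coeff_ng, hy0, hh0 0 (by omega)]; ring
    · by_cases hrk : r ≤ k
      · rw [hq1 r hr0 hrk, sub_self]
      · rw [hq2 r (by omega) hr, QR_Sp hg hy r (by omega), sub_zero]
  have hcore := core_P P n hF
  obtain ⟨c1, c2⟩ := core_d n hP hd hcore
  rw [PowerSeries.X_pow_dvd_iff] at c1 c2
  have hdz : ∀ r, n < r + k → r ≤ n + k → PowerSeries.coeff r d = 0 := by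
    intro r h1 h2
    refine rec_zero (f := ng g) (N := n) (M := n + k) (k := k) ?_ hg.ng ?_ hd1 r h1 h2
    · rw [coeff_ng, hg0]; simp
    · intro r h1 h2
      have := congrArg (PowerSeries.coeff r) hd
      rw [PowerSeries.coeff_one, if_neg (by omega), map_add ng, map_mul ng, map_ofNat, mul_add, map_add,
        show d * (2 * ng h) = 2 * (ng h * d) by ring, coeff_two_mul, hd2 r h1 h2, mul_zero, add_zero, mul_comm] at this
      exact this
  have hPz : ∀ r, n < r → r ≤ n + k → PowerSeries.coeff r P = 0 := by
    intro r h1 h2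
    have := c2 r (by omega)
    rw [map_sub, map_sub, hd2 r h1 h2, prod_zero (k := k) _ hy.ng] at this
    · simpa using this
    · intro s hs1 hs2
      exact hdz s (by omega) (by omega)
    · rw [coeff_ng, hy0, mul_zero]
  have hPs : Sp P n := by
    intro r hr
    refine rec_zero (f := g + 2 * y) (N := n + k) (M := r) (k := k) hb0 hb ?_ ?_ r (by omega) le_rfl
    · intro s hs _
      rw [hP, map_sub, hh s hs, hy s (by omega), sub_zero]
    · intro s hs1 hs2
      exact hPz s (by omega) (by omega)
  refine ⟨?_, hP0, hPs, ?_⟩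
  · intro r hr1 hr2
    rw [QR, add_comm]; exact hF r hr2
  let a : PowerSeries T := PowerSeries.mk fun i => if i ≤ n - k then PowerSeries.coeff i d else 0
  have ha : Sp a (n - k) := by
    intro i hi
    simp only [a, PowerSeries.coeff_mk]
    rw [if_neg (by omega)]
  refine ⟨a, ha, ?_⟩
  ext i
  by_cases hi : n < i
  · rw [(ha.mul hb.ng) i (by omega), ((Sp.one n).add hPs.two_mul) i hi]
  · have := c1 i (by omega)
    rw [map_sub, sub_eq_zero] at this
    rw [← this, PowerSeries.coeff_mul, PowerSeries.coeff_mul]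
    refine Finset.sum_congr rfl ?_
    rintro ⟨x, z⟩ hx
    simp only [Finset.HasAntidiagonal.mem_antidiagonal] at hx ⊢
    simp only [a, PowerSeries.coeff_mk]
    split_ifs with hxn
    · rfl
    · rw [hdz x (by omega) (by omega)]

theorem dir2 {n k : ℕ} (hkn : k ≤ n) {g h y P d a : PowerSeries T}
    (hg0 : PowerSeries.coeff 0 g = 1) (hg : Sp g k) (hh0 : ∀ i, i ≤ k → PowerSeries.coeff i h = 0)
    (hy0 : PowerSeries.coeff 0 y = 0) (hy : Sp y k)
    (hP : (g + 2 * y) * P = h - y) (hd : d * ng (g + 2 * h) = 1)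
    (hP0 : PowerSeries.coeff 0 P = 0) (hPs : Sp P n) (hPq : ∀ r, 1 ≤ r → r ≤ n → QR 1 P r = 0)
    (ha : Sp a (n - k)) (hab : a * ng (g + 2 * y) = 1 + 2 * P) :
    (∀ r, 1 ≤ r → r ≤ k → QR g y r = QR g h r) ∧ (∀ r, k < r → r ≤ n → QR g h r = 0) ∧
    (∀ r, n < r + k → r ≤ n → PowerSeries.coeff r d = 0) ∧
    (∀ r, n < r → r ≤ n + k → PowerSeries.coeff r (ng h * d) = 0) := by
  have hb0 : PowerSeries.coeff 0 (g + 2 * y) = 1 := by rw [map_add, coeff_two_mul, hg0, hy0]; simp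
  have hb : Sp (g + 2 * y) k := hg.add hy.two_mul
  have hF : ∀ r, r ≤ n → PowerSeries.coeff (2 * r) (ng P * (1 + P)) = 0 := by
    intro r hr
    rcases Nat.eq_zero_or_pos r with rfl | hr0
    · rw [mul_zero, cz, coeff_ng, hP0]; ring
    · rw [add_comm]; exact hPq r hr0 hr
  have hEF : (g + 2 * y) * ng (g + 2 * y) * (ng P * (1 + P)) = ng (h - y) * ((h - y) + (g + 2 * y)) := by
    rw [← hP, map_mul]; ring
  have hQ : ∀ r, r ≤ n → QR g h r = QR g y r := by
    intro r hr
    rw [← sub_eq_zero, ← even_id, ← hEF]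
    exact even_fwd _ _ (odd_zero _) n hF r hr
  have hcore := core_P P n hF
  obtain ⟨c1, c2⟩ := core_d n hP hd hcore
  have hu : IsUnit (ng (g + 2 * y)) := unit_of (by rw [coeff_ng, hb0]; simp)
  have c3 : (PowerSeries.X : PowerSeries T) ^ (2 * n + 2) ∣ d - a := by
    rw [← hab, ← sub_mul] at c1
    exact (hu.dvd_mul_right).1 c1
  rw [PowerSeries.X_pow_dvd_iff] at c2 c3
  have hdz : ∀ r, n < r + k → r < 2 * n + 2 → PowerSeries.coeff r d = 0 := by
    intro r h1 h2
    have := c3 r h2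
    rw [map_sub, ha r (by omega), sub_zero] at this
    exact this
  refine ⟨?_, ?_, ?_, ?_⟩
  · intro r h1 h2
    exact (hQ r (by omega)).symm
  · intro r h1 h2
    rw [hQ r h2, QR_Sp hg hy r h1]
  · intro r h1 h2
    exact hdz r h1 (by omega)
  · intro r h1 h2
    have := c2 r (by omega)
    rw [map_sub, map_sub, hPs r h1, prod_zero (k := k) _ hy.ng] at this
    · simpa using this
    · intro s hs1 hs2
      exact hdz s (by omega) (by omega)
    · rw [coeff_ng, hy0, mul_zero]

end Master

section Assembly
open PowerSeries

/-- the product of linear factors -/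
noncomputable def xs {T : Type} [CommRing T] {k : ℕ} (x : Fin k → T) : PowerSeries T :=
  ∏ i, (1 + PowerSeries.C (x i) * PowerSeries.X)

lemma xs_eq {T : Type} [CommRing T] {k : ℕ} (x : Fin k → T) :
    xs x = ((∏ i, (1 + Polynomial.C (x i) * Polynomial.X) : Polynomial T) : PowerSeries T) := by
  rw [xs, ← Polynomial.coeToPowerSeries.ringHom_apply, map_prod]
  simp

lemma map_xs {T S : Type} [CommRing T] [CommRing S] (f : T →+* S) {k : ℕ} (x : Fin k → T) :
    PowerSeries.map f (xs x) = xs (fun i => f (x i)) := by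
  rw [xs, xs, map_prod]
  simp

lemma xs_zero {T : Type} [CommRing T] {k : ℕ} (x : Fin k → T) : PowerSeries.coeff 0 (xs x) = 1 := by
  simp [xs]

lemma Sp_lin {T : Type} [CommRing T] (x : T) : Sp (1 + PowerSeries.C x * PowerSeries.X : PowerSeries T) 1 := by
  intro i hi
  rw [map_add, PowerSeries.coeff_one, if_neg (by omega), PowerSeries.coeff_C_mul, PowerSeries.coeff_X, if_neg (by omega)]
  simp

lemma Sp_xs {T : Type} [CommRing T] {k : ℕ} (x : Fin k → T) : Sp (xs x) k := by
  induction k with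
  | zero => simpa [xs] using Sp.one 0
  | succ k ih =>
    rw [xs, Fin.prod_univ_castSucc]
    exact (ih fun i => x i.castSucc).mul (Sp_lin _)

lemma coe_trunc {T : Type} [CommRing T] {n : ℕ} {p : PowerSeries T} (hp : Sp p n) :
    ((PowerSeries.trunc (n + 1) p : Polynomial T) : PowerSeries T) = p := by
  ext i
  rw [Polynomial.coeff_coe, PowerSeries.coeff_trunc]
  split_ifs with h
  · rfl
  · rw [hp i (by omega)]

lemma Sp_coe {T : Type} [CommRing T] {n : ℕ} {p : Polynomial T} (hp : p.natDegree ≤ n) :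
    Sp (p : PowerSeries T) n := by
  intro i hi
  rw [Polynomial.coeff_coe]
  exact Polynomial.coeff_eq_zero_of_natDegree_lt (by omega)

lemma deg_trunc {T : Type} [CommRing T] {n : ℕ} (p : PowerSeries T) :
    (PowerSeries.trunc (n + 1) p).natDegree ≤ n := by
  have := PowerSeries.natDegree_trunc_lt p n
  omega

theorem PSS_exists (A : Type) [CommRing A] (n : ℕ) (p : PowerSeries A) (hp : Sp p n) (hp0 : PowerSeries.coeff 0 p = 1)
    (k : ℕ) (hk : k ≤ n) :
    ∃ (B : Type) (_ : CommRing B) (_ : Algebra A B) (x : Fin k → B) (a : PowerSeries B),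
      Sp a (n - k) ∧ a * xs x = PowerSeries.map (algebraMap A B) p ∧
      Nonempty (Module.Basis (Fin (n.descFactorial k)) A B) ∧
      (∀ (T : Type) [CommRing T] (φ : A →+* T) (x' : Fin k → T) (a' : PowerSeries T), Sp a' (n - k) →
        a' * xs x' = PowerSeries.map φ p →
        ∃ ψ : B →+* T, ψ.comp (algebraMap A B) = φ ∧ ∀ i, ψ (x i) = x' i) ∧
      (∀ (T : Type) [CommRing T] (ψ₁ ψ₂ : B →+* T),
        ψ₁.comp (algebraMap A B) = ψ₂.comp (algebraMap A B) → (∀ i, ψ₁ (x i) = ψ₂ (x i)) → ψ₁ = ψ₂) := by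
  obtain ⟨B, i1, i2, x, a, h1, h2, h3, h4, h5, h6⟩ := PS_exists A n (PowerSeries.trunc (n + 1) p) (deg_trunc p)
    (by rw [PowerSeries.coeff_trunc, if_pos (by omega), hp0]) k hk
  have hcoe : ∀ {T : Type} [CommRing T] (φ : A →+* T),
      (((PowerSeries.trunc (n + 1) p).map φ : Polynomial T) : PowerSeries T) = PowerSeries.map φ p := by
    intro T _ φ
    rw [Polynomial.polynomial_map_coe, coe_trunc hp]
  refine ⟨B, i1, i2, x, a, Sp_coe h1, ?_, h4, ?_, h6⟩
  · rw [xs_eq, ← Polynomial.coe_mul, h3, hcoe]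
  · intro T _ φ x' a' ha' h
    refine h5 T φ x' (PowerSeries.trunc (n - k + 1) a') (deg_trunc a') ?_
    apply Polynomial.coe_injective
    rw [Polynomial.coe_mul, coe_trunc ha', ← xs_eq, h, hcoe]

lemma YS_zero {T : Type} [CommRing T] {m : ℕ} (y : Fin m → T) : PowerSeries.coeff 0 (YS m y) = 0 := by
  rw [coeff_YS, dif_neg (by omega)]

lemma Sp_YS {T : Type} [CommRing T] {m : ℕ} (y : Fin m → T) : Sp (YS m y) m := by
  intro i hi
  rw [coeff_YS, dif_neg (by omega)]

lemma YS_of {T : Type} [CommRing T] {m : ℕ} {P : PowerSeries T} (h0 : PowerSeries.coeff 0 P = 0) (h : Sp P m) :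
    YS m (fun i => PowerSeries.coeff (i + 1) P) = P := by
  ext i
  rw [coeff_YS]
  split_ifs with hi
  · simp only
    congr 1; congr 1; omega
  · by_cases h1 : i = 0
    · rw [h1, h0]
    · rw [h i (by omega)]

theorem W1_exists (n k : ℕ) (hk : k ≤ n) :
    ∃ (W : Type) (_ : CommRing W) (P : Fin n → W) (x : Fin k → W) (a : PowerSeries W),
      (∀ r, 1 ≤ r → r ≤ n → QR 1 (YS n P) r = 0) ∧ Sp a (n - k) ∧ a * xs x = 1 + 2 * YS n P ∧
      Nonempty (Module.Basis (Fin (2 ^ n * n.descFactorial k)) ℤ W) ∧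
      (∀ (T : Type) [CommRing T] (P' : Fin n → T) (x' : Fin k → T) (a' : PowerSeries T),
        (∀ r, 1 ≤ r → r ≤ n → QR 1 (YS n P') r = 0) → Sp a' (n - k) → a' * xs x' = 1 + 2 * YS n P' →
        ∃ ψ : W →+* T, (∀ i, ψ (P i) = P' i) ∧ ∀ i, ψ (x i) = x' i) ∧
      (∀ (T : Type) [CommRing T] (ψ₁ ψ₂ : W →+* T),
        (∀ i, ψ₁ (P i) = ψ₂ (P i)) → (∀ i, ψ₁ (x i) = ψ₂ (x i)) → ψ₁ = ψ₂) := by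
  obtain ⟨Z, _, iA, P, hP, ⟨bas⟩, hl, hu⟩ := Q_exists ℤ n 1 (fun _ => 0)
  obtain rfl : iA = Ring.toIntAlgebra Z := Subsingleton.elim _ _
  obtain ⟨W, _, _, x, a, ha, hax, ⟨bas'⟩, hl', hu'⟩ := PSS_exists Z n (1 + 2 * YS n P)
    ((Sp.one n).add (Sp_YS P).two_mul) (by rw [map_add, coeff_two_mul, YS_zero]; simp) k hk
  have hm : ∀ {T : Type} [CommRing T] (φ : Z →+* T),
      PowerSeries.map φ (1 + 2 * YS n P) = 1 + 2 * YS n (fun i => φ (P i)) := by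
    intro T _ φ
    rw [map_add, map_mul, map_YS, map_one, map_ofNat]
  refine ⟨W, inferInstance, fun i => algebraMap Z W (P i), x, a, ?_, ha, ?_, ?_, ?_, ?_⟩
  · intro r h1 h2
    have := congrArg (algebraMap Z W) (hP r h1 h2)
    rw [map_QR, map_map_ps, map_one, map_YS] at this
    simpa using this
  · rw [hax, hm]
  · have e : IsScalarTower ℤ Z W := inferInstance
    exact ⟨(bas.smulTower bas').reindex (Fintype.equivFinOfCardEq (n := 2 ^ n * n.descFactorial k) (by simp))⟩
  · intro T _ P' x' a' h1 h2 h3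
    obtain ⟨φ, hφ1, hφ2⟩ := hl T (Int.castRingHom T) P' (by
      intro r hr1 hr2
      rw [map_one, h1 r hr1 hr2]; simp)
    obtain ⟨ψ, hψ1, hψ2⟩ := hl' T φ x' a' h2 (by
      rw [h3, hm]
      simp only [hφ2])
    refine ⟨ψ, ?_, hψ2⟩
    intro i
    rw [← hφ2, ← hψ1]; rfl
  · intro T _ ψ₁ ψ₂ h1 h2
    refine hu' T ψ₁ ψ₂ ?_ h2
    refine hu T _ _ (RingHom.ext_int _ _) ?_
    exact h1

theorem W2_exists (M : Type) [CommRing M] (k : ℕ) (g h : PowerSeries M) (hg0 : PowerSeries.coeff 0 g = 1) (hg : Sp g k) :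
    ∃ (W : Type) (_ : CommRing W) (_ : Algebra M W) (y : Fin k → W) (x : Fin k → W),
      (∀ r, 1 ≤ r → r ≤ k → QR (PowerSeries.map (algebraMap M W) g) (YS k y) r =
        QR (PowerSeries.map (algebraMap M W) g) (PowerSeries.map (algebraMap M W) h) r) ∧
      xs x = ng (PowerSeries.map (algebraMap M W) g + 2 * YS k y) ∧
      Nonempty (Module.Basis (Fin (2 ^ k * k.factorial)) M W) ∧
      (∀ (T : Type) [CommRing T] (φ : M →+* T) (y' : Fin k → T) (x' : Fin k → T),
        (∀ r, 1 ≤ r → r ≤ k → QR (PowerSeries.map φ g) (YS k y') r =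
          QR (PowerSeries.map φ g) (PowerSeries.map φ h) r) →
        xs x' = ng (PowerSeries.map φ g + 2 * YS k y') →
        ∃ ψ : W →+* T, ψ.comp (algebraMap M W) = φ ∧ (∀ i, ψ (y i) = y' i) ∧ ∀ i, ψ (x i) = x' i) ∧
      (∀ (T : Type) [CommRing T] (ψ₁ ψ₂ : W →+* T), ψ₁.comp (algebraMap M W) = ψ₂.comp (algebraMap M W) →
        (∀ i, ψ₁ (y i) = ψ₂ (y i)) → (∀ i, ψ₁ (x i) = ψ₂ (x i)) → ψ₁ = ψ₂) := by
  obtain ⟨Z, _, _, y, hy, ⟨bas⟩, hl, hu⟩ := Q_exists M k g (fun r => QR g h r)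
  have hgz : PowerSeries.coeff 0 (PowerSeries.map (algebraMap M Z) g) = 1 := by
    rw [PowerSeries.coeff_map, hg0, map_one]
  have hgs : Sp (PowerSeries.map (algebraMap M Z) g) k := by
    intro i hi
    rw [PowerSeries.coeff_map, hg i hi, map_zero]
  obtain ⟨W, _, _, x, a, ha, hax, ⟨bas'⟩, hl', hu'⟩ := PSS_exists Z k (ng (PowerSeries.map (algebraMap M Z) g + 2 * YS k y))
    ((hgs.add (Sp_YS y).two_mul).ng) (by rw [coeff_ng, map_add, coeff_two_mul, YS_zero, hgz]; simp) k le_rfl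
  let _ : Algebra M W := ((algebraMap Z W).comp (algebraMap M Z)).toAlgebra
  have tow : IsScalarTower M Z W := IsScalarTower.of_algebraMap_eq (fun _ => rfl)
  have hm : ∀ {T : Type} [CommRing T] (φ : Z →+* T),
      PowerSeries.map φ (ng (PowerSeries.map (algebraMap M Z) g + 2 * YS k y)) =
        ng (PowerSeries.map (φ.comp (algebraMap M Z)) g + 2 * YS k (fun i => φ (y i))) := by
    intro T _ φ
    rw [map_ng, map_add (PowerSeries.map φ), map_mul (PowerSeries.map φ), map_YS, map_ofNat (PowerSeries.map φ), map_map_ps]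
  have ha1 : a = 1 := by
    have h0 := congrArg (PowerSeries.coeff 0) hax
    rw [hm, cz, xs_zero, coeff_ng, map_add, coeff_two_mul, YS_zero, PowerSeries.coeff_map, hg0] at h0
    ext i
    rcases Nat.eq_zero_or_pos i with rfl | hi
    · simpa using h0
    · rw [ha i (by omega), PowerSeries.coeff_one, if_neg (by omega)]
  refine ⟨W, inferInstance, inferInstance, fun i => algebraMap Z W (y i), x, ?_, ?_, ?_, ?_, ?_⟩
  · intro r h1 h2
    have := congrArg (algebraMap Z W) (hy r h1 h2)
    rw [map_QR, map_map_ps, map_YS, map_QR, map_QR, map_map_ps, map_map_ps] at this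
    exact this
  · rw [ha1, one_mul, hm] at hax
    exact hax
  · exact ⟨(bas.smulTower bas').reindex (Fintype.equivFinOfCardEq (by simp [Nat.descFactorial_self]))⟩
  · intro T _ φ y' x' h1 h2
    obtain ⟨φ', hφ1, hφ2⟩ := hl T φ y' (by
      intro r hr1 hr2
      rw [h1 r hr1 hr2, map_QR])
    obtain ⟨ψ, hψ1, hψ2⟩ := hl' T φ' x' 1 (Sp.one _) (by
      rw [one_mul, h2, hm, hφ1]
      simp only [hφ2])
    refine ⟨ψ, ?_, ?_, hψ2⟩
    · rw [← hφ1, ← hψ1]; rfl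
    · intro i
      rw [← hφ2, ← hψ1]; rfl
  · intro T _ ψ₁ ψ₂ h1 h2 h3
    refine hu' T ψ₁ ψ₂ ?_ h3
    exact hu T _ _ h1 h2

theorem final_alg (M W : Type) [CommRing M] [CommRing W] [Algebra M W] (a N : ℕ) (ha : 0 < a)
    (b : Module.Basis (Fin a) M W) (c : Module.Basis (Fin N) ℤ W) :
    Module.Free ℤ M ∧ ∃ m : ℕ, Module.rank ℤ M = m ∧ m * a = N := by
  have : Module.Free ℤ W := Module.Free.of_basis c
  have : Module.Finite ℤ W := Module.Finite.of_basis c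
  let f : M →+ W := ⟨⟨fun m => m • b ⟨0, ha⟩, zero_smul _ _⟩, fun x y => add_smul _ _ _⟩
  have hf : Function.Injective f.toIntLinearMap := by
    intro x y hxy
    have h1 : x • b ⟨0, ha⟩ = y • b ⟨0, ha⟩ := hxy
    have h2 := congrArg (fun z => b.repr z ⟨0, ha⟩) h1
    simpa using h2
  let e := LinearEquiv.ofInjective f.toIntLinearMap hf
  have hfree : Module.Free ℤ M := Module.Free.of_equiv e.symm
  have hfin : Module.Finite ℤ M := Module.Finite.equiv e.symm
  refine ⟨hfree, Module.finrank ℤ M, (Module.finrank_eq_rank ℤ M).symm, ?_⟩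
  have b2 := (Module.finBasis ℤ M).smulTower b
  have h1 := Module.finrank_eq_card_basis b2
  have h2 := Module.finrank_eq_card_basis c
  rw [h2] at h1
  simpa using h1.symm

end Assembly

section Final
open PowerSeries

/-- The relations, for a family of elements `t` in a ring. -/
def Rel {T : Type} [CommRing T] (n k : ℕ) (t : Fin (n + k) → T) : Prop :=
  (∀ r, k < r → r ≤ n → QR (lo k (tt t)) (hi k (tt t)) r = 0) ∧
  ∃ d : PowerSeries T, d * ng (lo k (tt t) + 2 * hi k (tt t)) = 1 ∧
    (∀ r, n < r + k → r ≤ n → PowerSeries.coeff r d = 0) ∧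
    (∀ r, n < r → r ≤ n + k → PowerSeries.coeff r (ng (hi k (tt t)) * d) = 0)

lemma map_lo_tt {T S : Type} [CommRing T] [CommRing S] (f : T →+* S) {N : ℕ} (k : ℕ) (t : Fin N → T) :
    PowerSeries.map f (lo k (tt t)) = lo k (tt fun i => f (t i)) := by
  rw [map_lo]
  simp only [map_tt]

lemma map_hi_tt {T S : Type} [CommRing T] [CommRing S] (f : T →+* S) {N : ℕ} (k : ℕ) (t : Fin N → T) :
    PowerSeries.map f (hi k (tt t)) = hi k (tt fun i => f (t i)) := by
  rw [map_hi]
  simp only [map_tt]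

lemma Rel.map {T S : Type} [CommRing T] [CommRing S] (f : T →+* S) {n k : ℕ} {t : Fin (n + k) → T}
    (h : Rel n k t) : Rel n k (fun i => f (t i)) := by
  obtain ⟨h1, d, h2, h3, h4⟩ := h
  refine ⟨?_, PowerSeries.map f d, ?_, ?_, ?_⟩
  · intro r a b
    rw [← map_lo_tt, ← map_hi_tt, ← map_QR, h1 r a b, map_zero]
  · rw [← map_lo_tt, ← map_hi_tt, ← map_one (PowerSeries.map f), ← h2, map_mul, map_ng,
      map_add (PowerSeries.map f), map_mul (PowerSeries.map f), map_ofNat (PowerSeries.map f)]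
  · intro r a b
    rw [PowerSeries.coeff_map, h3 r a b, map_zero]
  · intro r a b
    rw [← map_hi_tt, ← map_ng, ← map_mul, PowerSeries.coeff_map, h4 r a b, map_zero]

lemma lo_zero {T : Type} [CommRing T] {N : ℕ} (k : ℕ) (t : Fin N → T) : PowerSeries.coeff 0 (lo k (tt t)) = 1 := by
  rw [coeff_lo, if_pos (by omega), tt, dif_neg (by omega), if_pos rfl]

lemma Sp_lo {T : Type} [CommRing T] (k : ℕ) (t : ℕ → T) : Sp (lo k t) k := by
  intro i hi
  rw [coeff_lo, if_neg (by omega)]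

lemma hi_low {T : Type} [CommRing T] (k : ℕ) (t : ℕ → T) (i : ℕ) (hi' : i ≤ k) : PowerSeries.coeff i (hi k t) = 0 := by
  rw [coeff_hi, if_neg (by omega)]

lemma Sp_hi {T : Type} [CommRing T] {N : ℕ} (k : ℕ) (t : Fin N → T) : Sp (hi k (tt t)) N := by
  intro i hi'
  rw [coeff_hi]
  split_ifs
  · rw [tt, dif_neg (by omega), if_neg (by omega)]
  · rfl

/-- `t` from `b`, `w`. -/
noncomputable def tOf {T : Type} [CommRing T] (n k : ℕ) (b w : PowerSeries T) : Fin (n + k) → T := fun i =>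
  PowerSeries.coeff (i + 1) w + if (i : ℕ) + 1 ≤ k then PowerSeries.coeff (i + 1) b + PowerSeries.coeff (i + 1) w else 0

/-- `y` from `w`. -/
noncomputable def yOf {T : Type} [CommRing T] (k : ℕ) (w : PowerSeries T) : Fin k → T := fun i =>
  - PowerSeries.coeff (i + 1) w

lemma map_tOf {T S : Type} [CommRing T] [CommRing S] (f : T →+* S) (n k : ℕ) (b w : PowerSeries T) (i : Fin (n + k)) :
    f (tOf n k b w i) = tOf n k (PowerSeries.map f b) (PowerSeries.map f w) i := by
  simp only [tOf, PowerSeries.coeff_map]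
  split_ifs <;> simp

lemma map_yOf {T S : Type} [CommRing T] [CommRing S] (f : T →+* S) (k : ℕ) (w : PowerSeries T) (i : Fin k) :
    f (yOf k w i) = yOf k (PowerSeries.map f w) i := by
  simp only [yOf, PowerSeries.coeff_map, map_neg]

lemma tOf_eq {T : Type} [CommRing T] (n k : ℕ) (t : Fin (n + k) → T) (y : Fin k → T) (i : Fin (n + k)) :
    tOf n k (lo k (tt t) + 2 * YS k y) (hi k (tt t) - YS k y) i = t i := by
  have ht : tt t (i + 1) = t i := by
    rw [tt, dif_pos (by omega)]; rfl
  simp only [tOf, map_sub, map_add, coeff_two_mul, coeff_lo, coeff_hi, ht]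
  by_cases h : (i : ℕ) + 1 ≤ k
  · rw [if_pos h, if_pos h, if_neg (by omega)]; ring
  · rw [if_neg h, if_pos (by omega), coeff_YS, dif_neg (by omega)]; ring

lemma yOf_eq {T : Type} [CommRing T] (n k : ℕ) (t : Fin (n + k) → T) (y : Fin k → T) (i : Fin k) :
    yOf k (hi k (tt t) - YS k y) i = y i := by
  simp only [yOf, map_sub, coeff_hi]
  rw [if_neg (by omega), coeff_YS, dif_pos (by omega)]
  simp

lemma lo_tOf {T : Type} [CommRing T] (n k : ℕ) (b w : PowerSeries T) (hb0 : PowerSeries.coeff 0 b = 1) (hb : Sp b k) :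
    lo k (tt (tOf n k b w)) + 2 * YS k (yOf k w) = b := by
  ext i
  rw [map_add, coeff_two_mul, coeff_lo, coeff_YS]
  by_cases h : i ≤ k
  · rw [if_pos h]
    rcases i with _ | i
    · rw [dif_neg (by omega), tt, dif_neg (by omega), if_pos rfl, hb0]; ring
    · rw [dif_pos (by omega), tt, dif_pos (by omega)]
      simp only [tOf, yOf, Nat.add_sub_cancel]
      rw [if_pos h]; ring
  · rw [if_neg h, dif_neg (by omega), hb i (by omega)]; ring

lemma hi_tOf {T : Type} [CommRing T] (n k : ℕ) (b w : PowerSeries T) (hw0 : PowerSeries.coeff 0 w = 0) (hw : Sp w (n + k)) :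
    hi k (tt (tOf n k b w)) - YS k (yOf k w) = w := by
  ext i
  rw [map_sub, coeff_hi, coeff_YS]
  by_cases h : i ≤ k
  · rw [if_neg (by omega)]
    rcases i with _ | i
    · rw [dif_neg (by omega), hw0]; ring
    · rw [dif_pos (by omega)]
      simp only [yOf, Nat.add_sub_cancel]
      ring
  · rw [if_pos (by omega), dif_neg (by omega), tt]
    by_cases h2 : i ≤ n + k
    · rw [dif_pos (by omega)]
      obtain ⟨j, rfl⟩ : ∃ j, i = j + 1 := ⟨i - 1, by omega⟩
      simp only [tOf, Nat.add_sub_cancel]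
      rw [if_neg h]; ring
    · rw [dif_neg (by omega), if_neg (by omega), hw i (by omega)]; ring

lemma ng_ng {T : Type} [CommRing T] (y : PowerSeries T) : ng (ng y) = y := by
  ext i
  rw [coeff_ng, coeff_ng, ← mul_assoc, ← mul_pow]; simp

theorem main_iso (n k : ℕ) (hk : k ≤ n) (M : Type) [CommRing M] (t : Fin (n + k) → M) (hrel : Rel n k t)
    (hlift : ∀ (T : Type) [CommRing T] (t' : Fin (n + k) → T), Rel n k t' → ∃ φ : M →+* T, ∀ i, φ (t i) = t' i)
    (huniq : ∀ (T : Type) [CommRing T] (φ₁ φ₂ : M →+* T), (∀ i, φ₁ (t i) = φ₂ (t i)) → φ₁ = φ₂) :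
    Module.Free ℤ M ∧ ∃ m : ℕ, Module.rank ℤ M = m ∧ m * (2 ^ k * k.factorial) = 2 ^ n * n.descFactorial k := by
  obtain ⟨W1, _, P1, x1, a1, hP1, ha1, hax1, ⟨bas1⟩, hl1, hu1⟩ := W1_exists n k hk
  obtain ⟨W2, _, _, y2, x2, hq2, hx2, ⟨bas2⟩, hl2, hu2⟩ :=
    W2_exists M k (lo k (tt t)) (hi k (tt t)) (lo_zero k t) (Sp_lo k _)
  -- data in W2
  have hrel2 := hrel.map (algebraMap M W2)
  rw [map_lo_tt] at hx2
  simp only [map_lo_tt, map_hi_tt] at hq2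
  set t2 : Fin (n + k) → W2 := fun i => algebraMap M W2 (t i) with ht2
  set g2 := lo k (tt t2) with hg2
  set h2 := hi k (tt t2) with hh2
  have hb20 : PowerSeries.coeff 0 (g2 + 2 * YS k y2) = 1 := by
    rw [map_add, coeff_two_mul, YS_zero, lo_zero]; simp
  obtain ⟨P2, hP2⟩ : ∃ P2, (g2 + 2 * YS k y2) * P2 = h2 - YS k y2 := by
    obtain ⟨u, hu⟩ := unit_of hb20
    exact ⟨↑u⁻¹ * (h2 - YS k y2), by rw [← hu, Units.mul_inv_cancel_left]⟩
  obtain ⟨hr1, d2, hr2, hr3, hr4⟩ := hrel2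
  obtain ⟨hQ2, hP20, hP2s, a2, ha2, hax2⟩ := dir1 hk (lo_zero k t2) (Sp_lo k _) (hi_low k _) (Sp_hi k t2)
    (YS_zero y2) (Sp_YS y2) hP2 hr2 hq2 hr1 hr3 hr4
  rw [← YS_of hP20 hP2s] at hQ2
  rw [← hx2, ← YS_of hP20 hP2s] at hax2
  obtain ⟨F, hF1, hF2⟩ := hl1 W2 _ x2 a2 hQ2 ha2 hax2
  -- data in W1
  set b1 := ng (xs x1) with hb1
  set w1 := b1 * YS n P1 with hw1
  have hb10 : PowerSeries.coeff 0 b1 = 1 := by rw [hb1, coeff_ng, xs_zero]; simp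
  have hb1s : Sp b1 k := (Sp_xs x1).ng
  have hw10 : PowerSeries.coeff 0 w1 = 0 := by rw [hw1, cz, YS_zero, mul_zero]
  have hw1s : Sp w1 (n + k) := (hb1s.mul (Sp_YS P1)).mono (by omega)
  have hb1e := lo_tOf n k b1 w1 hb10 hb1s
  have hw1e := hi_tOf n k b1 w1 hw10 hw1s
  obtain ⟨d1, hd1⟩ : ∃ d1, d1 * ng (lo k (tt (tOf n k b1 w1)) + 2 * hi k (tt (tOf n k b1 w1))) = 1 := by
    have : IsUnit (ng (lo k (tt (tOf n k b1 w1)) + 2 * hi k (tt (tOf n k b1 w1)))) := by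
      apply unit_of
      rw [coeff_ng, map_add, coeff_two_mul, lo_zero, hi_low k _ 0 (by omega)]; simp
    obtain ⟨u, hu⟩ := this
    exact ⟨↑u⁻¹, by rw [← hu, Units.inv_mul]⟩
  obtain ⟨e1, e2, e3, e4⟩ := dir2 hk (lo_zero k (tOf n k b1 w1)) (Sp_lo k _) (hi_low k _) (YS_zero (yOf k w1)) (Sp_YS (yOf k w1))
    (P := YS n P1) (a := a1) (by rw [hb1e, hw1e]) hd1 (YS_zero P1) (Sp_YS P1) hP1 ha1 (by rw [hb1e, hb1, ng_ng, hax1])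
  obtain ⟨φ, hφ⟩ := hlift W1 (tOf n k b1 w1) ⟨e2, d1, hd1, e3, e4⟩
  obtain ⟨G, hG1, hG2, hG3⟩ := hl2 W1 φ (yOf k w1) x1 (by
    rw [map_lo_tt, map_hi_tt]; simp only [hφ]; exact e1) (by
    rw [map_lo_tt]; simp only [hφ]
    rw [hb1e, hb1, ng_ng])
  -- images of series
  have hFb : PowerSeries.map F b1 = g2 + 2 * YS k y2 := by
    rw [hb1, map_ng, map_xs]; simp only [hF2]
    rw [hx2, ng_ng]
  have hFP : PowerSeries.map F (YS n P1) = P2 := by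
    rw [map_YS]; simp only [hF1]
    exact YS_of hP20 hP2s
  have hFw : PowerSeries.map F w1 = h2 - YS k y2 := by
    rw [hw1, map_mul, hFb, hFP, hP2]
  have hGt : ∀ i, G (t2 i) = tOf n k b1 w1 i := by
    intro i
    rw [← hφ, ← hG1]; rfl
  have hGb : PowerSeries.map G (g2 + 2 * YS k y2) = b1 := by
    rw [map_add, map_mul, map_ofNat, map_YS, hg2, map_lo_tt]
    simp only [hGt, hG2]
    exact hb1e
  have hGw : PowerSeries.map G (h2 - YS k y2) = w1 := by
    rw [map_sub, map_YS, hh2, map_hi_tt]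
    simp only [hGt, hG2]
    exact hw1e
  have hGP : PowerSeries.map G P2 = YS n P1 := by
    have := congrArg (PowerSeries.map G) hP2
    rw [map_mul, hGb, hGw, hw1] at this
    exact (unit_of hb10).mul_left_cancel this
  have hGF : G.comp F = RingHom.id W1 := by
    apply hu1
    · intro i
      rw [RingHom.comp_apply, hF1, ← PowerSeries.coeff_map, hGP, coeff_YS, dif_pos (by omega)]
      simp
    · intro i
      rw [RingHom.comp_apply, hF2, hG3]; rfl
  have hFG : F.comp G = RingHom.id W2 := by
    apply hu2
    · apply huniq
      intro i
      have : F (G (t2 i)) = t2 i := by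
        rw [hGt, map_tOf, hFb, hFw, tOf_eq]
      exact this
    · intro i
      rw [RingHom.comp_apply, hG2, map_yOf, hFw, yOf_eq]; rfl
    · intro i
      rw [RingHom.comp_apply, hG3, hF2]; rfl
  let e : W1 ≃+* W2 := RingEquiv.ofRingHom F G hFG hGF
  exact final_alg M W2 _ _ (by positivity) bas2 (bas1.map e.toAddEquiv.toIntLinearEquiv)

end Final

section Concl

theorem concl (n k : ℕ) (hk : k ≤ n) (I : Ideal (MvPolynomial (Fin (n + k)) ℤ))
    (hI : I = Ideal.span (tDet n k '' Set.Icc (n - k + 1) n ∪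
          tSumRel n k '' Set.Icc (n + 1) (n + k) ∪
          tQuadRel n k '' Set.Icc (k + 1) n)) :
    Module.Free ℤ (MvPolynomial (Fin (n + k)) ℤ ⧸ I) ∧
    Module.rank ℤ (MvPolynomial (Fin (n + k)) ℤ ⧸ I) = (2 ^ (n - k) * n.choose k : Cardinal) := by
  have key : ∀ (T : Type) [CommRing T] (ev : MvPolynomial (Fin (n + k)) ℤ →+* T),
      (∀ z ∈ I, ev z = 0) ↔ Rel n k (fun i => ev (MvPolynomial.X i)) := by
    intro T _ ev
    have h1 : (∀ z ∈ I, ev z = 0) ↔ I ≤ RingHom.ker ev := Iff.rfl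
    rw [h1, hI, Ideal.span_le, Set.union_subset_iff, Set.union_subset_iff]
    simp only [Set.image_subset_iff]
    obtain ⟨d, hd⟩ : ∃ d, d * ng (lo k (tt fun i => ev (MvPolynomial.X i)) + 2 * hi k (tt fun i => ev (MvPolynomial.X i))) = 1 := by
      have : IsUnit (ng (lo k (tt fun i => ev (MvPolynomial.X i)) + 2 * hi k (tt fun i => ev (MvPolynomial.X i)))) := by
        apply unit_of
        rw [coeff_ng, map_add, coeff_two_mul, lo_zero, hi_low k _ 0 (by omega)]; simp
      obtain ⟨u, hu⟩ := this
      exact ⟨↑u⁻¹, by rw [← hu, Units.inv_mul]⟩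
    constructor
    · rintro ⟨⟨ha, hb⟩, hc⟩
      refine ⟨?_, d, hd, ?_, ?_⟩
      · intro r h1 h2
        have : ev (tQuadRel n k r) = 0 := hc ⟨h1, h2⟩
        rw [← ev_tQuadRel n k ev r h1, this, mul_zero]
      · intro r h1 h2
        rw [← ev_tDet n k ev d hd r]
        exact ha ⟨by omega, h2⟩
      · intro r h1 h2
        rw [← ev_tSumRel n k ev d hd r]
        exact hb ⟨h1, h2⟩
    · rintro ⟨hc, d', hd', ha, hb⟩
      refine ⟨⟨?_, ?_⟩, ?_⟩
      · rintro r ⟨h1, h2⟩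
        have : ev (tDet n k r) = 0 := by
          rw [ev_tDet n k ev d' hd' r]
          exact ha r (by omega) h2
        exact this
      · rintro r ⟨h1, h2⟩
        have : ev (tSumRel n k r) = 0 := by
          rw [ev_tSumRel n k ev d' hd' r]
          exact hb r h1 h2
        exact this
      · rintro r ⟨h1, h2⟩
        have h3 := ev_tQuadRel n k ev r h1
        rw [hc r h1 h2] at h3
        have h4 := congrArg (fun z => (-1) ^ r * z) h3
        simp only [← mul_assoc, ← mul_pow] at h4
        have : ev (tQuadRel n k r) = 0 := by simpa using h4
        exact this
  obtain ⟨hfree, m, hm1, hm2⟩ := main_iso n k hk (MvPolynomial (Fin (n + k)) ℤ ⧸ I)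
    (fun i => Ideal.Quotient.mk I (MvPolynomial.X i))
    ((key _ (Ideal.Quotient.mk I)).1 fun z hz => Ideal.Quotient.eq_zero_iff_mem.2 hz)
    (by
      intro T _ t' ht'
      let ev : MvPolynomial (Fin (n + k)) ℤ →+* T := MvPolynomial.eval₂Hom (Int.castRingHom T) t'
      have hev : ∀ i, ev (MvPolynomial.X i) = t' i := fun i => by simp [ev]
      refine ⟨Ideal.Quotient.lift I ev ((key T ev).2 ?_), ?_⟩
      · simpa only [hev] using ht'
      · intro i
        rw [Ideal.Quotient.lift_mk, hev])
    (by
      intro T _ φ₁ φ₂ h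
      apply Ideal.Quotient.ringHom_ext
      apply MvPolynomial.ringHom_ext'
      · exact RingHom.ext_int _ _
      · exact h)
  have hmm : m = 2 ^ (n - k) * n.choose k := by
    have hpos : 0 < 2 ^ k * k.factorial := by positivity
    apply Nat.eq_of_mul_eq_mul_right hpos
    rw [hm2, Nat.descFactorial_eq_factorial_mul_choose]
    have : 2 ^ n = 2 ^ (n - k) * 2 ^ k := by rw [← pow_add]; congr 1; omega
    rw [this]; ring
  have hconv : Module.Free ℤ (MvPolynomial (Fin (n + k)) ℤ ⧸ I) ∧
      Module.rank ℤ (MvPolynomial (Fin (n + k)) ℤ ⧸ I) = (m : Cardinal) := ⟨hfree, hm1⟩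
  refine ⟨hconv.1, hconv.2.trans ?_⟩
  rw [hmm]
  push_cast
  rfl

end Concl

end OGp

/-- **Presentation of `H^*(OG(n−k,2n+1);ℤ)`.** The quotient of `ℤ[τ_1,…,τ_{n+k}]`
by the ideal generated by the determinantal relations for `n−k+1 ≤ r ≤ n`, the
alternating-sum relations for `n+1 ≤ r ≤ n+k` and the quadratic relations for
`k+1 ≤ r ≤ n` is a free `ℤ`-module of rank `2^{n−k} · binom(n,k)`. -/
theorem OGodd_presentation_free_rank (n k : ℕ) (hn : 2 ≤ n) (hk₁ : 1 ≤ k)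
    (hk₂ : k ≤ n - 1) :
    Module.Free ℤ (MvPolynomial (Fin (n + k)) ℤ ⧸
        Ideal.span (tDet n k '' Set.Icc (n - k + 1) n ∪
          tSumRel n k '' Set.Icc (n + 1) (n + k) ∪
          tQuadRel n k '' Set.Icc (k + 1) n)) ∧
    Module.rank ℤ (MvPolynomial (Fin (n + k)) ℤ ⧸
        Ideal.span (tDet n k '' Set.Icc (n - k + 1) n ∪
          tSumRel n k '' Set.Icc (n + 1) (n + k) ∪
          tQuadRel n k '' Set.Icc (k + 1) n)) =
      (2 ^ (n - k) * n.choose k : Cardinal) := by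
  exact OGp.concl n k (by omega) _ rfl
end

section
/- Fix integers n ≥ 1 and 1 ≤ k ≤ n, and set m = n+1−k. Consider R = ℤ[τ_1,…,τ_{k−1}, τ_k, τ′_k, τ_{k+1},…,τ_{n+k}], with the conventions τ_0 = 1 and τ_p = 0 for p < 0 or p > n+k, and define c_p = τ_p for 0 ≤ p < k, c_k = τ_k + τ′_k, c_p = 2τ_p for k < p ≤ n+k, c_p = 0 for p < 0 or p > n+k, and Δ_r = det(c_{1+j−i})_{1≤i,j≤r} (with Δ_0 = 1). Let I ⊆ R be the ideal generated by: Δ_r for n−k+1 < r ≤ n; the two elements τ_k Δ_{n+1−k} − ∑_{p=k+1}^{n+1} (−1)^{p+k+1} τ_p Δ_{n+1−p} and τ′_k Δ_{n+1−k} − ∑_{p=k+1}^{n+1} (−1)^{p+k+1} τ_p Δ_{n+1−p}; the elements ∑_{p=k+1}^{r} (−1)^p τ_p Δ_{r−p} for n+1 < r ≤ n+k; the elements τ_r² + ∑_{i=1}^{r} (−1)^i τ_{r+i} c_{r−i} for k+1 ≤ r ≤ n; and the element τ_k τ′_k + ∑_{i=1}^{k} (−1)^i τ_{k+i} τ_{k−i}.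 Then R/I is a free ℤ-module of rank 2^{n+1−k} · binom(n+1, k). -/
section
open MvPolynomial

/-- The polynomial ring `R = ℤ[τ_1,…,τ_k,τ'_k,τ_{k+1},…,τ_{n+k}]`; the variable
`Option.none` is `τ'_k`, and `Option.some ⟨p-1⟩` is `τ_p`. -/
abbrev DRing (n k : ℕ) := MvPolynomial (Option (Fin (n + k))) ℤ

/-- The element `τ_p`, with the conventions `τ_0 = 1` and `τ_p = 0` for `p < 0`
or `p > n+k`. -/
noncomputable def tauGen (n k : ℕ) (p : ℤ) : DRing n k :=
  if h : 1 ≤ p ∧ p ≤ n + k then X (some ⟨p.toNat - 1, by omega⟩)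
  else if p = 0 then 1 else 0

/-- The extra variable `τ'_k`. -/
noncomputable def tauGen' (n k : ℕ) : DRing n k := X none

/-- `c_p = τ_p` for `0 ≤ p < k`, `c_k = τ_k + τ'_k`, `c_p = 2τ_p` for
`k < p ≤ n+k`, and `c_p = 0` otherwise. -/
noncomputable def cD (n k : ℕ) (p : ℤ) : DRing n k :=
  if 0 ≤ p ∧ p < k then tauGen n k p
  else if p = k then tauGen n k k + tauGen' n k
  else if (k : ℤ) < p ∧ p ≤ n + k then 2 * tauGen n k p
  else 0

/-- The Schur determinant `Δ_r = det (c_{1+j-i})_{1 ≤ i,j ≤ r}` (with `Δ_0 = 1`). -/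
noncomputable def ΔDet (n k : ℕ) (r : ℕ) : DRing n k :=
  (Matrix.of fun i j : Fin r => cD n k (1 + (j : ℤ) - (i : ℤ))).det

/-- `∑_{p=k+1}^{n+1} (−1)^{p+k+1} τ_p Δ_{n+1−p}`. -/
noncomputable def midSum (n k : ℕ) : DRing n k :=
  ∑ p ∈ Finset.Icc (k + 1) (n + 1),
    (-1 : DRing n k) ^ (p + k + 1) * tauGen n k p * ΔDet n k (n + 1 - p)

/-- The relation `∑_{p=k+1}^{r} (−1)^p τ_p Δ_{r−p}`. -/
noncomputable def dSumRel (n k : ℕ) (r : ℕ) : DRing n k :=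
  ∑ p ∈ Finset.Icc (k + 1) r, (-1 : DRing n k) ^ p * tauGen n k p * ΔDet n k (r - p)

/-- The quadratic relation `τ_r² + ∑_{i=1}^{r} (−1)^i τ_{r+i} c_{r−i}`. -/
noncomputable def dQuadRel (n k : ℕ) (r : ℕ) : DRing n k :=
  tauGen n k r ^ 2 +
    ∑ i ∈ Finset.Icc 1 r,
      (-1 : DRing n k) ^ i * tauGen n k (r + i) * cD n k ((r : ℤ) - i)

end

section
open PowerSeries

/-- substitution `z ↦ -z` -/
noncomputable def sg {C : Type} [CommRing C] : C⟦X⟧ →+* C⟦X⟧ := PowerSeries.rescale (-1)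

theorem coeff_sg {C : Type} [CommRing C] (f : C⟦X⟧) (r : ℕ) :
    coeff r (sg f) = (-1) ^ r * coeff r f := by
  simp [sg, coeff_rescale]

theorem sg_map {C D : Type} [CommRing C] [CommRing D] (g : C →+* D) (f : C⟦X⟧) :
    PowerSeries.map g (sg f) = sg (PowerSeries.map g f) := by
  ext r; simp [coeff_sg]

theorem odd_coeff_mul_sg {C : Type} [CommRing C] (f : C⟦X⟧) (r : ℕ) (hr : Odd r) :
    coeff r (f * sg f) = 0 := by
  rw [coeff_mul]
  refine Finset.sum_involution (fun p _ => (p.2, p.1)) ?_ ?_ ?_ ?_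
  · rintro ⟨a, b⟩ h
    simp only [Finset.HasAntidiagonal.mem_antidiagonal] at h
    simp only [coeff_sg]
    subst h
    rcases Nat.even_or_odd a with ha | ha <;> rcases Nat.even_or_odd b with hb | hb
    · exact absurd hr (by simp [Nat.even_add, ha, hb])
    · simp [ha.neg_one_pow, hb.neg_one_pow]; ring
    · simp [ha.neg_one_pow, hb.neg_one_pow]; ring
    · exact absurd hr (by simpa using ha.add_odd hb)
  · rintro ⟨a, b⟩ h _ h2
    simp only [Finset.HasAntidiagonal.mem_antidiagonal, Prod.mk.injEq] at h h2
    rw [← h, h2.1] at hr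
    exact absurd hr (by simp)
  · rintro ⟨a, b⟩ h
    simp only [Finset.HasAntidiagonal.mem_antidiagonal] at h ⊢; omega
  · rintro ⟨a, b⟩ h; rfl

/-- even coefficients of `F * g` when `F` is even -/
theorem even_coeff_mul {C : Type} [CommRing C] (F g : C⟦X⟧) (hF : ∀ r, Odd r → coeff r F = 0)
    (n : ℕ) (hg : ∀ r, r ≤ n → coeff (2 * r) g = 0) (r : ℕ) (hr : r ≤ n) :
    coeff (2 * r) (F * g) = 0 := by
  rw [coeff_mul]
  refine Finset.sum_eq_zero ?_
  rintro ⟨a, b⟩ h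
  simp only [Finset.HasAntidiagonal.mem_antidiagonal] at h
  rcases Nat.even_or_odd' a with ⟨c, ha | ha⟩
  · have : b = 2 * (r - c) := by omega
    simp only
    rw [this, hg _ (by omega), mul_zero]
  · simp only
    rw [hF a ⟨c, ha⟩, zero_mul]

theorem even_coeff_mul_rev {C : Type} [CommRing C] (F g : C⟦X⟧) (hF : ∀ r, Odd r → coeff r F = 0)
    (hF0 : coeff 0 F = 1)
    (n : ℕ) (hg : ∀ r, r ≤ n → coeff (2 * r) (F * g) = 0) (r : ℕ) (hr : r ≤ n) :
    coeff (2 * r) g = 0 := by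
  induction r using Nat.strong_induction_on with
  | _ r ih =>
    have h := hg r hr
    rw [coeff_mul, Finset.sum_eq_single (0, 2 * r)] at h
    · simpa [hF0] using h
    · rintro ⟨a, b⟩ h hne
      simp only [Finset.HasAntidiagonal.mem_antidiagonal] at h
      rcases Nat.even_or_odd' a with ⟨c, ha | ha⟩
      · have hb : b = 2 * (r - c) := by omega
        have hc : c ≠ 0 := by
          rintro rfl
          apply hne
          ext <;> simp <;> omega
        simp only
        rw [hb, ih _ (by omega) (by omega), mul_zero]
      · simp only
        rw [hF a ⟨c, ha⟩, zero_mul]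
    · intro h; simp at h

/-- recursion: if `x = 1 + ...` has degree `≤ k`, `x * g` vanishes above degree `N` and
`g` vanishes on a window of length `k` then `g` vanishes afterwards -/
theorem window {C : Type} [CommRing C] (x g : C⟦X⟧) (k a N : ℕ) (hx0 : coeff 0 x = 1)
    (hx : ∀ r, k < r → coeff r x = 0)
    (hN : ∀ r, N < r → coeff r (x * g) = 0)
    (hNa : N ≤ a + k)
    (hw : ∀ r, a < r → r ≤ a + k → coeff r g = 0) (r : ℕ) (hr : a < r) : coeff r g = 0 := by
  induction r using Nat.strong_induction_on with
  | _ r ih =>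
    by_cases h : r ≤ a + k
    · exact hw r hr h
    · have h1 := hN r (by omega)
      rw [coeff_mul, Finset.sum_eq_single (0, r)] at h1
      · simpa [hx0] using h1
      · rintro ⟨i, j⟩ h2 hne
        simp only [Finset.HasAntidiagonal.mem_antidiagonal] at h2
        simp only
        by_cases hi : k < i
        · rw [hx i hi, zero_mul]
        · have : i ≠ 0 := by
            rintro rfl
            apply hne; ext <;> simp; omega
          rw [ih j (by omega) (by omega), mul_zero]
      · intro h; simp at h

theorem coeff_two_mul {C : Type} [CommRing C] (g : C⟦X⟧) (r : ℕ) :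
    coeff r (2 * g) = 2 * coeff r g := by
  rw [two_mul, map_add, two_mul]

/-- from the quadratic relations: `t + t^∨ + 2 t t^∨` vanishes in low degrees -/
theorem quad_low {C : Type} [CommRing C] (t : C⟦X⟧) (n : ℕ)
    (hq : ∀ r, r ≤ n → coeff (2 * r) (t + t * sg t) = 0) (r : ℕ) (hr : r < 2 * n + 2) :
    coeff r (t + sg t + 2 * (t * sg t)) = 0 := by
  rcases Nat.even_or_odd' r with ⟨c, h | h⟩
  · have := hq c (by omega)
    rw [← h] at this
    have hev : Even r := ⟨c, by omega⟩
    simp only [map_add, coeff_two_mul, coeff_sg, hev.neg_one_pow] at this ⊢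
    linear_combination 2 * this
  · have hod : Odd r := ⟨c, h⟩
    simp only [map_add, coeff_two_mul, odd_coeff_mul_sg t r hod]
    rw [coeff_sg, hod.neg_one_pow]; ring

/-- the `> k` part of a series -/
noncomputable def upper {C : Type} [CommRing C] (k : ℕ) (s : C⟦X⟧) : C⟦X⟧ :=
  PowerSeries.mk fun p => if k < p then coeff p s else 0

/-- `[s D]_r - [u D]_r` if `D` vanishes in degrees from `r - k + 1` to `r` -/
theorem upper_coeff {C : Type} [CommRing C] (k : ℕ) (hk : 1 ≤ k) (s D : C⟦X⟧) (r : ℕ)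
    (hkr : k ≤ r)
    (hD : ∀ j, r - k < j → j < r → coeff j D = 0) :
    coeff r (s * D) = coeff 0 s * coeff r D + coeff k s * coeff (r - k) D
      + coeff r (upper k s * D) := by
  have key : s = PowerSeries.C (coeff 0 s) + PowerSeries.C (coeff k s) * X ^ k + upper k s
      + PowerSeries.mk (fun p => if 0 < p ∧ p < k then coeff p s else 0) := by
    ext p
    simp only [map_add, coeff_C, coeff_C_mul, coeff_X_pow, upper, coeff_mk]
    rcases Nat.eq_zero_or_pos p with rfl | hp
    · have : (0:ℕ) ≠ k := by omega
      simp [this]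
    · rcases lt_trichotomy p k with h | h | h
      · simp [h, h.ne, hp.ne', hp, h.le]
      · subst h; simp [hp.ne']
      · simp [h, h.ne', hp.ne', hp, h.le, not_lt]
  have h0 : coeff r (PowerSeries.mk (fun p => if 0 < p ∧ p < k then coeff p s else 0) * D) = 0 := by
    rw [coeff_mul]
    refine Finset.sum_eq_zero ?_
    rintro ⟨a, b⟩ h
    simp only [Finset.HasAntidiagonal.mem_antidiagonal] at h
    simp only [coeff_mk]
    split_ifs with h1
    · rw [hD b (by omega) (by omega), mul_zero]
    · simp
  conv_lhs => rw [key]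
  rw [add_mul, add_mul, add_mul, map_add, map_add, map_add, h0, coeff_C_mul, mul_assoc,
    coeff_C_mul, coeff_X_pow_mul', if_pos hkr]
  ring

theorem coeff_tail_mul {C : Type} [CommRing C] (f g : C⟦X⟧) (a b r : ℕ)
    (hf : ∀ i, a < i → coeff i f = 0) (hg : ∀ i, b < i → coeff i g = 0) (hr : a + b < r) :
    coeff r (f * g) = 0 := by
  rw [coeff_mul]
  refine Finset.sum_eq_zero ?_
  rintro ⟨i, j⟩ h
  simp only [Finset.HasAntidiagonal.mem_antidiagonal] at h
  simp only
  by_cases hi : a < i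
  · rw [hf i hi, zero_mul]
  · rw [hg j (by omega), mul_zero]

/-- The factorised form implies the relations. -/
theorem relations_of_point {C : Type} [CommRing C] (n k m : ℕ) (hk : 1 ≤ k)
    (hm : m + k = n + 1) (x s t D v : C⟦X⟧)
    (hx : ∀ r, k < r → coeff r x = 0)
    (ht0 : coeff 0 t = 0)
    (hs : s = x * t) (hD : (x + 2 * s) * D = 1)
    (ht : ∀ r, n < r → coeff r t = 0)
    (hq : ∀ r, coeff (2 * r) (t + t * sg t) = 0)
    (hv : ∀ r, m < r → coeff r v = 0) (hxv : x * v = 1 + 2 * sg t) :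
    (∀ r, m < r → coeff r D = 0) ∧
    ((coeff k x + coeff k s) * coeff m D + coeff (n + 1) (upper k s * D) = 0) ∧
    (coeff k s * coeff m D + coeff (n + 1) (upper k s * D) = 0) ∧
    (∀ r, n + 1 < r → coeff r (upper k s * D) = 0) ∧
    (∀ r, coeff (2 * r) (s * sg (x + s)) = 0) := by
  have h1 : t + sg t + 2 * (t * sg t) = 0 := by
    ext r
    exact quad_low t r (fun j _ => hq j) r (by omega)
  have hDv : D = v := by
    have : (x + 2 * s) * v = 1 := by
      rw [hs]
      linear_combination (1 + 2 * t) * hxv + 2 * h1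
    calc D = D * ((x + 2 * s) * v) := by rw [this, mul_one]
      _ = v := by rw [← mul_assoc, mul_comm D, hD, one_mul]
  subst hDv
  have hsD : s * D = - sg t := by
    rw [hs]; linear_combination t * hxv + h1
  have hsD' : ∀ r, n < r → coeff r (s * D) = 0 := by
    intro r hr
    rw [hsD, map_neg, coeff_sg, ht r hr]; simp
  have hs0 : coeff 0 s = 0 := by
    rw [hs, coeff_zero_eq_constantCoeff] at *
    simp [ht0]
  have hb' : coeff k s * coeff m D + coeff (n + 1) (upper k s * D) = 0 := by
    have := upper_coeff k hk s D (n + 1) (by omega) (fun j hj _ => hv j (by omega))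
    rw [hsD' _ (by omega), hs0, show n + 1 - k = m by omega] at this
    rw [zero_mul, zero_add] at this
    exact this.symm
  refine ⟨hv, ?_, hb', ?_, ?_⟩
  · have h2 : coeff k x * coeff m D = 0 := by
      have h3 : coeff (n + 1) (x * D) = 0 := by
        rw [hxv, map_add, coeff_two_mul, coeff_sg, ht _ (by omega), coeff_one]; simp
      rw [coeff_mul, Finset.sum_eq_single (k, m)] at h3
      · exact h3
      · rintro ⟨i, j⟩ h hne
        simp only [Finset.HasAntidiagonal.mem_antidiagonal] at h
        simp only
        by_cases hi : k < i
        · rw [hx i hi, zero_mul]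
        · rw [hv j, mul_zero]
          by_contra hj
          apply hne; ext <;> simp <;> omega
      · intro h; exact absurd (by simp; omega) h
    linear_combination h2 + hb'
  · intro r hr
    have := upper_coeff k hk s D r (by omega) (fun j hj _ => hv j (by omega))
    rw [hsD' _ (by omega), hs0, hv (r - k) (by omega)] at this
    simpa using this.symm
  · intro r
    have : s * sg (x + s) = (x * sg x) * (t + t * sg t) := by
      rw [hs, map_add, map_mul]; ring
    rw [this]
    exact even_coeff_mul _ _ (odd_coeff_mul_sg x) r (fun j _ => hq j) r le_rfl

/-- The relations imply the factorised form. -/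
theorem point_of_relations {C : Type} [CommRing C] (n k m : ℕ) (hk : 1 ≤ k) (hkn : k ≤ n)
    (hm : m + k = n + 1) (x s t D : C⟦X⟧)
    (hx0 : coeff 0 x = 1) (hx : ∀ r, k < r → coeff r x = 0)
    (ht0 : coeff 0 t = 0) (hsn : ∀ r, n + k < r → coeff r s = 0)
    (hs : s = x * t) (hD : (x + 2 * s) * D = 1)
    (ha : ∀ r, m < r → r ≤ n → coeff r D = 0)
    (hb : (coeff k x + coeff k s) * coeff m D + coeff (n + 1) (upper k s * D) = 0)
    (hb' : coeff k s * coeff m D + coeff (n + 1) (upper k s * D) = 0)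
    (hc : ∀ r, n + 1 < r → r ≤ n + k → coeff r (upper k s * D) = 0)
    (hE : ∀ r, 1 ≤ r → r ≤ n → coeff (2 * r) (s * sg (x + s)) = 0) :
    (∀ r, n < r → coeff r t = 0) ∧
    (∀ r, coeff (2 * r) (t + t * sg t) = 0) ∧
    (∀ r, m < r → coeff r D = 0) ∧ x * D = 1 + 2 * sg t := by
  have hs0 : coeff 0 s = 0 := by
    rw [hs, coeff_zero_eq_constantCoeff] at *
    simp [ht0]
  have hq : ∀ r, r ≤ n → coeff (2 * r) (t + t * sg t) = 0 := by
    refine even_coeff_mul_rev (x * sg x) _ (odd_coeff_mul_sg x) ?_ n ?_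
    · rw [coeff_zero_eq_constantCoeff] at *
      have := coeff_sg x 0
      rw [coeff_zero_eq_constantCoeff] at this
      simp [this, hx0]
    · intro r hr
      have : (x * sg x) * (t + t * sg t) = s * sg (x + s) := by
        rw [hs, map_add, map_mul]; ring
      rw [this]
      rcases Nat.eq_zero_or_pos r with rfl | h
      · rw [coeff_zero_eq_constantCoeff] at *
        simp [hs0]
      · exact hE r h hr
  -- vanishing of `D`
  have hD2 : ∀ r, m < r → r ≤ n + k → coeff r D = 0 := by
    intro r
    induction r using Nat.strong_induction_on with
    | _ r ih =>
      intro h1 h2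
      by_cases h3 : r ≤ n
      · exact ha r h1 h3
      have h4 := upper_coeff k hk (x + 2 * s) D r (by omega)
        (fun j hj hj2 => ih j hj2 (by omega) (by omega))
      have hu : upper k (x + 2 * s) = 2 * upper k s := by
        ext p
        simp only [upper, coeff_mk, map_add, coeff_two_mul]
        split_ifs with h
        · rw [hx p h]; ring
        · ring
      rw [hD, hu, coeff_one, if_neg (by omega), map_add, coeff_two_mul, map_add, coeff_two_mul,
        hs0, hx0, mul_assoc, coeff_two_mul] at h4
      by_cases h5 : r = n + 1
      · subst h5
        rw [show n + 1 - k = m by omega] at h4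
        linear_combination -h4 - hb - hb'
      · rw [hc r (by omega) h2, ih (r - k) (by omega) (by omega) (by omega)] at h4
        linear_combination -h4
  have hsD : ∀ r, n < r → r ≤ n + k → coeff r (s * D) = 0 := by
    intro r h1 h2
    rw [upper_coeff k hk s D r (by omega) (fun j hj hj2 => hD2 j (by omega) (by omega)), hs0]
    by_cases h5 : r = n + 1
    · subst h5
      rw [show n + 1 - k = m by omega]
      linear_combination hb'
    · rw [hc r (by omega) h2, hD2 (r - k) (by omega) (by omega)]; ring
  have hxD : x * D * (1 + 2 * t) = 1 := by rw [hs] at hD; linear_combination hD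
  have ht1 : ∀ r, n < r → r ≤ n + k → coeff r t = 0 := by
    intro r h1 h2
    have h3 : X ^ (2 * n + 2) ∣ (t + sg t + 2 * (t * sg t)) := by
      rw [X_pow_dvd_iff]; exact quad_low t n hq
    have h4 : X ^ (2 * n + 2) ∣ s * D + sg t := by
      have : s * D + sg t = (x * D) * (t + sg t + 2 * (t * sg t)) := by
        rw [hs]; linear_combination - sg t * hxD
      rw [this]; exact Dvd.dvd.mul_left h3 _
    rw [X_pow_dvd_iff] at h4
    have h5 := h4 r (by omega)
    rw [map_add, hsD r h1 h2, zero_add, coeff_sg] at h5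
    rcases neg_one_pow_eq_or C r with h | h <;> rw [h] at h5 <;> simpa using h5
  have ht : ∀ r, n < r → coeff r t = 0 :=
    window x t k n (n + k) hx0 hx (fun r hr => by rw [← hs]; exact hsn r hr) le_rfl ht1
  have hq' : ∀ r, coeff (2 * r) (t + t * sg t) = 0 := by
    intro r
    by_cases h : r ≤ n
    · exact hq r h
    · rw [map_add, ht _ (by omega), coeff_tail_mul t (sg t) n n _ ht
        (fun i hi => by rw [coeff_sg, ht i hi, mul_zero]) (by omega), add_zero]
  have h1 : t + sg t + 2 * (t * sg t) = 0 := by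
    ext r
    exact quad_low t r (fun j _ => hq' j) r (by omega)
  have hxD2 : x * D = 1 + 2 * sg t := by
    linear_combination (1 + 2 * sg t) * hxD - 2 * x * D * h1
  refine ⟨ht, hq', ?_, hxD2⟩
  refine window x D k m n hx0 hx ?_ (by omega) (fun r h1 h2 => hD2 r h1 (by omega))
  intro r hr
  rw [hxD2, map_add, coeff_two_mul, coeff_sg, ht _ hr, coeff_one, if_neg (by omega)]; simp
end

section
open PowerSeries

theorem toeplitz_det {R : Type} [CommRing R] (c : ℤ → R) (h0 : c 0 = 1)
    (hneg : ∀ p, p < 0 → c p = 0) (d : R⟦X⟧)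
    (hd : d * PowerSeries.mk (fun p : ℕ => c p) = 1) (r : ℕ) :
    (Matrix.of fun i j : Fin r => c (1 + (j : ℤ) - (i : ℤ))).det = (-1) ^ r * coeff r d := by
  set U : Matrix (Fin (r + 1)) (Fin (r + 1)) R := Matrix.of fun i j => c ((j : ℤ) - (i : ℤ)) with hU
  have hdet : U.det = 1 := by
    rw [Matrix.det_of_isUpperTriangular]
    · simp [hU, h0]
    · intro i j hij
      simp only [hU, Matrix.of_apply]
      apply hneg
      have : (j : ℕ) < i := hij
      omega
  have hrow : ∀ j : Fin (r + 1), ∑ l : Fin (r + 1), coeff (l : ℕ) d * c ((j : ℤ) - (l : ℤ)) = if j = 0 then 1 else 0 := by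
    intro j
    have h1 : coeff (j : ℕ) (d * PowerSeries.mk (fun p : ℕ => c p)) = if j = 0 then 1 else 0 := by
      rw [hd, coeff_one]; congr 1; exact propext (Fin.ext_iff (a := j) (b := 0)).symm
    rw [← h1, coeff_mul, Finset.Nat.sum_antidiagonal_eq_sum_range_succ_mk,
      Fin.sum_univ_eq_sum_range (fun l => coeff l d * c ((j : ℤ) - (l : ℤ)))]
    symm
    have : Finset.range (j : ℕ).succ ⊆ Finset.range (r + 1) := by
      intro a; simp; omega
    refine Finset.sum_subset_zero_on_sdiff this ?_ ?_
    · intro a ha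
      simp only [Finset.mem_sdiff, Finset.mem_range] at ha
      rw [hneg _ (by omega), mul_zero]
    · intro a ha
      simp only [Finset.mem_range] at ha
      simp only [coeff_mk]
      congr 2
      omega
  have hadj : U.adjugate 0 (Fin.last r) = coeff r d := by
    have h2 : Matrix.vecMul (fun l : Fin (r + 1) => coeff (l : ℕ) d) U = Pi.single 0 1 := by
      ext j
      refine (hrow j).trans ?_
      simp [Pi.single_apply]
    have h3 : Matrix.vecMul (Matrix.vecMul (fun l : Fin (r + 1) => coeff (l : ℕ) d) U) U.adjugate
        = fun l : Fin (r + 1) => coeff (l : ℕ) d := by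
      rw [Matrix.vecMul_vecMul, Matrix.mul_adjugate, hdet, one_smul, Matrix.vecMul_one]
    rw [h2] at h3
    have h4 := congrFun h3 (Fin.last r)
    simpa using h4
  rw [Matrix.adjugate_fin_succ_eq_det_submatrix] at hadj
  rw [← hadj]
  have : (U.submatrix (Fin.last r).succAbove (Fin.succAbove 0))
      = Matrix.of fun i j : Fin r => c (1 + (j : ℤ) - (i : ℤ)) := by
    ext i j
    simp only [hU, Matrix.submatrix_apply, Matrix.of_apply, Fin.succAbove_last, Fin.succAbove_zero]
    congr 1
    simp; ring
  rw [this, ← mul_assoc]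
  simp [← mul_pow]
end

section
open Polynomial

/-- iterated function modules -/
theorem fin_fin_addEquiv {T M K : Type} [AddCommGroup T] [AddCommGroup M] [AddCommGroup K] {a b : ℕ}
    (h1 : Nonempty (T ≃+ (Fin a → M))) (h2 : Nonempty (M ≃+ (Fin b → K))) :
    Nonempty (T ≃+ (Fin (a * b) → K)) := by
  obtain ⟨e1⟩ := h1
  obtain ⟨e2⟩ := h2
  let e3 : (Fin a → M) ≃+ (Fin a → Fin b → K) := AddEquiv.piCongrRight fun _ => e2
  let e4 : (Fin a → Fin b → K) ≃+ (Fin (a * b) → K) :=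
    { toFun := fun f p => f (finProdFinEquiv.symm p).1 (finProdFinEquiv.symm p).2
      invFun := fun g i j => g (finProdFinEquiv (i, j))
      left_inv := fun f => by ext i j; simp
      right_inv := fun g => by
        ext p; exact congrArg g (finProdFinEquiv.apply_symm_apply p)
      map_add' := fun f g => by ext p; simp }
  exact ⟨e1.trans (e3.trans e4)⟩

theorem tower (k : ℕ) : ∀ (K : Type) [CommRing K] [Nontrivial K] (P : K[X]) (N : ℕ) (_ : P.Monic)
    (_ : P.natDegree = N) (_ : k ≤ N),
    ∃ (T : Type) (_ : CommRing T) (i : K →+* T) (y : Fin k → T),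
      (∏ j, (X - C (y j))) ∣ P.map i ∧
      Nonempty (T ≃+ (Fin (N.descFactorial k) → K)) ∧
      (∀ (D : Type) [CommRing D] (f : K →+* D) (z : Fin k → D),
        (∏ j, (X - C (z j))) ∣ P.map f → ∃ g : T →+* D, g.comp i = f ∧ ∀ j, g (y j) = z j) ∧
      (∀ (D : Type) [CommRing D] (g g' : T →+* D), g.comp i = g'.comp i →
        (∀ j, g (y j) = g' (y j)) → g = g') := by
  induction k with
  | zero =>
    intro K _ _ P N hP hN hk
    refine ⟨K, inferInstance, RingHom.id K, Fin.elim0, by simp, ⟨?_⟩, ?_, ?_⟩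
    · rw [Nat.descFactorial_zero]
      exact (AddEquiv.funUnique (Fin 1) K).symm
    · intro D _ f z _
      exact ⟨f, by ext; simp, fun j => j.elim0⟩
    · intro D _ g g' h _
      simpa using h
  | succ k ih =>
    intro K _ _ P N hP hN hk
    have hdeg : P.degree ≠ 0 := by
      rw [degree_eq_natDegree hP.ne_zero, hN]
      exact_mod_cast (by omega : N ≠ 0)
    have : Nontrivial (AdjoinRoot P) := by
      have e := (AdjoinRoot.powerBasis' hP).basis.equivFun
      have hd : (AdjoinRoot.powerBasis' hP).dim = N := by simp [hN]
      have : Nonempty (Fin (AdjoinRoot.powerBasis' hP).dim) := ⟨⟨0, by omega⟩⟩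
      exact e.toEquiv.nontrivial
    set ρ := AdjoinRoot.root P with hρ
    set P' := P.map (AdjoinRoot.of P) /ₘ (X - C ρ) with hP'
    have hmul : (X - C ρ) * P' = P.map (AdjoinRoot.of P) := by
      rw [hP', mul_divByMonic_eq_iff_isRoot]
      exact AdjoinRoot.isRoot_root P
    have hP'm : P'.Monic := by
      have : (P.map (AdjoinRoot.of P)).Monic := hP.map _
      rw [← hmul] at this
      exact (monic_X_sub_C ρ).of_mul_monic_left this
    have hP'd : P'.natDegree = N - 1 := by
      have h1 : (P.map (AdjoinRoot.of P)).natDegree = N := by rw [hP.natDegree_map, hN]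
      rw [← hmul, (monic_X_sub_C ρ).natDegree_mul hP'm, natDegree_X_sub_C] at h1
      omega
    obtain ⟨T, hT, i, y, hy, hfree, hlift, huniq⟩ :=
      ih (AdjoinRoot P) P' (N - 1) hP'm hP'd (by omega)
    refine ⟨T, hT, i.comp (AdjoinRoot.of P), Fin.cons (i ρ) y, ?_, ?_, ?_, ?_⟩
    · rw [Fin.prod_univ_succ, ← Polynomial.map_map, ← hmul, Polynomial.map_mul]
      simp only [Fin.cons_zero, Fin.cons_succ, Polynomial.map_sub, map_X, map_C]
      exact mul_dvd_mul_left _ hy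
    · have h1 : Nonempty (AdjoinRoot P ≃+ (Fin N → K)) := by
        have hd : (AdjoinRoot.powerBasis' hP).dim = N := by simp [hN]
        have e := (AdjoinRoot.powerBasis' hP).basis.equivFun.toAddEquiv
        rw [hd] at e
        exact ⟨e⟩
      have h2 := fin_fin_addEquiv hfree h1
      have h3 : N.descFactorial (k + 1) = (N - 1).descFactorial k * N := by
        obtain ⟨M, rfl⟩ : ∃ M, N = M + 1 := ⟨N - 1, by omega⟩
        rw [Nat.succ_descFactorial_succ]; simp [mul_comm]
      rw [h3]
      exact h2
    · intro D _ f z hz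
      rw [Fin.prod_univ_succ] at hz
      have hroot : P.eval₂ f (z 0) = 0 := by
        have h1 : (X - C (z 0)) ∣ P.map f := (Dvd.intro _ rfl).trans hz
        rw [dvd_iff_isRoot, IsRoot.def, eval_map] at h1
        exact h1
      set l := AdjoinRoot.lift f (z 0) hroot with hl
      have hl1 : l.comp (AdjoinRoot.of P) = f := by ext a; simp [hl]
      have hl2 : l ρ = z 0 := by simp [hl, hρ]
      have hz2 : (∏ j : Fin k, (X - C (z j.succ))) ∣ P'.map l := by
        rw [← hl1, ← Polynomial.map_map, ← hmul, Polynomial.map_mul, Polynomial.map_sub, map_X,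
          map_C, hl2] at hz
        obtain ⟨q, hq⟩ := hz
        refine ⟨q, ?_⟩
        rw [mul_assoc] at hq
        exact (monic_X_sub_C (z 0)).isRegular.left hq
      obtain ⟨g, hg1, hg2⟩ := hlift D l (fun j => z j.succ) hz2
      refine ⟨g, ?_, ?_⟩
      · rw [← RingHom.comp_assoc, hg1, hl1]
      · intro j
        refine Fin.cases ?_ ?_ j
        · simp only [Fin.cons_zero]
          rw [← RingHom.comp_apply, hg1, hl2]
        · intro j; simpa using hg2 j
    · intro D _ g g' h1 h2
      apply huniq D g g'
      · refine AdjoinRoot.ringHom_ext (by simpa [RingHom.comp_assoc] using h1) ?_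
        simpa using h2 0
      · intro j; simpa using h2 j.succ
end

section
open MvPolynomial

/-- polynomials all of whose monomials have weight `< W` -/
noncomputable def LW {N : ℕ} (K : Type) [CommRing K] (w : Fin N → ℕ) (W : ℕ) :
    Submodule K (MvPolynomial (Fin N) K) :=
  restrictSupport K {m | Finsupp.weight w m < W}

theorem mem_LW {N : ℕ} {K : Type} [CommRing K] {w : Fin N → ℕ} {W : ℕ}
    {f : MvPolynomial (Fin N) K} :
    f ∈ LW K w W ↔ ∀ m ∈ f.support, Finsupp.weight w m < W := Iff.rfl

theorem LW_mono {N : ℕ} {K : Type} [CommRing K] {w : Fin N → ℕ} {W W' : ℕ} (h : W ≤ W')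
    {f : MvPolynomial (Fin N) K} (hf : f ∈ LW K w W) : f ∈ LW K w W' :=
  fun m hm => lt_of_lt_of_le (hf hm) h

theorem LW_mul {N : ℕ} {K : Type} [CommRing K] {w : Fin N → ℕ} {a b : ℕ}
    {f g : MvPolynomial (Fin N) K} (hf : f ∈ LW K w (a + 1)) (hg : g ∈ LW K w b) :
    f * g ∈ LW K w (a + b) := by
  classical
  rw [mem_LW] at *
  intro m hm
  have := support_mul f g hm
  rw [Finset.mem_add] at this
  obtain ⟨m1, h1, m2, h2, rfl⟩ := this
  have := hf m1 h1
  have := hg m2 h2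
  rw [map_add]; omega

theorem LW_monomial {N : ℕ} {K : Type} [CommRing K] (w : Fin N → ℕ) (m : Fin N →₀ ℕ) (a : K) :
    monomial m a ∈ LW K w (Finsupp.weight w m + 1) := by
  rw [mem_LW]
  intro m' h
  have := support_monomial_subset h
  rw [Finset.mem_singleton] at this
  subst this; omega

/-- `f` has leading term the monomial `m` -/
def Lead {N : ℕ} {K : Type} [CommRing K] (w : Fin N → ℕ) (m : Fin N →₀ ℕ)
    (f : MvPolynomial (Fin N) K) : Prop :=
  f - monomial m 1 ∈ LW K w (Finsupp.weight w m)

theorem Lead.mul {N : ℕ} {K : Type} [CommRing K] {w : Fin N → ℕ} {m m' : Fin N →₀ ℕ}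
    {f g : MvPolynomial (Fin N) K} (hf : Lead w m f) (hg : Lead w m' g) :
    Lead w (m + m') (f * g) := by
  unfold Lead at *
  have h1 : monomial (m + m') (1 : K) = monomial m 1 * monomial m' 1 := by
    rw [monomial_mul, one_mul]
  have h2 : f * g - monomial (m + m') 1 = monomial m 1 * (g - monomial m' 1)
      + (monomial m' 1 * (f - monomial m 1) + (f - monomial m 1) * (g - monomial m' 1)) := by
    rw [h1]; ring
  rw [h2, map_add]
  refine Submodule.add_mem _ (LW_mul (LW_monomial w m 1) hg) (Submodule.add_mem _ ?_ ?_)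
  · rw [add_comm]
    exact LW_mul (LW_monomial w m' 1) hf
  · exact LW_mul (LW_mono (Nat.le_succ _) hf) hg

theorem Lead.one {N : ℕ} {K : Type} [CommRing K] {w : Fin N → ℕ} :
    Lead w 0 (1 : MvPolynomial (Fin N) K) := by
  unfold Lead
  have : (1 : MvPolynomial (Fin N) K) - monomial 0 1 = 0 := by
    rw [← C_apply, map_one, sub_self]
  rw [this]; exact Submodule.zero_mem _

theorem Lead.pow {N : ℕ} {K : Type} [CommRing K] {w : Fin N → ℕ} {m : Fin N →₀ ℕ}
    {f : MvPolynomial (Fin N) K} (hf : Lead w m f) (e : ℕ) : Lead w (e • m) (f ^ e) := by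
  induction e with
  | zero => simpa using Lead.one
  | succ e ih => rw [pow_succ, add_smul, one_smul]; exact ih.mul hf

theorem Lead.prod {N : ℕ} {K : Type} [CommRing K] {w : Fin N → ℕ} {ι : Type} (S : Finset ι)
    (m : ι → Fin N →₀ ℕ) (f : ι → MvPolynomial (Fin N) K) (hf : ∀ i, Lead w (m i) (f i)) :
    Lead w (∑ i ∈ S, m i) (∏ i ∈ S, f i) := by
  classical
  induction S using Finset.induction_on with
  | empty => simpa using Lead.one
  | insert a S ha ih =>
    rw [Finset.sum_insert ha, Finset.prod_insert ha]
    exact (hf a).mul ih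

theorem Lead.X {N : ℕ} {K : Type} [CommRing K] {w : Fin N → ℕ} (i : Fin N) :
    Lead w (Finsupp.single i 1) (MvPolynomial.X i : MvPolynomial (Fin N) K) := by
  unfold Lead
  have : (MvPolynomial.X i : MvPolynomial (Fin N) K) - monomial (Finsupp.single i 1) 1 = 0 := by
    rw [MvPolynomial.X, sub_self]
  rw [this]; exact Submodule.zero_mem _

/-- the modified monomial -/
noncomputable def gmon {N : ℕ} {K : Type} [CommRing K] (g : Fin N → MvPolynomial (Fin N) K)
    (m : Fin N →₀ ℕ) : MvPolynomial (Fin N) K :=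
  ∏ i, (g i ^ (m i / 2) * X i ^ (m i % 2))

theorem gmon_lead {N : ℕ} {K : Type} [CommRing K] {w : Fin N → ℕ}
    (g : Fin N → MvPolynomial (Fin N) K) (hg : ∀ i, Lead w (Finsupp.single i 2) (g i))
    (m : Fin N →₀ ℕ) : Lead w m (gmon g m) := by
  have h := Lead.prod (w := w) Finset.univ (fun i => (m i / 2) • Finsupp.single i 2 +
    (m i % 2) • Finsupp.single i 1) (fun i => g i ^ (m i / 2) * X i ^ (m i % 2))
    (fun i => ((hg i).pow _).mul ((Lead.X i).pow _))
  have h2 : ∑ i, ((m i / 2) • Finsupp.single i 2 + (m i % 2) • Finsupp.single i 1) = m := by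
    conv_rhs => rw [← Finsupp.univ_sum_single m]
    refine Finset.sum_congr rfl fun i _ => ?_
    rw [Finsupp.smul_single, Finsupp.smul_single, ← Finsupp.single_add]
    congr 1
    simp only [smul_eq_mul]; omega
  rw [h2] at h
  exact h

theorem gmon_add {N : ℕ} {K : Type} [CommRing K] (g : Fin N → MvPolynomial (Fin N) K)
    (m : Fin N →₀ ℕ) (i : Fin N) : gmon g (m + Finsupp.single i 2) = g i * gmon g m := by
  classical
  have : g i = ∏ j, (if j = i then g i else 1) := by simp
  rw [this]
  unfold gmon
  rw [← Finset.prod_mul_distrib]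
  refine Finset.prod_congr rfl fun j _ => ?_
  rw [Finsupp.add_apply, Finsupp.single_apply]
  by_cases h : j = i
  · subst h
    simp only [if_true]
    rw [show (m j + 2) / 2 = m j / 2 + 1 by omega, show (m j + 2) % 2 = m j % 2 by omega]
    ring
  · simp [h, Ne.symm h]

noncomputable def gT {N : ℕ} {K : Type} [CommRing K] (g : Fin N → MvPolynomial (Fin N) K) :
    MvPolynomial (Fin N) K →ₗ[K] MvPolynomial (Fin N) K :=
  (basisMonomials (Fin N) K).constr K (gmon g)

theorem gT_monomial {N : ℕ} {K : Type} [CommRing K] (g : Fin N → MvPolynomial (Fin N) K)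
    (m : Fin N →₀ ℕ) (a : K) : gT g (monomial m a) = a • gmon g m := by
  have h : gT g (basisMonomials (Fin N) K m) = gmon g m := Module.Basis.constr_basis _ _ _ _
  rw [coe_basisMonomials] at h
  rw [← h, ← map_smul, smul_monomial, smul_eq_mul, mul_one]

theorem gT_mul {N : ℕ} {K : Type} [CommRing K] (g : Fin N → MvPolynomial (Fin N) K)
    (i : Fin N) (f : MvPolynomial (Fin N) K) : gT g (f * X i ^ 2) = gT g f * g i := by
  induction f using MvPolynomial.induction_on' with
  | monomial m a =>
    rw [X_pow_eq_monomial, monomial_mul, mul_one, gT_monomial, gT_monomial, gmon_add,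
      smul_mul_assoc, mul_comm (g i)]
  | add p q hp hq => rw [add_mul, map_add, map_add, add_mul, hp, hq]

theorem gT_lower {N : ℕ} {K : Type} [CommRing K] {w : Fin N → ℕ}
    (g : Fin N → MvPolynomial (Fin N) K) (hg : ∀ i, Lead w (Finsupp.single i 2) (g i))
    (W : ℕ) (f : MvPolynomial (Fin N) K) (hf : f ∈ LW K w (W + 1)) : gT g f - f ∈ LW K w W := by
  have h1 : gT g f - f = ∑ m ∈ f.support, coeff m f • (gmon g m - monomial m 1) := by
    conv_lhs => rw [f.as_sum, map_sum, ← Finset.sum_sub_distrib]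
    refine Finset.sum_congr rfl fun m _ => ?_
    rw [gT_monomial, smul_sub, smul_monomial, smul_eq_mul, mul_one]
  rw [h1]
  refine Submodule.sum_mem _ fun m hm => Submodule.smul_mem _ _ ?_
  exact LW_mono (Nat.lt_succ_iff.mp (hf hm)) (gmon_lead g hg m)

theorem LW_exists {N : ℕ} {K : Type} [CommRing K] (w : Fin N → ℕ) (f : MvPolynomial (Fin N) K) :
    ∃ W, f ∈ LW K w W := by
  refine ⟨f.support.sup (Finsupp.weight w) + 1, ?_⟩
  rw [mem_LW]
  intro m hm
  exact Nat.lt_succ_iff.mpr (Finset.le_sup (f := Finsupp.weight w) hm)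

theorem LW_zero {N : ℕ} {K : Type} [CommRing K] {w : Fin N → ℕ} {f : MvPolynomial (Fin N) K}
    (hf : f ∈ LW K w 0) : f = 0 := by
  rw [← support_eq_empty, Finset.eq_empty_iff_forall_notMem]
  intro m hm
  exact absurd (hf hm) (by simp)

theorem gT_bijective {N : ℕ} {K : Type} [CommRing K] {w : Fin N → ℕ}
    (g : Fin N → MvPolynomial (Fin N) K) (hg : ∀ i, Lead w (Finsupp.single i 2) (g i)) :
    Function.Bijective (gT g) := by
  constructor
  · rw [injective_iff_map_eq_zero]
    intro f hf
    obtain ⟨W, hW⟩ := LW_exists w f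
    induction W with
    | zero => exact LW_zero hW
    | succ W ih =>
      apply ih
      have := gT_lower g hg W f hW
      rw [hf, zero_sub] at this
      simpa using Submodule.neg_mem _ this
  · intro f
    obtain ⟨W, hW⟩ := LW_exists w f
    induction W generalizing f with
    | zero => exact ⟨0, by rw [LW_zero hW, map_zero]⟩
    | succ W ih =>
      obtain ⟨h, hh⟩ := ih _ (gT_lower g hg W f hW)
      exact ⟨f - h, by rw [map_sub, hh]; ring⟩

/-- exponent vectors of square-free monomials -/
noncomputable def sqf {N : ℕ} (e : Fin N → Fin 2) : Fin N →₀ ℕ :=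
  Finsupp.equivFunOnFinite.symm fun i => (e i : ℕ)

noncomputable def sqfCoeff (N : ℕ) (K : Type) [CommRing K] :
    MvPolynomial (Fin N) K →ₗ[K] ((Fin N → Fin 2) → K) :=
  LinearMap.pi fun e => lcoeff K (sqf e)

theorem sqfCoeff_surj (N : ℕ) (K : Type) [CommRing K] : Function.Surjective (sqfCoeff N K) := by
  classical
  intro v
  refine ⟨∑ e, monomial (sqf e) (v e), ?_⟩
  ext e
  simp only [sqfCoeff, LinearMap.pi_apply, lcoeff_apply, coeff_sum, coeff_monomial]
  rw [Finset.sum_eq_single e]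
  · simp
  · intro b _ hb
    rw [if_neg]
    intro h
    apply hb
    ext i
    have := DFunLike.congr_fun h i
    simpa [sqf] using this
  · simp

theorem sqfCoeff_ker (N : ℕ) (K : Type) [CommRing K] (f : MvPolynomial (Fin N) K) :
    sqfCoeff N K f = 0 ↔ f ∈ Ideal.span (Set.range fun i : Fin N => (X i ^ 2 : MvPolynomial (Fin N) K)) := by
  have h1 : (Set.range fun i : Fin N => (X i ^ 2 : MvPolynomial (Fin N) K)) =
      (fun s => monomial s (1 : K)) '' (Set.range fun i => Finsupp.single i 2) := by
    rw [← Set.range_comp]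
    congr 1
    ext i : 1
    simp [X_pow_eq_monomial]
  rw [h1, mem_ideal_span_monomial_image]
  constructor
  · intro h m hm
    by_contra hne
    push Not at hne
    have hlt : ∀ i, m i < 2 := by
      intro i
      by_contra hi
      apply hne _ ⟨i, rfl⟩
      rw [Finsupp.single_le_iff]; omega
    have h2 : sqf (fun i => ⟨m i, hlt i⟩) = m := by ext i; simp [sqf]
    have h3 := congrFun h (fun i => ⟨m i, hlt i⟩)
    simp only [sqfCoeff, LinearMap.pi_apply, lcoeff_apply, h2] at h3
    exact (mem_support_iff.mp hm) h3
  · intro h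
    ext e
    simp only [sqfCoeff, LinearMap.pi_apply, lcoeff_apply, Pi.zero_apply]
    by_contra hne
    obtain ⟨_, ⟨i, rfl⟩, hle⟩ := h _ (mem_support_iff.mpr hne)
    rw [Finsupp.single_le_iff] at hle
    have : sqf e i = e i := by simp [sqf]
    omega

theorem quad_free {N : ℕ} {K : Type} [CommRing K] {w : Fin N → ℕ}
    (g : Fin N → MvPolynomial (Fin N) K) (hg : ∀ i, Lead w (Finsupp.single i 2) (g i)) :
    Nonempty ((MvPolynomial (Fin N) K ⧸ Ideal.span (Set.range g)) ≃+ (Fin (2 ^ N) → K)) := by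
  let T := LinearEquiv.ofBijective (gT g) (gT_bijective g hg)
  have hT : ∀ f, T f = gT g f := fun f => rfl
  let Q : MvPolynomial (Fin N) K →ₗ[K] ((Fin N → Fin 2) → K) := sqfCoeff N K ∘ₗ T.symm.toLinearMap
  have hQ : Function.Surjective Q := (sqfCoeff_surj N K).comp T.symm.surjective
  have hker : ∀ f, Q f = 0 ↔ f ∈ Ideal.span (Set.range g) := by
    intro f
    obtain ⟨f, rfl⟩ := T.surjective f
    have : Q (T f) = sqfCoeff N K f := by simp [Q]
    rw [this, sqfCoeff_ker, Ideal.mem_span_range_iff_exists_fun, Ideal.mem_span_range_iff_exists_fun]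
    constructor
    · rintro ⟨c, rfl⟩
      exact ⟨fun i => T (c i), by simp only [map_sum, hT, gT_mul]⟩
    · rintro ⟨c, hc⟩
      refine ⟨fun i => T.symm (c i), T.injective ?_⟩
      rw [← hc]
      simp only [map_sum]
      refine Finset.sum_congr rfl fun i _ => ?_
      rw [hT, gT_mul, ← hT, T.apply_symm_apply]
  let e1 : (MvPolynomial (Fin N) K ⧸ Ideal.span (Set.range g)) ≃+ ((Fin N → Fin 2) → K) := by
    have hs : (Ideal.span (Set.range g)).toAddSubgroup = Q.toAddMonoidHom.ker := by
      ext f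
      exact (hker f).symm
    refine AddEquiv.trans ?_ (QuotientAddGroup.quotientKerEquivOfSurjective Q.toAddMonoidHom hQ)
    exact QuotientAddGroup.quotientAddEquivOfEq hs
  let e2 : ((Fin N → Fin 2) → K) ≃+ (Fin (2 ^ N) → K) :=
    (LinearEquiv.funCongrLeft K K (finFunctionFinEquiv (m := 2) (n := N)).symm).toAddEquiv
  exact ⟨e1.trans e2⟩
end

section
/-- strictly concave weights -/
def wt (N a : ℕ) : ℕ := if 1 ≤ a ∧ a ≤ N then 2 * (N + 1) ^ 2 - a ^ 2 else 0

theorem wt_lt (N r a b : ℕ) (hr1 : 1 ≤ r) (hrN : r ≤ N) (hab : a + b = 2 * r) (hne : a ≠ b) :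
    wt N a + wt N b < 2 * wt N r := by
  have hr : wt N r = 2 * (N + 1) ^ 2 - r ^ 2 := by rw [wt, if_pos ⟨hr1, hrN⟩]
  have hrs : r ^ 2 < (N + 1) ^ 2 := Nat.pow_lt_pow_left (by omega) (by norm_num)
  by_cases ha : 1 ≤ a ∧ a ≤ N
  · have hwa : wt N a = 2 * (N + 1) ^ 2 - a ^ 2 := by rw [wt, if_pos ha]
    have has : a ^ 2 < (N + 1) ^ 2 := Nat.pow_lt_pow_left (by omega) (by norm_num)
    by_cases hb : 1 ≤ b ∧ b ≤ N
    · have hwb : wt N b = 2 * (N + 1) ^ 2 - b ^ 2 := by rw [wt, if_pos hb]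
      have hbs : b ^ 2 < (N + 1) ^ 2 := Nat.pow_lt_pow_left (by omega) (by norm_num)
      have key : 2 * r ^ 2 < a ^ 2 + b ^ 2 := by
        zify at *
        have h0 : (0 : ℤ) < (a - b) ^ 2 := by
          have : (a : ℤ) - b ≠ 0 := sub_ne_zero.mpr hne
          positivity
        nlinarith
      omega
    · have hwb : wt N b = 0 := by rw [wt, if_neg hb]
      omega
  · have hwa : wt N a = 0 := by rw [wt, if_neg ha]
    by_cases hb : 1 ≤ b ∧ b ≤ N
    · have hwb : wt N b = 2 * (N + 1) ^ 2 - b ^ 2 := by rw [wt, if_pos hb]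
      omega
    · have hwb : wt N b = 0 := by rw [wt, if_neg hb]
      omega

theorem LW_C {N : ℕ} {K : Type} [CommRing K] (w : Fin N → ℕ) (a : K) (W : ℕ) :
    (MvPolynomial.C a : MvPolynomial (Fin N) K) ∈ LW K w (W + 1) := by
  have := LW_monomial w (0 : Fin N →₀ ℕ) a
  rw [map_zero] at this
  exact LW_mono (by omega) this

theorem LW_X {N : ℕ} {K : Type} [CommRing K] (w : Fin N → ℕ) (i : Fin N) :
    (MvPolynomial.X i : MvPolynomial (Fin N) K) ∈ LW K w (w i + 1) := by
  have := LW_monomial (K := K) w (Finsupp.single i 1) 1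
  rwa [Finsupp.weight_single, one_smul] at this

theorem quad_series_lead {N : ℕ} {K : Type} [CommRing K] (s d : PowerSeries (MvPolynomial (Fin N) K))
    (ε : MvPolynomial (Fin N) K) (hε : ε = 1 ∨ ε = -1)
    (hs : ∀ a, PowerSeries.coeff a s ∈ LW K (fun i : Fin N => wt N (i + 1)) (wt N a + 1))
    (hd : ∀ a, PowerSeries.coeff a d ∈ LW K (fun i : Fin N => wt N (i + 1)) (wt N a + 1))
    (hrr : ∀ i : Fin N, PowerSeries.coeff (i + 1 : ℕ) s * PowerSeries.coeff (i + 1 : ℕ) d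
      - ε * MvPolynomial.X i ^ 2 ∈ LW K (fun i : Fin N => wt N (i + 1)) (2 * wt N (i + 1)))
    (i : Fin N) :
    Lead (fun i : Fin N => wt N (i + 1)) (Finsupp.single i 2)
      (ε * ((-1) ^ (i + 1 : ℕ) * PowerSeries.coeff (2 * (i + 1 : ℕ)) (s * sg d))) := by
  unfold Lead
  rw [Finsupp.weight_single, smul_eq_mul, ← MvPolynomial.X_pow_eq_monomial]
  set r : ℕ := (i : ℕ) + 1 with hr
  have hεmem : ∀ f W, f ∈ LW K (fun i : Fin N => wt N (i + 1)) W →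
      ε * f ∈ LW K (fun i : Fin N => wt N (i + 1)) W := by
    intro f W hf
    rcases hε with h | h <;> rw [h]
    · simpa using hf
    · simpa using hf
  have hsmem : ∀ (e : ℕ) f W, f ∈ LW K (fun i : Fin N => wt N (i + 1)) W →
      (-1) ^ e * f ∈ LW K (fun i : Fin N => wt N (i + 1)) W := by
    intro e f W hf
    rcases neg_one_pow_eq_or (MvPolynomial (Fin N) K) e with h | h <;> rw [h]
    · simpa using hf
    · simpa using hf
  have hsum : PowerSeries.coeff (2 * r) (s * sg d) =
      (-1) ^ r * (PowerSeries.coeff r s * PowerSeries.coeff r d) +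
      ∑ p ∈ (Finset.HasAntidiagonal.antidiagonal (2 * r)).erase (r, r),
        PowerSeries.coeff p.1 s * PowerSeries.coeff p.2 (sg d) := by
    rw [PowerSeries.coeff_mul, ← Finset.add_sum_erase _ _ (a := (r, r))]
    · simp only [coeff_sg]; ring
    · rw [Finset.HasAntidiagonal.mem_antidiagonal]; simp; omega
  have hε2 : ε * ε = 1 := by rcases hε with h | h <;> simp [h]
  have h1 : ((-1 : MvPolynomial (Fin N) K) ^ r) * (-1) ^ r = 1 := by
    rw [← mul_pow]; simp
  rw [hsum]
  have h2 : ε * ((-1) ^ r * ((-1) ^ r * (PowerSeries.coeff r s * PowerSeries.coeff r d) +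
      ∑ p ∈ (Finset.HasAntidiagonal.antidiagonal (2 * r)).erase (r, r),
        PowerSeries.coeff p.1 s * PowerSeries.coeff p.2 (sg d))) - MvPolynomial.X i ^ 2 =
      ε * (PowerSeries.coeff r s * PowerSeries.coeff r d - ε * MvPolynomial.X i ^ 2) +
      ε * ((-1) ^ r * ∑ p ∈ (Finset.HasAntidiagonal.antidiagonal (2 * r)).erase (r, r),
        PowerSeries.coeff p.1 s * PowerSeries.coeff p.2 (sg d)) := by
    linear_combination (ε * PowerSeries.coeff r s * PowerSeries.coeff r d) * h1 +
      (MvPolynomial.X i ^ 2) * hε2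
  rw [h2]
  refine Submodule.add_mem _ (hεmem _ _ (hrr i)) (hεmem _ _ (hsmem _ _ _ ?_))
  refine Submodule.sum_mem _ ?_
  rintro ⟨a, b⟩ hab
  rw [Finset.mem_erase, Finset.HasAntidiagonal.mem_antidiagonal] at hab
  obtain ⟨hne, hab⟩ := hab
  simp only at hab ⊢
  have hlt := wt_lt N r a b (by omega) (by omega) hab (by
    rintro rfl
    apply hne; ext <;> simp <;> omega)
  rw [coeff_sg]
  refine LW_mono ?_ (LW_mul (hs a) (hsmem b _ _ (hd b)))
  omega

/-- symmetric expansion of the even coefficients -/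
theorem coeff_two_mul_sg {C : Type} [CommRing C] (s d : PowerSeries C) (r : ℕ) :
    (-1) ^ r * PowerSeries.coeff (2 * r) (s * sg d) =
      PowerSeries.coeff r s * PowerSeries.coeff r d +
      ∑ i ∈ Finset.Icc 1 r, (-1) ^ i *
        (PowerSeries.coeff (r + i) s * PowerSeries.coeff (r - i) d
          + PowerSeries.coeff (r - i) s * PowerSeries.coeff (r + i) d) := by
  have hI : Finset.Icc 1 r = (Finset.range r).image (· + 1) := by
    ext a
    simp only [Finset.mem_Icc, Finset.mem_image, Finset.mem_range]
    constructor
    · intro h; exact ⟨a - 1, by omega, by omega⟩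
    · rintro ⟨b, h, rfl⟩; omega
  rw [hI, Finset.sum_image (by intro a _ b _ h; simpa using h)]
  rw [PowerSeries.coeff_mul, Finset.Nat.sum_antidiagonal_eq_sum_range_succ_mk,
    show (2 * r).succ = r + (r + 1) by omega, Finset.sum_range_add, Finset.sum_range_succ',
    ← Finset.sum_range_reflect]
  simp only [coeff_sg, mul_add, Finset.sum_add_distrib, Finset.mul_sum]
  have h1 : ((-1 : C) ^ r) * (-1) ^ r = 1 := by
    rw [← mul_pow]; simp
  have e1 : ∑ x ∈ Finset.range r, (-1 : C) ^ r * (PowerSeries.coeff (r - 1 - x) s *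
      ((-1) ^ (2 * r - (r - 1 - x)) * PowerSeries.coeff (2 * r - (r - 1 - x)) d)) =
      ∑ x ∈ Finset.range r, (-1) ^ (x + 1) *
        (PowerSeries.coeff (r - (x + 1)) s * PowerSeries.coeff (r + (x + 1)) d) := by
    refine Finset.sum_congr rfl fun x hx => ?_
    rw [Finset.mem_range] at hx
    rw [show 2 * r - (r - 1 - x) = r + (x + 1) by omega, show r - 1 - x = r - (x + 1) by omega,
      pow_add]
    linear_combination ((-1) ^ (x + 1) *
        (PowerSeries.coeff (r - (x + 1)) s * PowerSeries.coeff (r + (x + 1)) d)) * h1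
  have e2 : ∑ x ∈ Finset.range r, (-1 : C) ^ r * (PowerSeries.coeff (r + (x + 1)) s *
      ((-1) ^ (2 * r - (r + (x + 1))) * PowerSeries.coeff (2 * r - (r + (x + 1))) d)) =
      ∑ x ∈ Finset.range r, (-1) ^ (x + 1) *
        (PowerSeries.coeff (r + (x + 1)) s * PowerSeries.coeff (r - (x + 1)) d) := by
    refine Finset.sum_congr rfl fun x hx => ?_
    rw [Finset.mem_range] at hx
    rw [show 2 * r - (r + (x + 1)) = r - (x + 1) by omega]
    have : (-1 : C) ^ r * (-1) ^ (r - (x + 1)) = (-1) ^ (x + 1) := by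
      have h3 : ((-1 : C) ^ (r - (x + 1))) * (-1) ^ (r - (x + 1)) = 1 := by
        rw [← mul_pow]; simp
      conv_lhs => rw [show r = (x + 1) + (r - (x + 1)) by omega, pow_add]
      rw [show x + 1 + (r - (x + 1)) - (x + 1) = r - (x + 1) by omega, mul_assoc, h3, mul_one]
    rw [← this]; ring
  rw [e1, e2, add_zero, show 2 * r - r = r by omega]
  linear_combination (PowerSeries.coeff r s * PowerSeries.coeff r d) * h1
end

section
open PowerSeries

theorem tauGen_zero (n k : ℕ) : tauGen n k 0 = 1 := by
  simp [tauGen]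

theorem tauGen_big (n k p : ℕ) (h : n + k < p) : tauGen n k p = 0 := by
  unfold tauGen
  rw [dif_neg (by omega), if_neg (by omega)]

/-- the series of the `c_p` -/
noncomputable def cSer (n k : ℕ) : (DRing n k)⟦X⟧ := PowerSeries.mk fun p : ℕ => cD n k p

/-- the series of the signed determinants -/
noncomputable def DSer (n k : ℕ) : (DRing n k)⟦X⟧ :=
  PowerSeries.mk fun r : ℕ => (-1) ^ r * ΔDet n k r

/-- the series of the `τ_p` with `p > k` -/
noncomputable def uSer (n k : ℕ) : (DRing n k)⟦X⟧ :=
  PowerSeries.mk fun p : ℕ => if k < p then tauGen n k p else 0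

theorem cSer_mul_DSer (n k : ℕ) (hk : 1 ≤ k) : cSer n k * DSer n k = 1 := by
  have h0 : cD n k 0 = 1 := by
    unfold cD; rw [if_pos (by omega), tauGen_zero]
  have hneg : ∀ p : ℤ, p < 0 → cD n k p = 0 := by
    intro p hp
    unfold cD; rw [if_neg (by omega), if_neg (by omega), if_neg (by omega)]
  have hc0 : constantCoeff (cSer n k) = ((1 : (DRing n k)ˣ) : DRing n k) := by
    rw [← coeff_zero_eq_constantCoeff_apply]
    simp [cSer, h0]
  have hd := PowerSeries.invOfUnit_mul (cSer n k) 1 hc0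
  have : DSer n k = invOfUnit (cSer n k) 1 := by
    ext1 r
    rw [DSer, coeff_mk, ΔDet, toeplitz_det (cD n k) h0 hneg _ hd r, ← mul_assoc, ← pow_add,
      (Even.add_self r).neg_one_pow, one_mul]
  rw [this]
  exact PowerSeries.mul_invOfUnit (cSer n k) 1 hc0

theorem coeff_uD (n k r : ℕ) :
    dSumRel n k r = (-1) ^ r * coeff r (uSer n k * DSer n k) := by
  rw [coeff_mul, Finset.Nat.sum_antidiagonal_eq_sum_range_succ_mk, Finset.mul_sum, dSumRel]
  have hsub : Finset.Icc (k + 1) r ⊆ Finset.range r.succ := by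
    intro p hp; simp at hp ⊢; omega
  rw [← Finset.sum_subset hsub]
  · refine Finset.sum_congr rfl fun p hp => ?_
    simp only [Finset.mem_Icc] at hp
    simp only [uSer, DSer, coeff_mk]
    rw [if_pos (by omega)]
    obtain ⟨d, rfl⟩ := Nat.exists_eq_add_of_le hp.2
    have : (-1 : DRing n k) ^ (p + d) * (-1) ^ d = (-1) ^ p := by
      rw [pow_add, mul_assoc, ← pow_add, (Even.add_self d).neg_one_pow, mul_one]
    rw [Nat.add_sub_cancel_left, ← this]; ring
  · intro p hp hp2
    simp only [Finset.mem_range, Finset.mem_Icc] at hp hp2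
    simp only [uSer, coeff_mk]
    rw [if_neg (by omega)]; simp

theorem midSum_eq (n k : ℕ) : midSum n k = (-1) ^ (k + 1) * dSumRel n k (n + 1) := by
  rw [midSum, dSumRel, Finset.mul_sum]
  refine Finset.sum_congr rfl fun p _ => ?_
  ring

/-- the generators -/
def gens (n k : ℕ) : Set (DRing n k) :=
  (ΔDet n k '' Set.Icc (n - k + 2) n ∪
        {tauGen n k k * ΔDet n k (n + 1 - k) - midSum n k,
         tauGen' n k * ΔDet n k (n + 1 - k) - midSum n k} ∪
        dSumRel n k '' Set.Icc (n + 2) (n + k) ∪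
        dQuadRel n k '' Set.Icc (k + 1) n ∪
        {tauGen n k k * tauGen' n k +
          ∑ i ∈ Finset.Icc 1 k,
            (-1 : DRing n k) ^ i * tauGen n k (k + i) * tauGen n k ((k : ℤ) - i)})

/-- A point: values of the generators in terms of two series. -/
structure Pt (n k : ℕ) {C : Type} [CommRing C] (f : DRing n k →+* C) (x s : C⟦X⟧) : Prop where
  x0 : coeff 0 x = 1
  xk : ∀ r, k < r → coeff r x = 0
  s0 : coeff 0 s = 0
  sn : ∀ r, n + k < r → coeff r s = 0
  lo : ∀ p : ℕ, 1 ≤ p → p < k → f (tauGen n k p) = coeff p x + 2 * coeff p s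
  mid : f (tauGen n k k) = coeff k x + coeff k s
  mid' : f (tauGen' n k) = coeff k s
  hi : ∀ p : ℕ, k < p → p ≤ n + k → f (tauGen n k p) = coeff p s

section
variable {n k : ℕ} {C : Type} [CommRing C] {f : DRing n k →+* C} {x s : C⟦X⟧}

theorem Pt.hi' (h : Pt n k f x s) (p : ℕ) (hp : k < p) : f (tauGen n k p) = coeff p s := by
  by_cases h2 : p ≤ n + k
  · exact h.hi p hp h2
  · rw [tauGen_big n k p (by omega), h.sn p (by omega), map_zero]

theorem Pt.c (h : Pt n k f x s) (hk : 1 ≤ k) (p : ℕ) :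
    f (cD n k p) = coeff p x + 2 * coeff p s := by
  unfold cD
  rcases Nat.eq_zero_or_pos p with rfl | hp
  · rw [if_pos (by omega)]
    simp [tauGen_zero, h.x0, h.s0]
  rcases lt_trichotomy p k with hpk | rfl | hpk
  · rw [if_pos (by omega), h.lo p hp hpk]
  · rw [if_neg (by omega), if_pos rfl, map_add, h.mid, h.mid']; ring
  · rw [if_neg (by omega), if_neg (by omega), h.xk p hpk]
    by_cases h2 : p ≤ n + k
    · rw [if_pos (by omega), map_mul, h.hi p hpk h2, map_ofNat f 2, zero_add]
    · rw [if_neg (by omega), h.sn p (by omega)]; simp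

theorem Pt.mapc (h : Pt n k f x s) (hk : 1 ≤ k) : PowerSeries.map f (cSer n k) = x + 2 * s := by
  ext p
  rw [coeff_map, cSer, coeff_mk, h.c hk, map_add, coeff_two_mul]

theorem Pt.mapu (h : Pt n k f x s) : PowerSeries.map f (uSer n k) = upper k s := by
  ext p
  rw [coeff_map, uSer, coeff_mk, upper, coeff_mk]
  split_ifs with hp
  · exact h.hi' p hp
  · simp

theorem Pt.cmulD (h : Pt n k f x s) (hk : 1 ≤ k) :
    (x + 2 * s) * PowerSeries.map f (DSer n k) = 1 := by
  rw [← h.mapc hk, ← map_mul, cSer_mul_DSer n k hk, map_one]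

theorem Pt.quad (h : Pt n k f x s) (hk : 1 ≤ k) (r : ℕ) (hr : k < r) :
    f (dQuadRel n k r) = (-1) ^ r * coeff (2 * r) (s * sg (x + s)) := by
  rw [coeff_two_mul_sg, dQuadRel, map_add, map_pow, map_sum, h.hi' r hr]
  congr 1
  · rw [map_add, h.xk r hr]; ring
  · refine Finset.sum_congr rfl fun i hi => ?_
    simp only [Finset.mem_Icc] at hi
    have e1 := h.hi' (r + i) (by omega)
    have e2 := h.c hk (r - i)
    push_cast [hi.2] at e1 e2
    rw [map_mul, map_mul, e1, e2, map_add, map_add, h.xk (r + i) (by omega)]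
    simp only [map_pow, map_neg, map_one]
    ring

theorem Pt.quadk (h : Pt n k f x s) :
    f (tauGen n k k * tauGen' n k +
          ∑ i ∈ Finset.Icc 1 k,
            (-1 : DRing n k) ^ i * tauGen n k (k + i) * tauGen n k ((k : ℤ) - i)) =
      (-1) ^ k * coeff (2 * k) (s * sg (x + s)) := by
  rw [coeff_two_mul_sg, map_add, map_mul, map_sum, h.mid, h.mid']
  congr 1
  · rw [map_add]; ring
  · refine Finset.sum_congr rfl fun i hi => ?_
    simp only [Finset.mem_Icc] at hi
    have e1 := h.hi' (k + i) (by omega)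
    have e2 : f (tauGen n k ((k - i : ℕ) : ℤ)) = coeff (k - i) x + 2 * coeff (k - i) s := by
      rcases Nat.eq_zero_or_pos (k - i) with h0 | h0
      · rw [h0, h.x0, h.s0]; simp [tauGen_zero]
      · exact h.lo _ h0 (by omega)
    push_cast [hi.2] at e1 e2
    rw [map_mul, map_mul, e1, e2, map_add, map_add, h.xk (k + i) (by omega)]
    simp only [map_pow, map_neg, map_one]
    ring

theorem neg_one_pow_mul_eq_zero (r : ℕ) (a : C) : (-1) ^ r * a = 0 ↔ a = 0 := by
  rcases neg_one_pow_eq_or C r with h | h <;> simp [h]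

theorem Pt.fΔ (f : DRing n k →+* C) (r : ℕ) :
    f (ΔDet n k r) = (-1) ^ r * coeff r (PowerSeries.map f (DSer n k)) := by
  rw [coeff_map, DSer, coeff_mk, map_mul, map_pow, map_neg, map_one, ← mul_assoc, ← pow_add,
      (Even.add_self r).neg_one_pow, one_mul]

theorem Pt.fsum (h : Pt n k f x s) (r : ℕ) :
    f (dSumRel n k r) = (-1) ^ r * coeff r (upper k s * PowerSeries.map f (DSer n k)) := by
  rw [coeff_uD, map_mul, ← coeff_map, map_mul, h.mapu]; simp

theorem Pt.fmid (h : Pt n k f x s) (m : ℕ) (hm : m + k = n + 1) (a : DRing n k) :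
    f (a * ΔDet n k (n + 1 - k) - midSum n k) =
      (-1) ^ m * (f a * coeff m (PowerSeries.map f (DSer n k)) +
        coeff (n + 1) (upper k s * PowerSeries.map f (DSer n k))) := by
  have : n + 1 - k = m := by omega
  rw [this, map_sub, map_mul, Pt.fΔ, midSum_eq, map_mul, h.fsum, ← hm]
  simp only [map_pow, map_neg, map_one]
  have e : (-1 : C) ^ (k + 1) * (-1) ^ (m + k) = - (-1) ^ m := by
    have : (-1 : C) ^ (k + 1) * (-1) ^ (m + k) = (-1) ^ (k + k) * (-1) ^ m * (-1) := by ring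
    rw [this, (Even.add_self k).neg_one_pow]; ring
  rw [← mul_assoc ((-1) ^ (k + 1)), e]; ring

theorem Pt.iff (h : Pt n k f x s) (hk : 1 ≤ k) (hkn : k ≤ n) (m : ℕ) (hm : m + k = n + 1) :
    (∀ g ∈ gens n k, f g = 0) ↔
    ((∀ r, m < r → r ≤ n → coeff r (PowerSeries.map f (DSer n k)) = 0) ∧
     ((coeff k x + coeff k s) * coeff m (PowerSeries.map f (DSer n k)) +
        coeff (n + 1) (upper k s * PowerSeries.map f (DSer n k)) = 0) ∧
     (coeff k s * coeff m (PowerSeries.map f (DSer n k)) +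
        coeff (n + 1) (upper k s * PowerSeries.map f (DSer n k)) = 0) ∧
     (∀ r, n + 1 < r → r ≤ n + k →
        coeff r (upper k s * PowerSeries.map f (DSer n k)) = 0) ∧
     (∀ r, k ≤ r → r ≤ n → coeff (2 * r) (s * sg (x + s)) = 0)) := by
  constructor
  · intro hg
    refine ⟨fun r h1 h2 => ?_, ?_, ?_, fun r h1 h2 => ?_, fun r h1 h2 => ?_⟩
    · have := hg (ΔDet n k r) (by
        left; left; left; left; exact ⟨r, ⟨by omega, h2⟩, rfl⟩)
      rwa [Pt.fΔ, neg_one_pow_mul_eq_zero] at this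
    · have := hg (tauGen n k k * ΔDet n k (n + 1 - k) - midSum n k) (by
        left; left; left; right; left; rfl)
      rwa [h.fmid m hm, neg_one_pow_mul_eq_zero, h.mid] at this
    · have := hg (tauGen' n k * ΔDet n k (n + 1 - k) - midSum n k) (by
        left; left; left; right; right; rfl)
      rwa [h.fmid m hm, neg_one_pow_mul_eq_zero, h.mid'] at this
    · have := hg (dSumRel n k r) (by
        left; left; right; exact ⟨r, ⟨by omega, h2⟩, rfl⟩)
      rwa [h.fsum, neg_one_pow_mul_eq_zero] at this
    · rcases h1.eq_or_lt with rfl | h1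
      · have := hg _ (by right; rfl)
        rwa [h.quadk, neg_one_pow_mul_eq_zero] at this
      · have := hg (dQuadRel n k r) (by
          left; right; exact ⟨r, ⟨by omega, h2⟩, rfl⟩)
        rwa [h.quad hk r h1, neg_one_pow_mul_eq_zero] at this
  · rintro ⟨ha, hb, hb', hc, hE⟩ g hg
    rcases hg with (((⟨r, hr, rfl⟩ | (rfl | rfl)) | ⟨r, hr, rfl⟩) | ⟨r, hr, rfl⟩) | rfl
    · rw [Pt.fΔ, neg_one_pow_mul_eq_zero]
      have := hr.1
      exact ha r (by omega) hr.2
    · rwa [h.fmid m hm, neg_one_pow_mul_eq_zero, h.mid]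
    · rwa [h.fmid m hm, neg_one_pow_mul_eq_zero, h.mid']
    · rw [h.fsum, neg_one_pow_mul_eq_zero]
      have := hr.1
      exact hc r (by omega) hr.2
    · have := hr.1
      rw [h.quad hk r (by omega), neg_one_pow_mul_eq_zero]
      exact hE r (by omega) hr.2
    · rw [h.quadk, neg_one_pow_mul_eq_zero]
      exact hE k le_rfl hkn

end
end

section
open PowerSeries

/-- reversed polynomial of a series -/
noncomputable def toP {C : Type} [CommRing C] (N : ℕ) (φ : C⟦X⟧) : Polynomial C :=
  Polynomial.reflect N (trunc (N + 1) φ)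

/-- series of a reversed polynomial -/
noncomputable def fromP {C : Type} [CommRing C] (N : ℕ) (P : Polynomial C) : C⟦X⟧ :=
  PowerSeries.mk fun r => if r ≤ N then P.coeff (N - r) else 0

section
variable {C D : Type} [CommRing C] [CommRing D]

theorem toP_coeff (N : ℕ) (φ : C⟦X⟧) (i : ℕ) :
    (toP N φ).coeff i = if i ≤ N then coeff (N - i) φ else 0 := by
  rw [toP, Polynomial.coeff_reflect, coeff_trunc]
  by_cases h : i ≤ N
  · rw [Polynomial.revAt_le h, if_pos h, if_pos (by omega)]
  · rw [if_neg h, Polynomial.revAt_eq_self_of_lt (by omega), if_neg (by omega)]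

theorem toP_map (g : C →+* D) (N : ℕ) (φ : C⟦X⟧) :
    (toP N φ).map g = toP N (PowerSeries.map g φ) := by
  ext i
  rw [Polynomial.coeff_map, toP_coeff, toP_coeff, coeff_map]
  split_ifs <;> simp

theorem fromP_map (g : C →+* D) (N : ℕ) (P : Polynomial C) :
    PowerSeries.map g (fromP N P) = fromP N (P.map g) := by
  ext i
  simp only [fromP, coeff_map, coeff_mk, Polynomial.coeff_map]
  split_ifs <;> simp

theorem toP_natDegree_le (N : ℕ) (φ : C⟦X⟧) : (toP N φ).natDegree ≤ N := by
  rw [Polynomial.natDegree_le_iff_coeff_eq_zero]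
  intro i hi
  rw [toP_coeff, if_neg (by omega)]

theorem toP_monic (N : ℕ) (φ : C⟦X⟧) (h : coeff 0 φ = 1) : (toP N φ).Monic := by
  apply Polynomial.monic_of_natDegree_le_of_coeff_eq_one N (toP_natDegree_le N φ)
  rw [toP_coeff]; simpa using h

theorem toP_natDegree [Nontrivial C] (N : ℕ) (φ : C⟦X⟧) (h : coeff 0 φ = 1) :
    (toP N φ).natDegree = N := by
  apply le_antisymm (toP_natDegree_le N φ)
  apply Polynomial.le_natDegree_of_ne_zero
  rw [toP_coeff]; simp at h; simp [h]

theorem fromP_supp (N : ℕ) (P : Polynomial C) (r : ℕ) (hr : N < r) : coeff r (fromP N P) = 0 := by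
  rw [fromP, coeff_mk, if_neg (by omega)]

theorem fromP_toP (N : ℕ) (φ : C⟦X⟧) (h : ∀ r, N < r → coeff r φ = 0) :
    fromP N (toP N φ) = φ := by
  ext r
  rw [fromP, coeff_mk]
  split_ifs with hr
  · rw [toP_coeff, if_pos (by omega), Nat.sub_sub_self hr]
  · rw [h r (by omega)]

theorem toP_fromP (N : ℕ) (P : Polynomial C) (h : P.natDegree ≤ N) : toP N (fromP N P) = P := by
  ext i
  rw [toP_coeff]
  split_ifs with hi
  · rw [fromP, coeff_mk, if_pos (by omega), Nat.sub_sub_self hi]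
  · rw [Polynomial.coeff_eq_zero_of_natDegree_lt (by omega)]

theorem coe_trunc_of_supp (N : ℕ) (φ : C⟦X⟧) (h : ∀ r, N < r → coeff r φ = 0) :
    ((trunc (N + 1) φ : Polynomial C) : C⟦X⟧) = φ := by
  ext r
  rw [Polynomial.coeff_coe, coeff_trunc]
  split_ifs with hr
  · rfl
  · rw [h r (by omega)]

theorem supp_mul (a b : ℕ) (φ ψ : C⟦X⟧) (hφ : ∀ r, a < r → coeff r φ = 0)
    (hψ : ∀ r, b < r → coeff r ψ = 0) (r : ℕ) (hr : a + b < r) : coeff r (φ * ψ) = 0 := by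
  rw [coeff_mul]
  refine Finset.sum_eq_zero ?_
  rintro ⟨i, j⟩ hij
  simp only [Finset.HasAntidiagonal.mem_antidiagonal] at hij
  dsimp only
  by_cases hi : a < i
  · rw [hφ i hi, zero_mul]
  · rw [hψ j (by omega), mul_zero]

theorem toP_mul (a b : ℕ) (φ ψ : C⟦X⟧) (hφ : ∀ r, a < r → coeff r φ = 0)
    (hψ : ∀ r, b < r → coeff r ψ = 0) : toP (a + b) (φ * ψ) = toP a φ * toP b ψ := by
  rw [toP, toP, toP, ← Polynomial.reflect_mul _ _
    (Nat.lt_succ_iff.mp (natDegree_trunc_lt φ a)) (Nat.lt_succ_iff.mp (natDegree_trunc_lt ψ b))]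
  congr 1
  rw [← Polynomial.coe_inj (R := C), coe_trunc_of_supp _ _ (supp_mul a b φ ψ hφ hψ), Polynomial.coe_mul,
    coe_trunc_of_supp _ _ hφ, coe_trunc_of_supp _ _ hψ]

theorem fromP_mul (a b : ℕ) (P Q : Polynomial C) (hP : P.natDegree ≤ a) (hQ : Q.natDegree ≤ b) :
    fromP (a + b) (P * Q) = fromP a P * fromP b Q := by
  conv_lhs => rw [← toP_fromP a P hP, ← toP_fromP b Q hQ]
  rw [← toP_mul _ _ _ _ (fromP_supp a P) (fromP_supp b Q), fromP_toP]
  exact supp_mul _ _ _ _ (fromP_supp a P) (fromP_supp b Q)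

theorem prodX_monic {k : ℕ} (y : Fin k → C) :
    (∏ j, (Polynomial.X - Polynomial.C (y j))).Monic :=
  Polynomial.monic_prod_of_monic _ _ fun j _ => Polynomial.monic_X_sub_C (y j)

theorem prodX_natDegree [Nontrivial C] {k : ℕ} (y : Fin k → C) :
    (∏ j, (Polynomial.X - Polynomial.C (y j))).natDegree = k := by
  rw [Polynomial.natDegree_prod_of_monic _ _ fun j _ => Polynomial.monic_X_sub_C (y j)]
  simp

theorem prodX_map {k : ℕ} (g : C →+* D) (y : Fin k → C) :
    (∏ j, (Polynomial.X - Polynomial.C (y j))).map g =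
      ∏ j, (Polynomial.X - Polynomial.C (g (y j))) := by
  simp [Polynomial.map_prod]

theorem fromP_zero [Nontrivial C] {k : ℕ} (y : Fin k → C) :
    coeff 0 (fromP k (∏ j, (Polynomial.X - Polynomial.C (y j)))) = 1 := by
  rw [fromP, coeff_mk, if_pos (by omega)]
  have := (prodX_monic y).coeff_natDegree
  rwa [prodX_natDegree] at this

theorem cofactor_deg [Nontrivial C] {k m : ℕ} (y : Fin k → C) (Q : Polynomial C)
    (h : ((∏ j, (Polynomial.X - Polynomial.C (y j))) * Q).natDegree ≤ k + m) :
    Q.natDegree ≤ m := by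
  by_cases hQ : Q = 0
  · simp [hQ]
  rw [(prodX_monic y).natDegree_mul' hQ, prodX_natDegree] at h
  omega

theorem prodX_eq_toP [Nontrivial C] {k : ℕ} (y : Fin k → C) (x : C⟦X⟧) (hx : coeff 0 x = 1)
    (h : (∏ j, (Polynomial.X - Polynomial.C (y j))) ∣ toP k x) :
    toP k x = ∏ j, (Polynomial.X - Polynomial.C (y j)) :=
  Polynomial.eq_of_monic_of_dvd_of_natDegree_le (prodX_monic y) (toP_monic k x hx) h
    (by rw [prodX_natDegree]; exact toP_natDegree_le k x)

theorem series_cancel (x a b : C⟦X⟧) (hx : coeff 0 x = 1) (h : x * a = x * b) : a = b := by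
  have h1 := PowerSeries.invOfUnit_mul x 1 (by simpa using hx)
  calc a = invOfUnit x 1 * (x * a) := by rw [← mul_assoc, h1, one_mul]
    _ = b := by rw [h, ← mul_assoc, h1, one_mul]

end
end

section
open PowerSeries

theorem neg_one_mul_zero {C : Type} [CommRing C] (a : C) (h : -1 * a = 0) : a = 0 := by
  simpa using h

theorem quad_quot {N : ℕ} {K : Type} [CommRing K] (s d : PowerSeries (MvPolynomial (Fin N) K))
    (ε : MvPolynomial (Fin N) K) (hε : ε = 1 ∨ ε = -1)
    (hs : ∀ a, PowerSeries.coeff a s ∈ LW K (fun i : Fin N => wt N (i + 1)) (wt N a + 1))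
    (hd : ∀ a, PowerSeries.coeff a d ∈ LW K (fun i : Fin N => wt N (i + 1)) (wt N a + 1))
    (hrr : ∀ i : Fin N, PowerSeries.coeff (i + 1 : ℕ) s * PowerSeries.coeff (i + 1 : ℕ) d
      - ε * MvPolynomial.X i ^ 2 ∈ LW K (fun i : Fin N => wt N (i + 1)) (2 * wt N (i + 1))) :
    ∃ (T : Type) (_ : CommRing T) (π : MvPolynomial (Fin N) K →+* T),
      Nonempty (T ≃+ (Fin (2 ^ N) → K)) ∧ Function.Surjective π ∧
      (∀ i : Fin N, π (coeff (2 * (i + 1)) (s * sg d)) = 0) ∧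
      (∀ (D : Type) [CommRing D] (f : MvPolynomial (Fin N) K →+* D),
        (∀ i : Fin N, f (coeff (2 * (i + 1)) (s * sg d)) = 0) → ∃ g : T →+* D, g.comp π = f) := by
  set q : Fin N → MvPolynomial (Fin N) K :=
    fun i => ε * ((-1) ^ (i + 1 : ℕ) * coeff (2 * (i + 1)) (s * sg d)) with hq
  have hlead := quad_series_lead s d ε hε hs hd hrr
  refine ⟨MvPolynomial (Fin N) K ⧸ Ideal.span (Set.range q), inferInstance, Ideal.Quotient.mk _,
    quad_free q hlead, Ideal.Quotient.mk_surjective, ?_, ?_⟩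
  · intro i
    have h1 : Ideal.Quotient.mk (Ideal.span (Set.range q)) (q i) = 0 :=
      Ideal.Quotient.eq_zero_iff_mem.mpr (Ideal.subset_span ⟨i, rfl⟩)
    simp only [hq] at h1
    rw [map_mul, map_mul, map_pow, map_neg, map_one] at h1
    rcases hε with rfl | rfl
    · rw [map_one, one_mul, neg_one_pow_mul_eq_zero] at h1
      exact h1
    · rw [map_neg, map_one] at h1
      have h2 := neg_one_mul_zero _ h1
      exact (neg_one_pow_mul_eq_zero _ _).mp h2
  · intro D _ f hf
    refine ⟨Ideal.Quotient.lift _ f ?_, ?_⟩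
    · intro a ha
      have : Ideal.span (Set.range q) ≤ RingHom.ker f := by
        rw [Ideal.span_le]
        rintro _ ⟨i, rfl⟩
        simp only [SetLike.mem_coe, RingHom.mem_ker, hq, map_mul, hf i, mul_zero]
      exact this ha
    · exact RingHom.ext fun a => rfl

/-- the universal polynomial series -/
noncomputable def tVar (n : ℕ) : PowerSeries (MvPolynomial (Fin n) ℤ) :=
  PowerSeries.mk fun p => if h : 1 ≤ p ∧ p ≤ n then MvPolynomial.X ⟨p - 1, by omega⟩ else 0

theorem B_exists (n : ℕ) : ∃ (B : Type) (_ : CommRing B) (t : B⟦X⟧),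
    coeff 0 t = 0 ∧ (∀ r, n < r → coeff r t = 0) ∧ (∀ r, coeff (2 * r) (t + t * sg t) = 0) ∧
    Nonempty (B ≃+ (Fin (2 ^ n) → ℤ)) ∧
    (∀ (D : Type) [CommRing D] (t' : D⟦X⟧), coeff 0 t' = 0 → (∀ r, n < r → coeff r t' = 0) →
      (∀ r, coeff (2 * r) (t' + t' * sg t') = 0) → ∃ g : B →+* D, PowerSeries.map g t = t') ∧
    (∀ (D : Type) [CommRing D] (g g' : B →+* D),
      PowerSeries.map g t = PowerSeries.map g' t → g = g') := by
  have hX : ∀ i : Fin n, coeff (i + 1 : ℕ) (tVar n) = MvPolynomial.X i := by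
    intro i
    rw [tVar, coeff_mk, dif_pos ⟨by omega, by omega⟩]; rfl
  have h0 : ∀ p, ¬ (1 ≤ p ∧ p ≤ n) → coeff p (tVar n) = 0 := by
    intro p hp
    rw [tVar, coeff_mk, dif_neg hp]
  have hs : ∀ a, PowerSeries.coeff a (tVar n) ∈
      LW ℤ (fun i : Fin n => wt n (i + 1)) (wt n a + 1) := by
    intro a
    by_cases ha : 1 ≤ a ∧ a ≤ n
    · obtain ⟨b, rfl⟩ : ∃ b, a = b + 1 := ⟨a - 1, by omega⟩
      have := LW_X (K := ℤ) (fun i : Fin n => wt n (i + 1)) ⟨b, by omega⟩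
      rw [← hX] at this
      exact this
    · rw [h0 a ha]; exact Submodule.zero_mem _
  have hd : ∀ a, PowerSeries.coeff a (1 + tVar n) ∈
      LW ℤ (fun i : Fin n => wt n (i + 1)) (wt n a + 1) := by
    intro a
    rw [map_add]
    refine Submodule.add_mem _ ?_ (hs a)
    rw [coeff_one]
    split_ifs
    · have := LW_C (fun i : Fin n => wt n (i + 1)) (1 : ℤ) (wt n a)
      rwa [map_one] at this
    · exact Submodule.zero_mem _
  obtain ⟨T, _, π, hT, hsurj, hz, huniv⟩ := quad_quot (tVar n) (1 + tVar n) 1 (Or.inl rfl) hs hd (by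
    intro i
    rw [map_add, hX, coeff_one, if_neg (by omega)]
    convert Submodule.zero_mem _ using 1
    ring)
  have key : ∀ {D : Type} [CommRing D] (t : D⟦X⟧), t * sg (1 + t) = t + t * sg t := by
    intro D _ t
    rw [map_add, map_one]; ring
  refine ⟨T, inferInstance, PowerSeries.map π (tVar n), ?_, ?_, ?_, hT, ?_, ?_⟩
  · rw [coeff_map, h0 0 (by omega), map_zero]
  · intro r hr
    rw [coeff_map, h0 r (by omega), map_zero]
  · intro r
    rw [← key, ← map_one (PowerSeries.map π), ← map_add, ← sg_map, ← map_mul, coeff_map]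
    by_cases hr : 1 ≤ r ∧ r ≤ n
    · have := hz ⟨r - 1, by omega⟩
      simp only [Nat.sub_add_cancel hr.1] at this
      exact this
    · rcases Nat.eq_zero_or_pos r with rfl | hr0
      · have h00 := h0 0 (by omega)
        simp only [mul_zero, coeff_zero_eq_constantCoeff] at h00 ⊢
        simp [h00]
      · have := coeff_two_mul_sg (tVar n) (1 + tVar n) r
        have hsum : ∑ i ∈ Finset.Icc 1 r, (-1) ^ i *
            (coeff (r + i) (tVar n) * coeff (r - i) (1 + tVar n)
            + coeff (r - i) (tVar n) * coeff (r + i) (1 + tVar n)) = 0 := by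
          refine Finset.sum_eq_zero fun i hi => ?_
          simp only [Finset.mem_Icc] at hi
          rw [h0 (r + i) (by omega), map_add _ 1, map_add _ 1, h0 (r + i) (by omega), coeff_one,
            coeff_one, if_neg (show r + i ≠ 0 by omega)]
          simp
        rw [hsum, h0 r hr, zero_mul, add_zero, neg_one_pow_mul_eq_zero] at this
        rw [this, map_zero]
  · intro D _ t' h1 h2 h3
    set F : MvPolynomial (Fin n) ℤ →+* D :=
      MvPolynomial.eval₂Hom (Int.castRingHom D) (fun i => coeff (i + 1 : ℕ) t') with hF
    have hm : PowerSeries.map F (tVar n) = t' := by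
      ext p
      rw [coeff_map]
      by_cases hp : 1 ≤ p ∧ p ≤ n
      · obtain ⟨b, rfl⟩ : ∃ b, p = b + 1 := ⟨p - 1, by omega⟩
        have := hX ⟨b, by omega⟩
        simp only at this
        rw [this, hF]; simp
      · rw [h0 p hp, map_zero]
        rcases Nat.eq_zero_or_pos p with rfl | hp0
        · exact h1.symm
        · exact (h2 p (by omega)).symm
    obtain ⟨g, hg⟩ := huniv D F (by
      intro i
      rw [← coeff_map, map_mul, sg_map, map_add, map_one, hm, key]
      exact h3 _)
    refine ⟨g, ?_⟩
    rw [← hm, ← hg]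
    ext; simp
  · intro D _ g g' h
    rw [← RingHom.cancel_right hsurj]
    apply MvPolynomial.ringHom_ext
    · intro a; simp
    · intro i
      have := congrArg (coeff (i + 1 : ℕ)) h
      simp only [coeff_map, hX] at this
      exact this

end

section
open PowerSeries

theorem Pt.map {n k : ℕ} {C D : Type} [CommRing C] [CommRing D] {f : DRing n k →+* C} {x s : C⟦X⟧}
    (h : Pt n k f x s) (g : C →+* D) :
    Pt n k (g.comp f) (PowerSeries.map g x) (PowerSeries.map g s) where
  x0 := by rw [coeff_map, h.x0, map_one]
  xk r hr := by rw [coeff_map, h.xk r hr, map_zero]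
  s0 := by rw [coeff_map, h.s0, map_zero]
  sn r hr := by rw [coeff_map, h.sn r hr, map_zero]
  lo p h1 h2 := by
    rw [RingHom.comp_apply, h.lo p h1 h2, coeff_map, coeff_map, map_add, map_mul, map_ofNat]
  mid := by rw [RingHom.comp_apply, h.mid, coeff_map, coeff_map, map_add]
  mid' := by rw [RingHom.comp_apply, h.mid', coeff_map]
  hi p h1 h2 := by rw [RingHom.comp_apply, h.hi p h1 h2, coeff_map]

theorem tauGen_X (n k : ℕ) (j : Fin (n + k)) :
    tauGen n k ((j + 1 : ℕ) : ℤ) = MvPolynomial.X (some j) := by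
  unfold tauGen
  rw [dif_pos ⟨by omega, by omega⟩]
  congr 2

theorem Pt.unique {n k : ℕ} {C : Type} [CommRing C] {f f' : DRing n k →+* C} {x s : C⟦X⟧}
    (h : Pt n k f x s) (h' : Pt n k f' x s) : f = f' := by
  apply MvPolynomial.ringHom_ext
  · intro a; simp
  · rintro (_ | j)
    · exact h.mid'.trans h'.mid'.symm
    · rw [← tauGen_X]
      rcases lt_trichotomy (j + 1 : ℕ) k with hj | hj | hj
      · rw [h.lo _ (by omega) hj, h'.lo _ (by omega) hj]
      · rw [hj, h.mid, h'.mid]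
      · rw [h.hi' _ hj, h'.hi' _ hj]

theorem Pt.exists {n k : ℕ} (hk : 1 ≤ k) {C : Type} [CommRing C] {x s : C⟦X⟧}
    (x0 : coeff 0 x = 1) (xk : ∀ r, k < r → coeff r x = 0)
    (s0 : coeff 0 s = 0) (sn : ∀ r, n + k < r → coeff r s = 0) :
    ∃ f : DRing n k →+* C, Pt n k f x s := by
  let v : Option (Fin (n + k)) → C := fun o => match o with
    | none => coeff k s
    | some j => if (j + 1 : ℕ) < k then coeff (j + 1 : ℕ) x + 2 * coeff (j + 1 : ℕ) s
        else if (j + 1 : ℕ) = k then coeff k x + coeff k s else coeff (j + 1 : ℕ) s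
  have hv : ∀ p : ℕ, 1 ≤ p → p ≤ n + k →
      MvPolynomial.eval₂Hom (Int.castRingHom C) v (tauGen n k p) =
       if p < k then coeff p x + 2 * coeff p s
        else if p = k then coeff k x + coeff k s else coeff p s := by
    intro p h1 h2
    obtain ⟨b, rfl⟩ : ∃ b, p = b + 1 := ⟨p - 1, by omega⟩
    have := tauGen_X n k ⟨b, by omega⟩
    simp only at this
    rw [this, MvPolynomial.eval₂Hom_X']
  refine ⟨MvPolynomial.eval₂Hom (Int.castRingHom C) v, x0, xk, s0, sn, ?_, ?_, ?_, ?_⟩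
  · intro p h1 h2
    rw [hv p h1 (by omega), if_pos h2]
  · rw [hv k hk (by omega), if_neg (by omega), if_pos rfl]
  · rw [tauGen', MvPolynomial.eval₂Hom_X']
  · intro p h1 h2
    rw [hv p (by omega) h2, if_neg (by omega), if_neg (by omega)]

/-- the quotient ring -/
abbrev AQ (n k : ℕ) := DRing n k ⧸ Ideal.span (gens n k)

/-- constants in the extension -/
noncomputable def cst (n k : ℕ) : DRing n k →+* MvPolynomial (Fin (k - 1)) (AQ n k) :=
  MvPolynomial.C.comp (Ideal.Quotient.mk _)

/-- series of the `s_p` -/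
noncomputable def sVar (n k : ℕ) : PowerSeries (MvPolynomial (Fin (k - 1)) (AQ n k)) :=
  PowerSeries.mk fun p => if h : 1 ≤ p ∧ p ≤ k - 1 then MvPolynomial.X ⟨p - 1, by omega⟩
    else cst n k (if p = 0 then 0 else if p = k then tauGen' n k else tauGen n k p)

/-- series of the `x_p` -/
noncomputable def xVar (n k : ℕ) : PowerSeries (MvPolynomial (Fin (k - 1)) (AQ n k)) :=
  PowerSeries.mk fun p => if 1 ≤ p ∧ p ≤ k - 1 then cst n k (tauGen n k p) - 2 * coeff p (sVar n k)
    else cst n k (if p = 0 then 1 else if p = k then tauGen n k k - tauGen' n k else 0)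

theorem sVar_X (n k : ℕ) (i : Fin (k - 1)) :
    coeff (i + 1 : ℕ) (sVar n k) = MvPolynomial.X i := by
  rw [sVar, coeff_mk, dif_pos ⟨by omega, by omega⟩]; rfl

theorem xsVar_pt (n k : ℕ) (hk : 1 ≤ k) : Pt n k (cst n k) (xVar n k) (sVar n k) where
  x0 := by rw [xVar, coeff_mk, if_neg (by omega), if_pos rfl, map_one]
  xk r hr := by rw [xVar, coeff_mk, if_neg (by omega), if_neg (by omega), if_neg (by omega), map_zero]
  s0 := by rw [sVar, coeff_mk, dif_neg (by omega), if_pos rfl, map_zero]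
  sn r hr := by
    rw [sVar, coeff_mk, dif_neg (by omega), if_neg (by omega), if_neg (by omega),
      tauGen_big n k r hr, map_zero]
  lo p h1 h2 := by rw [xVar, coeff_mk, if_pos (by omega)]; ring
  mid := by
    rw [xVar, sVar, coeff_mk, coeff_mk, if_neg (by omega), if_neg (by omega), if_pos rfl,
      dif_neg (by omega), if_neg (by omega), if_pos rfl, map_sub]; ring
  mid' := by
    rw [sVar, coeff_mk, dif_neg (by omega), if_neg (by omega), if_pos rfl]
  hi p h1 h2 := by
    rw [sVar, coeff_mk, dif_neg (by omega), if_neg (by omega), if_neg (by omega)]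

theorem A_exists (n k : ℕ) (hk : 1 ≤ k) :
    ∃ (A' : Type) (_ : CommRing A') (i : DRing n k →+* A') (x s : A'⟦X⟧),
    Pt n k i x s ∧ (∀ g ∈ gens n k, i g = 0) ∧
    (∀ r, 1 ≤ r → r < k → coeff (2 * r) (s * sg (x + s)) = 0) ∧
    Nonempty (A' ≃+ (Fin (2 ^ (k - 1)) → AQ n k)) ∧
    (∀ (D : Type) [CommRing D] (f : DRing n k →+* D) (x' s' : D⟦X⟧), Pt n k f x' s' →
      (∀ g ∈ gens n k, f g = 0) → (∀ r, 1 ≤ r → r < k → coeff (2 * r) (s' * sg (x' + s')) = 0) →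
      ∃ g : A' →+* D, PowerSeries.map g x = x' ∧ PowerSeries.map g s = s') ∧
    (∀ (D : Type) [CommRing D] (g g' : A' →+* D), PowerSeries.map g x = PowerSeries.map g' x →
      PowerSeries.map g s = PowerSeries.map g' s → g = g') := by
  have hpt := xsVar_pt n k hk
  have hC : ∀ (a : DRing n k) (W : ℕ),
      cst n k a ∈ LW (AQ n k) (fun i : Fin (k - 1) => wt (k - 1) (i + 1)) (W + 1) :=
    fun a W => LW_C _ _ W
  have hs : ∀ a, PowerSeries.coeff a (sVar n k) ∈
      LW (AQ n k) (fun i : Fin (k - 1) => wt (k - 1) (i + 1)) (wt (k - 1) a + 1) := by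
    intro a
    by_cases ha : 1 ≤ a ∧ a ≤ k - 1
    · obtain ⟨b, rfl⟩ : ∃ b, a = b + 1 := ⟨a - 1, by omega⟩
      have := LW_X (K := AQ n k) (fun i : Fin (k - 1) => wt (k - 1) (i + 1)) ⟨b, by omega⟩
      rw [← sVar_X] at this
      exact this
    · rw [sVar, coeff_mk, dif_neg ha]; exact hC _ _
  have hsum : ∀ p, 1 ≤ p ∧ p ≤ k - 1 → coeff p (xVar n k + sVar n k) =
      cst n k (tauGen n k p) - coeff p (sVar n k) := by
    intro p hp
    rw [map_add, xVar, coeff_mk, if_pos hp]; ring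
  have hd : ∀ a, PowerSeries.coeff a (xVar n k + sVar n k) ∈
      LW (AQ n k) (fun i : Fin (k - 1) => wt (k - 1) (i + 1)) (wt (k - 1) a + 1) := by
    intro a
    by_cases ha : 1 ≤ a ∧ a ≤ k - 1
    · rw [hsum a ha]
      exact Submodule.sub_mem _ (hC _ _) (hs a)
    · rw [map_add]
      refine Submodule.add_mem _ ?_ (hs a)
      rw [xVar, coeff_mk, if_neg ha]; exact hC _ _
  obtain ⟨T, _, π, hT, hsurj, hz, huniv⟩ := quad_quot (sVar n k) (xVar n k + sVar n k) (-1)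
    (Or.inr rfl) hs hd (by
      intro i
      have e : coeff (i + 1 : ℕ) (sVar n k) * coeff (i + 1 : ℕ) (xVar n k + sVar n k)
        - -1 * MvPolynomial.X i ^ 2 = MvPolynomial.X i * cst n k (tauGen n k ((i + 1 : ℕ) : ℤ)) := by
        rw [hsum _ ⟨by omega, by omega⟩, sVar_X]; ring
      rw [e, two_mul]
      apply LW_mul (LW_X _ i)
      have hw : 0 < wt (k - 1) (i + 1) := by
        rw [wt, if_pos ⟨by omega, by omega⟩]
        have : (i + 1 : ℕ) ^ 2 ≤ (k - 1 + 1) ^ 2 := Nat.pow_le_pow_left (by omega) 2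
        have h2 : 0 < (k - 1 + 1) ^ 2 := by positivity
        omega
      obtain ⟨W, hW⟩ := Nat.exists_eq_succ_of_ne_zero hw.ne'
      rw [hW]
      exact hC _ _)
  refine ⟨T, inferInstance, π.comp (cst n k), PowerSeries.map π (xVar n k),
    PowerSeries.map π (sVar n k), hpt.map π, ?_, ?_, hT, ?_, ?_⟩
  · intro g hg
    have : Ideal.Quotient.mk (Ideal.span (gens n k)) g = 0 :=
      Ideal.Quotient.eq_zero_iff_mem.mpr (Ideal.subset_span hg)
    simp [cst, this]
  · intro r h1 h2
    rw [← map_add, ← sg_map, ← map_mul, coeff_map]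
    have := hz ⟨r - 1, by omega⟩
    simp only [Nat.sub_add_cancel h1] at this
    exact this
  · intro D _ f x' s' hp hg hq
    have hker : ∀ a ∈ Ideal.span (gens n k), f a = 0 := by
      intro a ha
      have : Ideal.span (gens n k) ≤ RingHom.ker f := by
        rw [Ideal.span_le]
        exact fun b hb => hg b hb
      exact this ha
    set F : MvPolynomial (Fin (k - 1)) (AQ n k) →+* D :=
      MvPolynomial.eval₂Hom (Ideal.Quotient.lift _ f hker) (fun i => coeff (i + 1 : ℕ) s') with hF
    have hFc : ∀ a, F (cst n k a) = f a := by
      intro a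
      rw [hF, cst, RingHom.comp_apply, MvPolynomial.eval₂Hom_C]
      rfl
    have hms : PowerSeries.map F (sVar n k) = s' := by
      ext p
      rw [coeff_map]
      by_cases hp' : 1 ≤ p ∧ p ≤ k - 1
      · obtain ⟨b, rfl⟩ : ∃ b, p = b + 1 := ⟨p - 1, by omega⟩
        have := sVar_X n k ⟨b, by omega⟩
        simp only at this
        rw [this, hF, MvPolynomial.eval₂Hom_X']
      · rw [sVar, coeff_mk, dif_neg hp', hFc]
        split_ifs with h1 h2
        · rw [h1, hp.s0, map_zero]
        · rw [h2, hp.mid']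
        · exact hp.hi' p (by omega)
    have hmx : PowerSeries.map F (xVar n k) = x' := by
      ext p
      rw [coeff_map, xVar, coeff_mk]
      by_cases hp' : 1 ≤ p ∧ p ≤ k - 1
      · rw [if_pos hp', map_sub, map_mul, map_ofNat, ← coeff_map F, hms, hFc,
          hp.lo p hp'.1 (by omega)]; ring
      · rw [if_neg hp', hFc]
        split_ifs with h1 h2
        · rw [h1, hp.x0, map_one]
        · rw [h2, map_sub, hp.mid, hp.mid']; ring
        · rw [hp.xk p (by omega), map_zero]
    obtain ⟨g, hg⟩ := huniv D F (by
      intro i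
      rw [← coeff_map, map_mul, sg_map, map_add, hms, hmx]
      exact hq _ (by omega) (by omega))
    refine ⟨g, ?_, ?_⟩
    · rw [← hmx, ← hg]
      ext; simp
    · rw [← hms, ← hg]
      ext; simp
  · intro D _ g g' hx hs'
    have hcst : (g.comp π).comp (cst n k) = (g'.comp π).comp (cst n k) := by
      have e1 := (hpt.map π).map g
      have e2 := (hpt.map π).map g'
      rw [← hx, ← hs'] at e2
      exact e1.unique e2
    rw [← RingHom.cancel_right hsurj]
    apply MvPolynomial.ringHom_ext
    · intro a
      obtain ⟨b, rfl⟩ := Ideal.Quotient.mk_surjective a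
      exact congrArg (fun h => h b) hcst
    · intro i
      have := congrArg (coeff (i + 1 : ℕ)) hs'
      simp only [coeff_map, sVar_X] at this
      exact this

end

section
open PowerSeries

theorem main_iso (n k : ℕ) (hk : 1 ≤ k) (hkn : k ≤ n) :
    ∃ M M' : ℕ, M = k.descFactorial k * 2 ^ (k - 1) ∧ M' = (n + 1).descFactorial k * 2 ^ n ∧
      Nonempty ((Fin M → AQ n k) ≃+ (Fin M' → ℤ)) := by
  obtain ⟨m, hm⟩ : ∃ m, m + k = n + 1 := ⟨n + 1 - k, by omega⟩
  obtain ⟨B, _, t, ht0, htn, htq, ⟨eB⟩, Buniv, Buniq⟩ := B_exists n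
  obtain ⟨A', _, i, x, s, hpt, hgens, hquad, hA, Auniv, Auniq⟩ := A_exists n k hk
  have hBn : Nontrivial B := eB.toEquiv.nontrivial
  have hone : ∀ {D : Type} [CommRing D] (t : D⟦X⟧), coeff 0 t = 0 → coeff 0 (1 + 2 * sg t) = 1 := by
    intro D _ t h
    rw [map_add, coeff_two_mul, coeff_sg, h]; simp
  have hmapone : ∀ {C D : Type} [CommRing C] [CommRing D] (g : C →+* D) (t : C⟦X⟧),
      PowerSeries.map g (1 + 2 * sg t) = 1 + 2 * sg (PowerSeries.map g t) := by
    intro C D _ _ g t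
    rw [map_add, map_mul, map_one, map_ofNat, sg_map]
  obtain ⟨E', _, i', y', hdvd', ⟨eE'⟩, E'univ, E'uniq⟩ := tower k B (toP (n + 1) (1 + 2 * sg t)) (n + 1)
    (toP_monic _ _ (hone t ht0)) (toP_natDegree _ _ (hone t ht0)) (by omega)
  have hE'n : Nontrivial E' := by
    have : Nonempty (Fin ((n + 1).descFactorial k)) :=
      ⟨⟨0, Nat.pos_of_ne_zero (by rw [Ne, Nat.descFactorial_eq_zero_iff_lt]; omega)⟩⟩
    exact eE'.toEquiv.nontrivial
  -- the point in E'
  obtain ⟨Q, hQ⟩ := hdvd'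
  rw [toP_map, hmapone] at hQ
  set t' := PowerSeries.map i' t with ht'
  set x' := fromP k (∏ j, (Polynomial.X - Polynomial.C (y' j))) with hx'
  have hQd : Q.natDegree ≤ m := by
    apply cofactor_deg y' Q
    rw [← hQ, add_comm k m, hm]
    exact toP_natDegree_le _ _
  have ht'0 : coeff 0 t' = 0 := by rw [ht', coeff_map, ht0, map_zero]
  have ht'n : ∀ r, n < r → coeff r t' = 0 := by
    intro r hr; rw [ht', coeff_map, htn r hr, map_zero]
  have ht'q : ∀ r, coeff (2 * r) (t' + t' * sg t') = 0 := by
    intro r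
    rw [ht', ← sg_map, ← map_mul, ← map_add, coeff_map, htq, map_zero]
  have hxv : x' * fromP m Q = 1 + 2 * sg t' := by
    rw [hx', ← fromP_mul _ _ _ _ (prodX_natDegree y').le hQd, ← hQ, add_comm k m, hm, fromP_toP]
    intro r hr
    rw [map_add, coeff_two_mul, coeff_sg, ht'n r (by omega), coeff_one, if_neg (by omega)]
    simp
  have hx'0 : coeff 0 x' = 1 := fromP_zero y'
  have hx'k : ∀ r, k < r → coeff r x' = 0 := fromP_supp k _
  set s' := x' * t' with hs'
  have hs'0 : coeff 0 s' = 0 := by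
    rw [coeff_zero_eq_constantCoeff_apply] at ht'0 ⊢
    rw [hs', map_mul, ht'0, mul_zero]
  have hs'n : ∀ r, n + k < r → coeff r s' = 0 := by
    intro r hr
    exact supp_mul k n _ _ hx'k ht'n r (by omega)
  obtain ⟨f, hf⟩ := Pt.exists (n := n) hk hx'0 hx'k hs'0 hs'n
  obtain ⟨r1, r2, r3, r4, r5⟩ := relations_of_point n k m hk hm x' s' t'
    (PowerSeries.map f (DSer n k)) (fromP m Q) hx'k ht'0 hs' (hf.cmulD hk) ht'n ht'q
    (fromP_supp m Q) hxv
  obtain ⟨g0, hg0x, hg0s⟩ := Auniv E' f x' s' hf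
    ((hf.iff hk hkn m hm).mpr ⟨fun r h _ => r1 r h, r2, r3, fun r h _ => r4 r h, fun r _ _ => r5 r⟩)
    (fun r _ _ => r5 r)
  have hA'n : Nontrivial A' := g0.domain_nontrivial
  obtain ⟨E, _, iE, y, hdvd, eE, Euniv, Euniq⟩ := tower k A' (toP k x) k
    (toP_monic _ _ hpt.x0) (toP_natDegree _ _ hpt.x0) le_rfl
  obtain ⟨φ, hφi, hφy⟩ := Euniv E' g0 y' (by
    rw [toP_map, hg0x, hx', toP_fromP _ _ (prodX_natDegree y').le])
  have hEn : Nontrivial E := φ.domain_nontrivial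
  -- the point in A'
  have hinv := PowerSeries.mul_invOfUnit x 1 (by simpa using hpt.x0)
  obtain ⟨tA, htA⟩ : ∃ tA : A'⟦X⟧, s = x * tA :=
    ⟨invOfUnit x 1 * s, by rw [← mul_assoc, hinv, one_mul]⟩
  have htA0 : coeff 0 tA = 0 := by
    have h1 := hpt.s0
    have h2 := hpt.x0
    rw [coeff_zero_eq_constantCoeff_apply] at h1 h2 ⊢
    rw [htA, map_mul, h2, one_mul] at h1
    exact h1
  obtain ⟨q1, q2, q3, q4, q5⟩ := (hpt.iff hk hkn m hm).mp hgens
  obtain ⟨p1, p2, p3, p4⟩ := point_of_relations n k m hk hkn hm x s tA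
    (PowerSeries.map i (DSer n k)) hpt.x0 hpt.xk htA0 hpt.sn htA (hpt.cmulD hk) q1 q2 q3 q4
    (by
      intro r h1 h2
      by_cases h3 : r < k
      · exact hquad r h1 h3
      · exact q5 r (by omega) h2)
  obtain ⟨g1, hg1⟩ := Buniv A' tA htA0 p1 p2
  rw [toP_map] at hdvd
  obtain ⟨ψ, hψi, hψy⟩ := E'univ E (iE.comp g1) y (by
    have e : (toP (n + 1) (1 + 2 * sg t)).map (iE.comp g1) =
        toP k (PowerSeries.map iE x) * (toP m (PowerSeries.map i (DSer n k))).map iE := by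
      rw [← Polynomial.map_map, toP_map, hmapone, hg1, ← p4, ← hm, add_comm m k,
        toP_mul _ _ _ _ hpt.xk p3, Polynomial.map_mul, toP_map iE k x]
    rw [e]
    exact hdvd.mul_right _)
  have hmm : ∀ {C D F : Type} [CommRing C] [CommRing D] [CommRing F] (g : C →+* D) (h : D →+* F)
      (a : C⟦X⟧), PowerSeries.map (h.comp g) a = PowerSeries.map h (PowerSeries.map g a) := by
    intro C D F _ _ _ g h a
    ext; simp
  have h1 : φ.comp ψ = RingHom.id E' := by
    apply E'uniq
    · rw [RingHom.comp_assoc, hψi, ← RingHom.comp_assoc, hφi, RingHom.id_comp]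
      apply Buniq
      rw [hmm, hg1, ← ht']
      apply series_cancel x' _ _ hx'0
      rw [← hs', ← hg0s, ← hg0x, htA, map_mul]
    · intro j; simp [hφy, hψy]
  have h2 : ψ.comp φ = RingHom.id E := by
    have hx2 : PowerSeries.map ψ x' = PowerSeries.map iE x := by
      rw [hx', fromP_map, prodX_map]
      simp only [hψy]
      rw [← prodX_eq_toP y (PowerSeries.map iE x) (by rw [coeff_map, hpt.x0, map_one]) hdvd,
        fromP_toP]
      intro r hr
      rw [coeff_map, hpt.xk r hr, map_zero]
    apply Euniq
    · rw [RingHom.comp_assoc, hφi, RingHom.id_comp]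
      apply Auniq
      · rw [hmm, hg0x, hx2]
      · rw [hmm, hg0s, hs', map_mul, hx2, ht', ← hmm, hψi, hmm, hg1, ← map_mul, ← htA]
    · intro j; simp [hφy, hψy]
  have e : E ≃+* E' := RingEquiv.ofRingHom φ ψ h1 h2
  obtain ⟨a1⟩ := fin_fin_addEquiv eE hA
  obtain ⟨a2⟩ := fin_fin_addEquiv ⟨eE'⟩ ⟨eB⟩
  exact ⟨_, _, rfl, rfl, ⟨a1.symm.trans (e.toAddEquiv.trans a2)⟩⟩

theorem free_rank (A : Type) [AddCommGroup A] [Module ℤ A] (M M' R : ℕ) (hM : 0 < M) (h : M' = M * R)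
    (e : (Fin M → A) ≃+ (Fin M' → ℤ)) : Module.Free ℤ A ∧ Module.rank ℤ A = (R : Cardinal) := by
  let _ : Module ℤ (Fin M → A) := Pi.module (Fin M) (fun _ => A) ℤ
  let e' : (Fin M → A) ≃ₗ[ℤ] (Fin M' → ℤ) := e.toIntLinearEquiv
  have hf : Module.Finite ℤ (Fin M → A) := Module.Finite.equiv e'.symm
  have hfA : Module.Finite ℤ A :=
    Module.Finite.of_surjective (LinearMap.proj (R := ℤ) (φ := fun _ : Fin M => A) ⟨0, hM⟩)
      (fun a => ⟨fun _ => a, rfl⟩)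
  let j : A →ₗ[ℤ] (Fin M' → ℤ) := e'.toLinearMap.comp (LinearMap.single ℤ (fun _ : Fin M => A) ⟨0, hM⟩)
  have hj : Function.Injective j := e'.injective.comp (Pi.single_injective (M := fun _ : Fin M => A) ⟨0, hM⟩)
  have htf : Module.IsTorsionFree ℤ A := hj.moduleIsTorsionFree j (fun c x => j.map_smul c x)
  have hfree : Module.Free ℤ A := inferInstance
  refine ⟨hfree, ?_⟩
  have h1 := e'.finrank_eq
  rw [Module.finrank_pi_fintype, Module.finrank_pi] at h1
  simp only [Finset.sum_const, Finset.card_univ, Fintype.card_fin, smul_eq_mul] at h1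
  rw [h] at h1
  rw [← Module.finrank_eq_rank, Nat.eq_of_mul_eq_mul_left hM h1]

theorem OG_aux (n k : ℕ) (hk : 1 ≤ k) (hkn : k ≤ n) :
    Module.Free ℤ (AQ n k) ∧
      Module.rank ℤ (AQ n k) = (2 ^ (n + 1 - k) * (n + 1).choose k : Cardinal) := by
  obtain ⟨M, M', hM, hM', ⟨e⟩⟩ := main_iso n k hk hkn
  have := free_rank (AQ n k) M M' (2 ^ (n + 1 - k) * (n + 1).choose k) (by
    rw [hM, Nat.descFactorial_self]; positivity) (by
    have : 2 ^ n = 2 ^ (k - 1) * 2 ^ (n + 1 - k) := by rw [← pow_add]; congr 1; omega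
    rw [hM, hM', Nat.descFactorial_self, Nat.descFactorial_eq_factorial_mul_choose, this]; ring) e
  refine ⟨this.1, ?_⟩
  rw [this.2]; push_cast; rfl

end

open MvPolynomial

/-- **Presentation of `H^*(OG(n+1−k,2n+2);ℤ)`.** The quotient of
`ℤ[τ_1,…,τ_k,τ'_k,τ_{k+1},…,τ_{n+k}]` by the stated relations is a free
`ℤ`-module of rank `2^{n+1−k} · binom(n+1,k)`. -/
theorem OGeven_presentation_free_rank (n k : ℕ) (hn : 1 ≤ n) (hk₁ : 1 ≤ k)
    (hk₂ : k ≤ n) :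
    Module.Free ℤ (DRing n k ⧸
      Ideal.span (ΔDet n k '' Set.Icc (n - k + 2) n ∪
        {tauGen n k k * ΔDet n k (n + 1 - k) - midSum n k,
         tauGen' n k * ΔDet n k (n + 1 - k) - midSum n k} ∪
        dSumRel n k '' Set.Icc (n + 2) (n + k) ∪
        dQuadRel n k '' Set.Icc (k + 1) n ∪
        {tauGen n k k * tauGen' n k +
          ∑ i ∈ Finset.Icc 1 k,
            (-1 : DRing n k) ^ i * tauGen n k (k + i) * tauGen n k ((k : ℤ) - i)})) ∧
    Module.rank ℤ (DRing n k ⧸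
      Ideal.span (ΔDet n k '' Set.Icc (n - k + 2) n ∪
        {tauGen n k k * ΔDet n k (n + 1 - k) - midSum n k,
         tauGen' n k * ΔDet n k (n + 1 - k) - midSum n k} ∪
        dSumRel n k '' Set.Icc (n + 2) (n + k) ∪
        dQuadRel n k '' Set.Icc (k + 1) n ∪
        {tauGen n k k * tauGen' n k +
          ∑ i ∈ Finset.Icc 1 k,
            (-1 : DRing n k) ^ i * tauGen n k (k + i) * tauGen n k ((k : ℤ) - i)})) =
      (2 ^ (n + 1 - k) * (n + 1).choose k : Cardinal) := by
  exact OG_aux n k hk₁ hk₂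
end
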